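/- As a ℤ[1/2]-module, RP′(ℚ)[1/2] is isomorphic to (⊕_{p prime} ℤ/(p+1)′) ⊕ ℤ/3 ⊕ V, where m′ denotes the odd part of m and V is a free ℤ[1/2]-module of countably infinite rank. -/

import Mathlib

open scoped Classical

noncomputable section

variable (F : Type) [Field F]

/-- The group of square classes `G_F = F^× / (F^×)²`. -/
def SqCl (F : Type) [Field F] : Type :=
  Fˣ ⧸ (powMonoidHom 2 : Fˣ →* Fˣ).range

instance : CommGroup (SqCl F) := QuotientGroup.Quotient.commGroup _

/-- The square class of a unit. -/
def sqc : Fˣ →* SqCl F := QuotientGroup.mk' _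

/-- The group ring `R_F = ℤ[F^×/(F^×)²]`. -/
abbrev RF (F : Type) [Field F] : Type := MonoidAlgebra ℤ (SqCl F)

/-- `⟨x⟩ ∈ R_F`, the square class of a unit as an element of the group ring. -/
def cls (x : Fˣ) : RF F := MonoidAlgebra.of ℤ (SqCl F) (sqc F x)

/-- The free `R_F`-module on the set `F^×`. -/
abbrev FreeRP (F : Type) [Field F] : Type := Fˣ →₀ RF F

/-- The generator `[x]` of the free module. -/
def gen (x : Fˣ) : FreeRP F := Finsupp.single x 1

/-- units from nonzero field elements -/
def U (x : F) (h : x ≠ 0) : Fˣ := Units.mk0 x h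

variable {F}

theorem one_sub_ne {x : Fˣ} (hx : (x : F) ≠ 1) : (1 : F) - x ≠ 0 :=
  sub_ne_zero.mpr (Ne.symm hx)

theorem inv_sub_one_ne {x : Fˣ} (hx : (x : F) ≠ 1) : ((x : F)⁻¹ - 1) ≠ 0 :=
  sub_ne_zero.mpr (fun h => hx (by rwa [inv_eq_one] at h))

theorem one_sub_inv_ne {x : Fˣ} (hx : (x : F) ≠ 1) : (1 - (x : F)⁻¹) ≠ 0 :=
  sub_ne_zero.mpr (fun h => hx (by rw [eq_comm, inv_eq_one] at h; exact h.symm ▸ rfl))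

variable (F)

/-- The five term relation `S_{x,y}` as an element of the free module. -/
def FT (x y : Fˣ) (hx : (x : F) ≠ 1) (hy : (y : F) ≠ 1) : FreeRP F :=
  gen F x - gen F y + cls F x • gen F (y * x⁻¹)
    - cls F (U F ((x : F)⁻¹ - 1) (inv_sub_one_ne hx)) •
        gen F (U F ((1 - (x : F)⁻¹) / (1 - (y : F)⁻¹))
          (div_ne_zero (one_sub_inv_ne hx) (one_sub_inv_ne hy)))
    + cls F (U F (1 - (x : F)) (one_sub_ne hx)) •
        gen F (U F ((1 - (x : F)) / (1 - (y : F)))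
          (div_ne_zero (one_sub_ne hx) (one_sub_ne hy)))

/-- The set of five-term relations. -/
def ftRels : Set (FreeRP F) :=
  {w | ∃ (x y : Fˣ) (hx : (x : F) ≠ 1) (hy : (y : F) ≠ 1), w = FT F x y hx hy}

/-- The relations `ψ₁(x) = [x] + ⟨-1⟩[x⁻¹]`. -/
def psiRels : Set (FreeRP F) :=
  {w | ∃ x : Fˣ, w = gen F x + cls F (-1) • gen F x⁻¹}

/-- relations `⟨-1⟩[x] = [x]` -/
def minusRels : Set (FreeRP F) :=
  {w | ∃ x : Fˣ, w = cls F (-1) • gen F x - gen F x}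

/-- relations `[x⁻¹] = -[x]` -/
def invRels : Set (FreeRP F) :=
  {w | ∃ x : Fˣ, w = gen F x⁻¹ + gen F x}

/-- The module `qRP(F) = RP(F)/⟨ψ₁(x) : x ∈ F^×⟩`. -/
def qRP : Type := FreeRP F ⧸ Submodule.span (RF F) (ftRels F ∪ psiRels F)

instance : AddCommGroup (qRP F) := by unfold qRP; infer_instance
instance : Module (RF F) (qRP F) := by unfold qRP; infer_instance

/-- `[x] ∈ qRP(F)` -/
def qrp (x : Fˣ) : qRP F := Submodule.Quotient.mk (gen F x)

/-- The module `RP′(F)`. -/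
def RP' : Type :=
  FreeRP F ⧸ Submodule.span (RF F)
    ({gen F 1} ∪ ftRels F ∪ minusRels F ∪ invRels F)

instance : AddCommGroup (RP' F) := by unfold RP'; infer_instance
instance : Module (RF F) (RP' F) := by unfold RP'; infer_instance

/-- `[x] ∈ RP′(F)` -/
def rp (x : Fˣ) : RP' F := Submodule.Quotient.mk (gen F x)

/-- the submodule of `M` generated by the elements `(⟨a⟩ - χ(a))·m`. -/
def chiSub (χ : SqCl F →* ℤˣ) (M : Type) [AddCommGroup M] [Module (RF F) M] :
    Submodule (RF F) M :=
  Submodule.span (RF F)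
    {w | ∃ (a : Fˣ) (m : M), w = cls F a • m - ((χ (sqc F a) : ℤ)) • m}

/-- `M_χ` -/
def ChiQuot (χ : SqCl F →* ℤˣ) (M : Type) [AddCommGroup M] [Module (RF F) M] : Type :=
  M ⧸ chiSub F χ M

instance (χ : SqCl F →* ℤˣ) (M : Type) [AddCommGroup M] [Module (RF F) M] :
    AddCommGroup (ChiQuot F χ M) := by unfold ChiQuot; infer_instance
instance (χ : SqCl F →* ℤˣ) (M : Type) [AddCommGroup M] [Module (RF F) M] :
    Module (RF F) (ChiQuot F χ M) := by unfold ChiQuot; infer_instance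

/-- image of `m` in `M_χ` -/
def mkChi (χ : SqCl F →* ℤˣ) {M : Type} [AddCommGroup M] [Module (RF F) M] (m : M) :
    ChiQuot F χ M := Submodule.Quotient.mk m

/-- `M[1/2]`, as an `R_F`-module (localization at the powers of `2`). -/
def Loc2 (M : Type) [AddCommGroup M] [Module (RF F) M] : Type :=
  LocalizedModule (Submonoid.powers (2 : RF F)) M

instance (M : Type) [AddCommGroup M] [Module (RF F) M] : AddCommGroup (Loc2 F M) := by
  unfold Loc2; infer_instance
instance (M : Type) [AddCommGroup M] [Module (RF F) M] : Module (RF F) (Loc2 F M) := by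
  unfold Loc2; infer_instance

/-- the canonical map `M → M[1/2]` -/
def toLoc2 {M : Type} [AddCommGroup M] [Module (RF F) M] (m : M) : Loc2 F M :=
  LocalizedModule.mkLinearMap (Submonoid.powers (2 : RF F)) M m


/-- the square class of a field element (junk value `1` at `0`). -/
def sqv (a : F) : SqCl F := if h : a ≠ 0 then sqc F (U F a h) else 1

/-- `[a] ∈ RP′(F)` for a field element `a`, where `[0]` is assigned the value `c₀`. -/
def rpc (c₀ : RP' F) (a : F) : RP' F := if h : a ≠ 0 then rp F (U F a h) else c₀

end

noncomputable section

/-- the odd part `m′ = 2^{-v₂(m)}·m` of a natural number `m` -/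
def oddPart (m : ℕ) : ℕ := m / 2 ^ (m.factorization 2)

/-- The ring `ℤ[1/2]`. -/
def ZHalf : Type := Localization.Away (2 : ℤ)

instance : CommRing ZHalf := by unfold ZHalf; infer_instance

/-- `RP′(ℚ)[1/2] = RP′(ℚ) ⊗ ℤ[1/2]`, here realized as the localization of the
`ℤ`-module `RP′(ℚ)` at the powers of `2`. -/
def RPQhalf : Type := LocalizedModule (Submonoid.powers (2 : ℤ)) (RP' ℚ)

instance : AddCommGroup RPQhalf := by unfold RPQhalf; infer_instance


structure Chi {k : Type*} [Field k] (χ : k → ℤ) : Prop where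
  mul : ∀ x y, x ≠ 0 → y ≠ 0 → χ (x * y) = χ x * χ y
  pm : ∀ x, x ≠ 0 → χ x = 1 ∨ χ x = -1
  neg : χ (-1) = 1

namespace Chi
variable {k : Type*} [Field k] {χ : k → ℤ} (h : Chi χ)
include h
theorem one : χ 1 = 1 := by
  have := h.mul 1 1 one_ne_zero one_ne_zero
  rw [mul_one] at this
  rcases h.pm 1 one_ne_zero with h | h <;> rw [h] at this ⊢ ; omega
theorem sq {x : k} (hx : x ≠ 0) : χ x * χ x = 1 := by
  rcases h.pm x hx with h | h <;> rw [h] <;> rfl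
theorem inv {x : k} (hx : x ≠ 0) : χ x⁻¹ = χ x := by
  have := h.mul x x⁻¹ hx (inv_ne_zero hx)
  rw [mul_inv_cancel₀ hx, h.one] at this
  rcases h.pm x hx with h1 | h1 <;> rcases h.pm _ (inv_ne_zero hx) with h2 | h2 <;>
    rw [h1, h2] at this ⊢ <;> omega
theorem div {x y : k} (hx : x ≠ 0) (hy : y ≠ 0) : χ (x / y) = χ x * χ y := by
  rw [div_eq_mul_inv, h.mul _ _ hx (inv_ne_zero hy), h.inv hy]
theorem neg' {x : k} (hx : x ≠ 0) : χ (-x) = χ x := by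
  rw [← neg_one_mul, h.mul _ _ (neg_ne_zero.2 one_ne_zero) hx, h.neg, one_mul]
theorem sub {x y : k} (hx : x ≠ y) : χ (x - y) = χ (y - x) := by
  rw [← neg_sub, h.neg' (sub_ne_zero.2 hx.symm)]
end Chi

structure QD {k : Type*} [Field k] {A : Type*} [AddCommGroup A] (χ : k → ℤ) (f : k → A) : Prop where
  one : f 1 = 0
  inv : ∀ x, x ≠ 0 → f x⁻¹ = - f x
  ft : ∀ x y, x ≠ 0 → x ≠ 1 → y ≠ 0 → y ≠ 1 →
    f x - f y + χ x • f (y / x) - (χ x * χ (1 - x)) • f (y * (1 - x) / (x * (1 - y)))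
      + χ (1 - x) • f ((1 - x) / (1 - y)) = 0

def TF2 (A : Type*) [AddCommGroup A] : Prop := ∀ a : A, a + a = 0 → a = 0

namespace QD
variable {k : Type*} [Field k] {A : Type*} [AddCommGroup A] {χ : k → ℤ} {f : k → A}

theorem inv' (q : QD χ f) {x y : k} (hx : x ≠ 0) (e : x * y = 1) : f y = - f x := by
  rw [← q.inv x hx]; congr 1; exact eq_inv_of_mul_eq_one_right e

theorem neg_one (q : QD χ f) (tf : TF2 A) : f (-1) = 0 := by
  apply tf
  have := q.inv' (x := -1) (y := -1) (by simp) (by simp)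
  exact eq_neg_iff_add_eq_zero.1 this

theorem refl_aux (q : QD χ f) {x y : k} (hx : x ≠ 0) (hx1 : x ≠ 1)
    (hy : y ≠ 0) (hy1 : y ≠ 1) : f x + f (1 - x) = f y + f (1 - y) := by
  have a1 : 1 - x ≠ 0 := sub_ne_zero.2 hx1.symm
  have a2 : 1 - y ≠ 0 := sub_ne_zero.2 hy1.symm
  have h1 := q.ft x y hx hx1 hy hy1
  have h2 := q.ft (1 - x) (1 - y) a1 (by simpa using hx) a2 (by simpa using hy)
  rw [sub_sub_cancel, sub_sub_cancel] at h2
  rw [q.inv' (x := (1 - x) / (1 - y)) (y := (1 - y) / (1 - x)) (by positivity) (by field_simp),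
    q.inv' (x := y * (1 - x) / (x * (1 - y))) (y := (1 - y) * x / ((1 - x) * y)) (by positivity)
      (by field_simp),
    q.inv' (x := y / x) (y := x / y) (by positivity) (by field_simp)] at h2
  linear_combination (norm := module) h1 + h2

theorem refl (q : QD χ f) (tf : TF2 A) (k2 : (2 : k) ≠ 0) {x : k} (hx : x ≠ 0) (hx1 : x ≠ 1) :
    f x + f (1 - x) = f 2 := by
  have e : (-1 : k) ≠ 1 := fun h => k2 (by linear_combination -h)
  have := q.refl_aux hx hx1 (y := -1) (by simp) e
  rw [this, q.neg_one tf]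
  norm_num

theorem three (q : QD χ f) (tf : TF2 A) (k2 : (2 : k) ≠ 0) : f 2 + f 2 + f 2 = 0 := by
  have := q.refl tf k2 (x := 2⁻¹) (inv_ne_zero k2) (by
    intro h; rw [inv_eq_one] at h
    exact one_ne_zero (α := k) (by linear_combination h))
  have e : (1 : k) - 2⁻¹ = 2⁻¹ := by field_simp; ring
  rw [e, q.inv 2 k2] at this
  linear_combination (norm := module) -this
end QD

namespace QD
variable {k : Type*} [Field k] {A : Type*} [AddCommGroup A] {χ : k → ℤ} {f : k → A}

theorem odd (q : QD χ f) (hχ : Chi χ) (tf : TF2 A) (k2 : (2 : k) ≠ 0) {x : k} (hx : x ≠ 0)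
    (h : χ x = -1) : f x = χ (1 - x) • f 2 := by
  have x1 : x ≠ 1 := by rintro rfl; rw [hχ.one] at h; omega
  have xm : x ≠ -1 := by rintro rfl; rw [hχ.neg] at h; omega
  have a1 : 1 - x ≠ 0 := sub_ne_zero.2 x1.symm
  have a2 : 1 + x ≠ 0 := fun h => xm (by linear_combination h)
  have a3 : x - 1 ≠ 0 := sub_ne_zero.2 x1
  have h1 := q.ft x x⁻¹ hx x1 (inv_ne_zero hx) (by simpa using x1)
  have h2 := q.ft x (x ^ 2) hx x1 (by positivity) (by
    intro h; have : (1 - x) * (1 + x) = 0 := by linear_combination -h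
    rcases mul_eq_zero.1 this with h | h <;> contradiction)
  rw [h, q.inv x hx, q.inv' (x := x ^ 2) (y := x⁻¹ / x) (by positivity) (by field_simp),
    show (1 - x) / (1 - x⁻¹) = -x by
      rw [show (1 - x⁻¹) = -(1 - x) / x by field_simp; ring]; field_simp,
    q.inv' (x := -x) (y := x⁻¹ * (1 - x) / (x * (1 - x⁻¹))) (by simpa using hx) (by
      rw [show (1 - x⁻¹) = -(1 - x) / x by field_simp; ring]; field_simp)] at h1
  have e3 : f (1 / (1 + x)) + f (x / (1 + x)) = f 2 := by
    have := q.refl tf k2 (x := 1 / (1 + x)) (one_div_ne_zero a2) (by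
      intro h; field_simp at h; exact hx (by linear_combination -h))
    rwa [show 1 - 1 / (1 + x) = x / (1 + x) by field_simp; ring] at this
  have e4 : (1 - x ^ 2) = (1 - x) * (1 + x) := by ring
  rw [h, show x ^ 2 / x = x by field_simp, e4,
    show x ^ 2 * (1 - x) / (x * ((1 - x) * (1 + x))) = x / (1 + x) by field_simp,
    show (1 - x) / ((1 - x) * (1 + x)) = 1 / (1 + x) by field_simp] at h2
  have e5 := q.three tf k2
  rcases hχ.pm _ a1 with h' | h' <;> rw [h'] at h1 h2 ⊢
  · rw [← sub_eq_zero]; apply tf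
    linear_combination (norm := module) h1 + h2 - e5 - e3
  · rw [← sub_eq_zero]; apply tf
    linear_combination (norm := module) h1 + h2 + e5 + e3

theorem evenodd (q : QD χ f) (hχ : Chi χ) (tf : TF2 A) (k2 : (2 : k) ≠ 0) {x : k} (hx : x ≠ 0)
    (hx1 : x ≠ 1) (h : χ x = 1) (h' : χ (1 - x) = -1) : f x = 0 := by
  have := q.odd hχ tf k2 (sub_ne_zero.2 hx1.symm) h'
  have e := q.refl tf k2 hx hx1
  rw [sub_sub_cancel, h] at this
  linear_combination (norm := module) e - this

/-- the basic pattern analysis -/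
structure Pat (q : QD χ f) (x z : k) : Prop where
  ft : f x - f z + χ x • f (z / x) - (χ x * χ (1 - x)) • f (z * (1 - x) / (x * (1 - z)))
      + χ (1 - x) • f ((1 - x) / (1 - z)) = 0
  a0 : z / x ≠ 0
  b0 : z * (1 - x) / (x * (1 - z)) ≠ 0
  c0 : (1 - x) / (1 - z) ≠ 0
  a1 : z / x ≠ 1
  b1 : z * (1 - x) / (x * (1 - z)) ≠ 1
  c1 : (1 - x) / (1 - z) ≠ 1
  a : χ (z / x) = χ z * χ x
  b : χ (z * (1 - x) / (x * (1 - z))) = χ z * χ (1 - x) * χ x * χ (1 - z)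
  c : χ ((1 - x) / (1 - z)) = χ (1 - x) * χ (1 - z)
  a' : χ (1 - z / x) = χ (x - z) * χ x
  b' : χ (1 - z * (1 - x) / (x * (1 - z))) = χ (x - z) * χ x * χ (1 - z)
  c' : χ (1 - (1 - x) / (1 - z)) = χ (x - z) * χ (1 - z)

theorem pat (q : QD χ f) (hχ : Chi χ) {x z : k} (hx : x ≠ 0)
    (hx1 : x ≠ 1) (hz : z ≠ 0) (hz1 : z ≠ 1) (hxz : x ≠ z) : Pat q x z := by
  have d0 : 1 - x ≠ 0 := sub_ne_zero.2 hx1.symm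
  have d1 : 1 - z ≠ 0 := sub_ne_zero.2 hz1.symm
  have d2 : x - z ≠ 0 := sub_ne_zero.2 hxz
  have e1 : 1 - z / x = (x - z) / x := by field_simp
  have e2 : 1 - z * (1 - x) / (x * (1 - z)) = (x - z) / (x * (1 - z)) := by field_simp; ring
  have e3 : 1 - (1 - x) / (1 - z) = (x - z) / (1 - z) := by field_simp; ring
  refine ⟨q.ft x z hx hx1 hz hz1, by positivity, by positivity, by positivity, ?_, ?_, ?_,
    hχ.div hz hx, ?_, hχ.div d0 d1, ?_, ?_, ?_⟩
  · rw [ne_comm, ← sub_ne_zero, e1]; positivity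
  · rw [ne_comm, ← sub_ne_zero, e2]; positivity
  · rw [ne_comm, ← sub_ne_zero, e3]; positivity
  · rw [hχ.div (by positivity) (by positivity), hχ.mul _ _ hz d0, hχ.mul _ _ hx d1]; ring
  · rw [e1, hχ.div d2 hx]
  · rw [e2, hχ.div d2 (by positivity), hχ.mul _ _ hx d1]; ring
  · rw [e3, hχ.div d2 d1]

variable (q : QD χ f) (hχ : Chi χ) (tf : TF2 A) (k2 : (2 : k) ≠ 0)
  {x z : k} (hx : x ≠ 0) (hx1 : x ≠ 1) (hz : z ≠ 0) (hz1 : z ≠ 1) (hxz : x ≠ z)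
  (z1 : χ z = 1) (z2 : χ (1 - z) = 1)
include q hχ tf k2 hx hx1 hz hz1 hxz z1 z2

theorem mmp (h1 : χ x = -1) (h2 : χ (1 - x) = -1) (h3 : χ (x - z) = 1) : f z = - f 2 := by
  obtain ⟨ft, a0, b0, c0, a1, b1, c1, a, b, c, a', b', c'⟩ := q.pat hχ hx hx1 hz hz1 hxz
  have e5 := q.three tf k2
  simp only [h1, h2, h3, z1, z2] at ft a b c a' b' c'
  have u1 := q.odd hχ tf k2 hx h1
  have u2 := q.odd hχ tf k2 a0 a
  have u3 := q.evenodd hχ tf k2 b0 b1 b b'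
  have u4 := q.odd hχ tf k2 c0 c
  rw [h2] at u1
  rw [a'] at u2; rw [c'] at u4
  rw [u1, u2, u3, u4] at ft
  linear_combination (norm := module) -ft

theorem mpm (h1 : χ x = -1) (h2 : χ (1 - x) = 1) (h3 : χ (x - z) = -1) : f z = f 2 := by
  obtain ⟨ft, a0, b0, c0, a1, b1, c1, a, b, c, a', b', c'⟩ := q.pat hχ hx hx1 hz hz1 hxz
  have e5 := q.three tf k2
  simp only [h1, h2, h3, z1, z2] at ft a b c a' b' c'
  have u1 := q.odd hχ tf k2 hx h1
  have u2 := q.odd hχ tf k2 a0 a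
  have u3 := q.odd hχ tf k2 b0 b
  have u4 := q.evenodd hχ tf k2 c0 c1 c c'
  rw [h2] at u1
  rw [a'] at u2; rw [b'] at u3
  rw [u1, u2, u3, u4] at ft
  linear_combination (norm := module) -ft

theorem pmm (h1 : χ x = 1) (h2 : χ (1 - x) = -1) (h3 : χ (x - z) = -1) : f z = 0 := by
  obtain ⟨ft, a0, b0, c0, a1, b1, c1, a, b, c, a', b', c'⟩ := q.pat hχ hx hx1 hz hz1 hxz
  have e5 := q.three tf k2
  simp only [h1, h2, h3, z1, z2] at ft a b c a' b' c'
  have u1 := q.evenodd hχ tf k2 hx hx1 h1 h2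
  have u2 := q.evenodd hχ tf k2 a0 a1 a a'
  have u3 := q.odd hχ tf k2 b0 b
  have u4 := q.odd hχ tf k2 c0 c
  rw [b'] at u3; rw [c'] at u4
  rw [u1, u2, u3, u4] at ft
  linear_combination (norm := module) -ft

theorem mpp (h1 : χ x = -1) (h2 : χ (1 - x) = 1) (h3 : χ (x - z) = 1) :
    f z = f ((z - x) / (1 - x)) := by
  obtain ⟨ft, a0, b0, c0, a1, b1, c1, a, b, c, a', b', c'⟩ := q.pat hχ hx hx1 hz hz1 hxz
  have e5 := q.three tf k2
  have d0 : 1 - x ≠ 0 := sub_ne_zero.2 hx1.symm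
  have d1 : 1 - z ≠ 0 := sub_ne_zero.2 hz1.symm
  have d2 : z - x ≠ 0 := sub_ne_zero.2 hxz.symm
  simp only [h1, h2, h3, z1, z2] at ft a b c a' b' c'
  have u1 := q.odd hχ tf k2 hx h1
  have u2 := q.odd hχ tf k2 a0 a
  have u3 := q.odd hχ tf k2 b0 b
  have u4 := q.refl tf k2 (x := (z - x) / (1 - x)) (by positivity) (by
    rw [ne_comm, ← sub_ne_zero, show 1 - (z - x) / (1 - x) = (1 - z) / (1 - x) by
      field_simp; ring]; positivity)
  rw [show 1 - (z - x) / (1 - x) = (1 - z) / (1 - x) by field_simp; ring,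
    q.inv' (x := (1 - x) / (1 - z)) (y := (1 - z) / (1 - x)) (by positivity) (by field_simp)] at u4
  rw [h2] at u1
  rw [a'] at u2; rw [b'] at u3
  rw [u1, u2, u3] at ft
  linear_combination (norm := module) -ft - u4

theorem pmp (h1 : χ x = 1) (h2 : χ (1 - x) = -1) (h3 : χ (x - z) = 1) :
    f z = f (z / x) := by
  obtain ⟨ft, a0, b0, c0, a1, b1, c1, a, b, c, a', b', c'⟩ := q.pat hχ hx hx1 hz hz1 hxz
  have e5 := q.three tf k2
  simp only [h1, h2, h3, z1, z2] at ft a b c a' b' c'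
  have u1 := q.evenodd hχ tf k2 hx hx1 h1 h2
  have u3 := q.odd hχ tf k2 b0 b
  have u4 := q.odd hχ tf k2 c0 c
  rw [b'] at u3; rw [c'] at u4
  rw [u1, u3, u4] at ft
  linear_combination (norm := module) -ft

theorem ppm (h1 : χ x = 1) (h2 : χ (1 - x) = 1) (h3 : χ (x - z) = -1) :
    f z = f x := by
  obtain ⟨ft, a0, b0, c0, a1, b1, c1, a, b, c, a', b', c'⟩ := q.pat hχ hx hx1 hz hz1 hxz
  simp only [h1, h2, h3, z1, z2] at ft a b c a' b' c'
  have u2 := q.evenodd hχ tf k2 a0 a1 a a'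
  have u3 := q.evenodd hχ tf k2 b0 b1 b b'
  have u4 := q.evenodd hχ tf k2 c0 c1 c c'
  rw [u2, u3, u4] at ft
  linear_combination (norm := module) -ft
end QD

namespace QD
variable {k : Type*} [Field k] {A : Type*} [AddCommGroup A] {χ : k → ℤ} {f : k → A}

theorem bad (q : QD χ f) (hχ : Chi χ) (tf : TF2 A) (k2 : (2 : k) ≠ 0) {x y : k}
    (hx : x ≠ 0) (hx1 : x ≠ 1) (hy : y ≠ 0) (hy1 : y ≠ 1) (hxy : x ≠ y)
    (x1 : χ x = -1) (x2 : χ (1 - x) = 1) (y1 : χ y = -1) (y2 : χ (1 - y) = -1)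
    (xy : χ (x - y) = 1) (z : k) (hz : z ≠ 0) : f z = 0 := by
  have C0 : f 2 = 0 := by
    obtain ⟨ft, a0, b0, c0, a1, b1, c1, a, b, c, a', b', c'⟩ := q.pat hχ hx hx1 hy hy1 hxy
    simp only [x1, x2, y1, y2, xy] at ft a b c a' b' c'
    have u1 := q.odd hχ tf k2 hx x1
    have u0 := q.odd hχ tf k2 hy y1
    have u2 := q.evenodd hχ tf k2 a0 a1 a a'
    have u3 := q.odd hχ tf k2 b0 b
    have u4 := q.odd hχ tf k2 c0 c
    rw [x2] at u1; rw [y2] at u0; rw [b'] at u3; rw [c'] at u4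
    rw [u1, u0, u2, u3, u4] at ft
    apply tf
    linear_combination (norm := module) ft
  by_cases hz1 : z = 1
  · rw [hz1, q.one]
  have dz : 1 - z ≠ 0 := sub_ne_zero.2 (Ne.symm hz1)
  rcases hχ.pm z hz with h1 | h1
  swap
  · rw [q.odd hχ tf k2 hz h1, C0, smul_zero]
  rcases hχ.pm _ dz with h2 | h2
  swap
  · exact q.evenodd hχ tf k2 hz hz1 h1 h2
  have zx : x ≠ z := by rintro rfl; omega
  have zy : y ≠ z := by rintro rfl; omega
  have dx : x - z ≠ 0 := sub_ne_zero.2 zx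
  have dy : y - z ≠ 0 := sub_ne_zero.2 zy
  rcases hχ.pm _ dx with h3 | h3
  swap
  · rw [q.mpm hχ tf k2 hx hx1 hz hz1 zx h1 h2 x1 x2 h3, C0]
  rcases hχ.pm _ dy with h4 | h4
  · rw [q.mmp hχ tf k2 hy hy1 hz hz1 zy h1 h2 y1 y2 h4, C0, neg_zero]
  rw [q.mpp hχ tf k2 hx hx1 hz hz1 zx h1 h2 x1 x2 h3]
  have d1 : 1 - x ≠ 0 := sub_ne_zero.2 hx1.symm
  have d2 : 1 - y ≠ 0 := sub_ne_zero.2 hy1.symm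
  have d3 : y - x ≠ 0 := sub_ne_zero.2 hxy.symm
  have d4 : z - x ≠ 0 := sub_ne_zero.2 zx.symm
  have e1 : 1 - (z - x) / (1 - x) = (1 - z) / (1 - x) := by field_simp; ring
  have e2 : 1 - (y - x) / (1 - x) = (1 - y) / (1 - x) := by field_simp; ring
  have e3 : (y - x) / (1 - x) - (z - x) / (1 - x) = (y - z) / (1 - x) := by field_simp; ring
  refine q.pmm hχ tf k2 (x := (y - x) / (1 - x)) (by positivity) ?_ (by positivity) ?_ ?_ ?_ ?_ ?_ ?_ ?_
  · rw [ne_comm, ← sub_ne_zero, e2]; positivity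
  · rw [ne_comm, ← sub_ne_zero, e1]; positivity
  · rw [← sub_ne_zero, e3]; positivity
  · rw [hχ.div d4 d1, hχ.sub zx.symm, h3, x2]; rfl
  · rw [e1, hχ.div dz d1, h2, x2]; rfl
  · rw [hχ.div d3 d1, hχ.sub hxy.symm, xy, x2]; rfl
  · rw [e2, hχ.div d2 d1, y2, x2]; rfl
  · rw [e3, hχ.div dy d1, h4, x2]; rfl
end QD

def chip (p : ℕ) (x : ℚ) : ℤ := if Even (padicValRat p x) then 1 else -1

theorem chip_chi (p : ℕ) [Fact p.Prime] : Chi (chip p) := by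
  refine ⟨fun x y hx hy => ?_, fun x hx => ?_, ?_⟩
  · unfold chip; rw [padicValRat.mul hx hy]
    by_cases h1 : Even (padicValRat p x) <;> by_cases h2 : Even (padicValRat p y) <;>
      simp [h1, h2, Int.even_add]
  · unfold chip; split_ifs <;> simp
  · unfold chip; simp

theorem Chi.nat_ext {χ ψ : ℚ → ℤ} (h : Chi χ) (h' : Chi ψ) (N : ℕ)
    (e : ∀ p : ℕ, p.Prime → p ∣ N → χ p = ψ p) (hN : N ≠ 0) : χ N = ψ N := by
  induction N using Nat.recOnMul with
  | zero => exact absurd rfl hN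
  | one => simp [h.one, h'.one]
  | prime p hp => exact e p hp dvd_rfl
  | mul a b iha ihb =>
    have ha : a ≠ 0 := by rintro rfl; simp at hN
    have hb : b ≠ 0 := by rintro rfl; simp at hN
    push_cast
    rw [h.mul _ _ (by positivity) (by positivity), h'.mul _ _ (by positivity) (by positivity),
      iha (fun p hp hd => e p hp (hd.mul_right b)) ha, ihb (fun p hp hd => e p hp (hd.mul_left a)) hb]

theorem Chi.ext {χ ψ : ℚ → ℤ} (h : Chi χ) (h' : Chi ψ)
    (e : ∀ p : ℕ, p.Prime → χ p = ψ p) (x : ℚ) (hx : x ≠ 0) : χ x = ψ x := by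
  have n0 : (x.num : ℚ) ≠ 0 := by simpa using hx
  have d0 : (x.den : ℚ) ≠ 0 := by simp
  have key : ∀ m : ℤ, m ≠ 0 → χ m = ψ m := by
    intro m hm
    obtain ⟨n, h1 | h1⟩ := Int.eq_nat_or_neg m
    · rw [h1, Int.cast_natCast]; exact h.nat_ext h' _ (fun p hp _ => e p hp) (by omega)
    · have : (n : ℚ) ≠ 0 := by norm_cast; omega
      rw [h1, Int.cast_neg, Int.cast_natCast, h.neg' this, h'.neg' this]
      exact h.nat_ext h' n (fun p hp _ => e p hp) (by omega)
  rw [← Rat.num_div_den x, h.div n0 d0, h'.div n0 d0, key _ (by simpa using hx)]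
  rw [h.nat_ext h' _ (fun p hp _ => e p hp) (by simp)]

theorem one_chi {k} [Field k] : Chi (fun _ : k => 1) := ⟨by simp, by simp, by simp⟩

theorem chip_prime (p q : ℕ) [hp : Fact p.Prime] (hq : q.Prime) :
    chip p q = if q = p then -1 else 1 := by
  unfold chip
  split_ifs with h1 h2 h2
  · subst h2; rw [padicValRat.of_nat, padicValNat_self] at h1; simp at h1
  · rfl
  · rfl
  · rw [padicValRat.of_nat, padicValNat_primes (p := p) (q := q) (hq := ⟨hq⟩) (fun h => h2 h.symm)] at h1; simp at h1

theorem chi_cases {χ : ℚ → ℤ} (h : Chi χ) : (∀ x, x ≠ 0 → χ x = 1) ∨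
    (∃ p : ℕ, p.Prime ∧ ∀ x, x ≠ 0 → χ x = chip p x) ∨
    ∃ p q : ℕ, p.Prime ∧ q.Prime ∧ p < q ∧ χ p = -1 ∧ χ q = -1 ∧
      ∀ n : ℕ, 0 < n → n < q → ¬ p ∣ n → χ n = 1 := by
  by_cases h1 : ∃ p : ℕ, p.Prime ∧ χ p = -1
  swap
  · left; push Not at h1
    exact h.ext one_chi (fun p hp => (h.pm p (by exact_mod_cast hp.ne_zero)).resolve_right (h1 p hp))
  right
  obtain ⟨hp, hp'⟩ := Nat.find_spec h1
  have hmin := @Nat.find_min _ _ h1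
  set p := Nat.find h1
  have : Fact p.Prime := ⟨hp⟩
  by_cases h2 : ∃ q : ℕ, q.Prime ∧ p < q ∧ χ q = -1
  swap
  · left; push Not at h2
    refine ⟨p, hp, h.ext (chip_chi p) (fun q hq => ?_)⟩
    rw [chip_prime p q hq]
    split_ifs with e
    · rw [e, hp']
    rcases lt_or_gt_of_ne e with e | e
    · exact (h.pm q (by exact_mod_cast hq.ne_zero)).resolve_right (fun h => hmin e ⟨hq, h⟩)
    · exact (h.pm q (by exact_mod_cast hq.ne_zero)).resolve_right (h2 q hq e)
  right
  obtain ⟨hq, hpq, hq'⟩ := Nat.find_spec h2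
  have hmin2 := @Nat.find_min _ _ h2
  set q := Nat.find h2
  refine ⟨p, q, hp, hq, hpq, hp', hq', fun n hn hnq hpn => ?_⟩
  refine h.nat_ext one_chi n (fun l hl hd => ?_) hn.ne'
  refine (h.pm l (by exact_mod_cast hl.ne_zero)).resolve_right (fun hh => ?_)
  have l1 : l ≠ p := by rintro rfl; exact hpn hd
  have l2 : l ≤ n := Nat.le_of_dvd hn hd
  rcases lt_or_gt_of_ne l1 with e | e
  · exact hmin e ⟨hl, hh⟩
  · exact hmin2 (by omega : l < q) ⟨hl, e, hh⟩

theorem QD.two_primes {A : Type*} [AddCommGroup A] {χ : ℚ → ℤ} {f : ℚ → A}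
    (Q : QD χ f) (h : Chi χ) (tf : TF2 A) {p q : ℕ} (hp : p.Prime) (hq : q.Prime) (hpq : p < q)
    (hp' : χ p = -1) (hq' : χ q = -1)
    (H : ∀ n : ℕ, 0 < n → n < q → ¬ p ∣ n → χ n = 1) (z : ℚ) (hz : z ≠ 0) : f z = 0 := by
  have hp0 := hp.pos
  have hnd : ¬ p ∣ q := fun hd => by
    rcases (Nat.dvd_prime hq).1 hd with h | h
    · exact hp.one_lt.ne' h
    · omega
  obtain ⟨m, r, hr, hqm⟩ : ∃ m r, r < p ∧ q = p * m + r :=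
    ⟨q / p, q % p, Nat.mod_lt _ hp0, (Nat.div_add_mod q p).symm⟩
  have hr0 : 0 < r := by
    rcases Nat.eq_zero_or_pos r with h | h
    · exact absurd ⟨m, by omega⟩ hnd
    · exact h
  have hm0 : 0 < m := by
    grind
  have hmq : m < q := by nlinarith [hp.two_le]
  have sub : χ ((q : ℚ) - p) = 1 := by
    have := H (q - p) (by omega) (by omega) (fun hd => hnd ((Nat.dvd_sub_iff_left hpq.le dvd_rfl).1 hd))
    rwa [Nat.cast_sub hpq.le] at this
  have p0 : (p : ℚ) ≠ 0 := by positivity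
  have q0 : (q : ℚ) ≠ 0 := by have := hq.pos; positivity
  have m0 : (m : ℚ) ≠ 0 := by positivity
  have hpq' : (p : ℚ) ≠ q := by exact_mod_cast hpq.ne
  have qp0 : (q : ℚ) - p ≠ 0 := sub_ne_zero.2 hpq'.symm
  have qe : (q : ℚ) = p * m + r := by exact_mod_cast hqm
  have fin : ∀ s : ℕ, 0 < s → χ s = 1 → s ≠ p → s ≠ q → χ ((s : ℚ) - p) = 1 →
      χ ((s : ℚ) - q) = -1 → f z = 0 := by
    intro s hs s1 s2 s3 s4 s5
    have s0 : (s : ℚ) ≠ 0 := by positivity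
    have s2' : (s : ℚ) - p ≠ 0 := sub_ne_zero.2 (by exact_mod_cast s2)
    have s3' : (s : ℚ) - q ≠ 0 := sub_ne_zero.2 (by exact_mod_cast s3)
    refine Q.bad h tf two_ne_zero (x := p / s) (y := q / s) (by positivity) ?_ (by positivity) ?_ ?_
      ?_ ?_ ?_ ?_ ?_ z hz
    · intro e; field_simp at e; exact s2 (by exact_mod_cast e.symm)
    · intro e; field_simp at e; exact s3 (by exact_mod_cast e.symm)
    · intro e; field_simp at e; exact hpq' e
    · rw [h.div p0 s0, hp', s1]; rfl
    · rw [show 1 - (p : ℚ) / s = (s - p) / s by field_simp, h.div s2' s0, s4, s1]; rfl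
    · rw [h.div q0 s0, hq', s1]; rfl
    · rw [show 1 - (q : ℚ) / s = (s - q) / s by field_simp, h.div s3' s0, s5, s1]; rfl
    · rw [show (p : ℚ) / s - q / s = (p - q) / s by field_simp,
        h.div (sub_ne_zero.2 hpq') s0, h.sub hpq', sub, s1]; rfl
  have nd : ∀ t, 0 < t → t < p → ¬ p ∣ t := fun t h1 h2 hd => by
    have := Nat.le_of_dvd h1 hd; omega
  rcases h.pm m m0 with hm | hm
  · refine fin r hr0 (H r hr0 (by omega) (nd r hr0 hr)) (by omega) (by omega) ?_ ?_
    · rw [h.sub (by exact_mod_cast hr.ne)]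
      have := H (p - r) (by omega) (by omega) (nd _ (by omega) (by omega))
      rwa [Nat.cast_sub hr.le] at this
    · rw [qe, show (r : ℚ) - (p * m + r) = -(p * m) by ring, h.neg' (by positivity), h.mul _ _ p0 m0,
        hp', hm]; rfl
  · have hpm : p ∣ m := by
      grind
    have hm2 : p ≤ m := Nat.le_of_dvd hm0 hpm
    have p2 := hp.two_le
    have hlt : r + p < q := by nlinarith
    refine fin (r + p) (by omega) (H _ (by omega) hlt (fun hd => nd r hr0 hr ((Nat.dvd_add_left dvd_rfl).1 hd)))
      (by omega) (by omega) ?_ ?_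
    · push_cast; rw [add_sub_cancel_right]; exact H r hr0 (by omega) (nd r hr0 hr)
    · have m1 := H (m - 1) (by omega) (by omega) (fun hd => by
        have := (Nat.dvd_sub_iff_right (by omega) hpm).1 hd
        have := Nat.le_of_dvd one_pos this
        omega)
      rw [Nat.cast_sub (by omega)] at m1
      push_cast at m1 ⊢
      have : (m : ℚ) - 1 ≠ 0 := sub_ne_zero.2 (by norm_cast; omega)
      rw [qe, show (r : ℚ) + p - (p * m + r) = -(p * (m - 1)) by ring, h.neg' (by positivity),
        h.mul _ _ p0 this, hp', m1]; rfl


structure Alt {B : Type*} [AddCommGroup B] (f : ℚ → B) : Prop where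
  zero : f 0 = 0
  one : f 1 = 0
  inv : ∀ x, f x⁻¹ = - f x
  sub : ∀ x, f (1 - x) = - f x
  ft : ∀ x y, x ≠ 0 → x ≠ 1 → y ≠ 0 → y ≠ 1 →
    f x - f y + f (y / x) - f (y * (1 - x) / (x * (1 - y))) + f ((1 - x) / (1 - y)) = 0

/-- the vanishing statement at level `N` -/
def EE {B : Type*} [AddCommGroup B] (f : ℚ → B) (N : ℕ) : Prop :=
  ∀ a b c d e g : ℤ, |a| ≤ N → |b| ≤ N → |c| ≤ N → |d| ≤ N → |e| ≤ N → |g| ≤ N →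
    a * b + c * d + e * g = 0 → f (-((a : ℚ) * b) / (c * d)) = 0

def OneT {B : Type*} [AddCommGroup B] (f : ℚ → B) (n : ℕ) : Prop :=
  ∀ a b c d k : ℤ, |a| < n → |b| < n → |c| < n → |d| < n → |k| ≤ n →
    a * d - b * c = k * n → f ((a : ℚ) * d / (b * c)) = 0

def PosT {B : Type*} [AddCommGroup B] (f : ℚ → B) (n : ℕ) : Prop :=
  ∀ a b c d k : ℤ, 0 < a → 0 < b → 0 < c → 0 < d → a < n → b < n → c < n → d < n →
    a * d - b * c = k * n → f ((a : ℚ) * d / (b * c)) = 0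

namespace Alt
variable {B : Type*} [AddCommGroup B] {f : ℚ → B} (h : Alt f)
include h

theorem tri_swap {α β : ℚ} : f (-β / α) = - f (-α / β) := by
  rw [← h.inv]; congr 1; rw [inv_div, div_neg, neg_div]

theorem tri_rot {α β γ : ℚ} (e : α + β + γ = 0) (h0 : f (-α / β) = 0) : f (-β / γ) = 0 := by
  by_cases hb : β = 0
  · simp [hb, h.zero]
  by_cases hc : γ = 0
  · simp [hc, h.zero]
  have : -β / γ = (1 - (-α / β))⁻¹ := by
    grind
  rw [this, h.inv, h.sub, h0]; simp

theorem inv_zero {x y : ℚ} (e : y = x⁻¹) (h0 : f x = 0) : f y = 0 := by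
  rw [e, h.inv, h0, neg_zero]

theorem add {a1 b1 a2 b2 a3 b3 D12 D13 n : ℚ} (n0 : n ≠ 0) (ha1 : a1 ≠ 0) (hb1 : b1 ≠ 0)
    (ha2 : a2 ≠ 0) (hb2 : b2 ≠ 0) (ha3 : a3 ≠ 0) (hb3 : b3 ≠ 0)
    (e12 : a1 * b2 - b1 * a2 = D12 * n) (e13 : a1 * b3 - b1 * a3 = D13 * n)
    (h1 : f (D12 * a3 / (D13 * a2)) = 0) (h2 : f (D12 * b3 / (D13 * b2)) = 0) :
    f (a1 * b3 / (b1 * a3)) = f (a1 * b2 / (b1 * a2)) + f (a2 * b3 / (b2 * a3)) := by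
  by_cases d12 : D12 = 0
  · have : a1 * b2 = b1 * a2 := by rw [d12] at e12; linear_combination e12
    have e1 : a1 * b2 / (b1 * a2) = 1 := by rw [this]; field_simp
    rw [e1, h.one, zero_add]; congr 1; field_simp; linear_combination this
  by_cases d13 : D13 = 0
  · have : a1 * b3 = b1 * a3 := by rw [d13] at e13; linear_combination e13
    have e1 : a1 * b3 / (b1 * a3) = 1 := by rw [this]; field_simp
    rw [e1, h.one, show a2 * b3 / (b2 * a3) = (a1 * b2 / (b1 * a2))⁻¹ by
      rw [inv_div]; field_simp; linear_combination this, h.inv]; simp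
  have k1 : a1 * b2 / (b1 * a2) ≠ 1 := by
    intro h; field_simp at h
    have : D12 * n = 0 := by rw [← e12, h]; ring
    simp_all
  have k2 : a1 * b3 / (b1 * a3) ≠ 1 := by
    intro h; field_simp at h
    have : D13 * n = 0 := by rw [← e13, h]; ring
    simp_all
  have := h.ft (a1 * b2 / (b1 * a2)) (a1 * b3 / (b1 * a3)) (by positivity) k1 (by positivity) k2
  have s1 : 1 - a1 * b2 / (b1 * a2) = - (D12 * n) / (b1 * a2) := by
    rw [← e12]; field_simp; ring
  have s2 : 1 - a1 * b3 / (b1 * a3) = - (D13 * n) / (b1 * a3) := by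
    rw [← e13]; field_simp; ring
  rw [s1, s2] at this
  rw [show a1 * b3 / (b1 * a3) / (a1 * b2 / (b1 * a2)) = a2 * b3 / (b2 * a3) by field_simp,
    show - (D12 * n) / (b1 * a2) / (- (D13 * n) / (b1 * a3)) = D12 * a3 / (D13 * a2) by field_simp,
    show a1 * b3 / (b1 * a3) * (-(D12 * n) / (b1 * a2)) / (a1 * b2 / (b1 * a2) * (-(D13 * n) / (b1 * a3)))
      = D12 * b3 / (D13 * b2) by field_simp, h1, h2] at this
  linear_combination (norm := module) -this

/-- reduce level `n` to the one-term case -/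
theorem EE_of_OneT {n : ℕ} (hn : 3 ≤ n) (hE : EE f (n - 1)) (h1 : OneT f n) : EE f n := by
  have hn' : ((n - 1 : ℕ) : ℤ) = n - 1 := by push_cast [show 1 ≤ n by omega]; rfl
  unfold EE at hE; rw [hn'] at hE
  have S1 : ∀ a b c d k : ℤ, |a| < n → |b| < n → |c| < n → |d| < n → |k| ≤ n →
      a * b + c * d + k * n = 0 → f (-((a : ℚ) * b) / (c * d)) = 0 := by
    intro a b c d k ha hb hc hd hk e
    have := h1 a (-c) d b (-k) ha (by simpa using hc) hd hb (by simpa using hk) (by linear_combination e)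
    rw [← this]; congr 1; push_cast; rw [neg_mul, div_neg, neg_div]
  have S2 : ∀ a b c : ℤ, |a| ≤ n → |b| ≤ n → |c| ≤ n → a + b + c = 0 → f (-(a : ℚ) / b) = 0 := by
    intro a b c ha hb hc e
    have e' : (a : ℚ) + b + c = 0 := by exact_mod_cast e
    have one : |(1 : ℤ)| < n := by rw [abs_one]; omega
    have T : ∀ a b c : ℤ, |a| < n → |b| < n → |c| ≤ n → a + b + c = 0 → f (-(a : ℚ) / b) = 0 := by
      intro a b c ha hb hc e
      by_cases hc' : |c| < n
      · have := hE a 1 b 1 c 1 (by omega) (by omega) (by omega) (by omega) (by omega) (by omega) (by omega)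
        simpa using this
      · have hc'' : |c| = n := by omega
        rcases abs_cases c with ⟨h2, _⟩ | ⟨h2, _⟩
        · have := S1 a 1 b 1 1 ha one hb one one.le (by rw [h2] at hc''; omega)
          simpa using this
        · have := S1 a 1 b 1 (-1) ha one hb one (by simpa using one.le) (by rw [h2] at hc''; omega)
          simpa using this
    by_cases hc' : |c| < n
    · by_cases ha' : |a| < n
      · by_cases hb' : |b| < n
        · exact T a b c ha' hb' hc e
        · have := T c a b hc' ha' hb (by omega)
          exact h.tri_rot (by linear_combination e') this
      · by_cases hb' : |b| < n
        · have := T b c a hb' hc' ha (by omega)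
          exact h.tri_rot (by linear_combination e') (h.tri_rot (by linear_combination e') this)
        · have : c = 0 := by
            rcases abs_cases a with h | h <;> rcases abs_cases b with h' | h' <;> 
            rcases abs_cases c with h'' | h'' <;> omega
          have : (a : ℚ) = - b := by rw [this] at e'; push_cast at e'; linear_combination e'
          rw [this, neg_neg]
          by_cases hb : (b : ℚ) = 0
          · simp [hb, h.zero]
          · rw [div_self hb, h.one]
    · have : a = 0 ∨ b = 0 ∨ (|a| < n ∧ |b| < n) := by
        rcases abs_cases a with h | h <;> rcases abs_cases b with h' | h' <;> 
            rcases abs_cases c with h'' | h'' <;> omega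
      rcases this with h' | h' | h'
      · simp [h', h.zero]
      · simp [h', h.zero]
      · exact T a b c h'.1 h'.2 hc e
  have nf : ∀ a b : ℤ, |a| ≤ n → |b| ≤ n → (|a| < n ∧ |b| < n) ∨ ∃ k : ℤ, |k| ≤ n ∧ a * b = k * n := by
    intro a b ha hb
    by_cases h1 : |a| < n
    · by_cases h2 : |b| < n
      · exact Or.inl ⟨h1, h2⟩
      · right
        rcases abs_cases b with ⟨h, _⟩ | ⟨h, _⟩
        · exact ⟨a, ha, by rw [show b = n by omega]⟩
        · exact ⟨-a, by simpa using ha, by rw [show b = -n by omega]; ring⟩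
    · right
      rcases abs_cases a with ⟨h, _⟩ | ⟨h, _⟩
      · exact ⟨b, hb, by rw [show a = n by omega]; ring⟩
      · exact ⟨-b, by simpa using hb, by rw [show a = -n by omega]; ring⟩
  have n0 : (n : ℚ) ≠ 0 := by positivity
  have N0 : (n : ℤ) ≠ 0 := by positivity
  have nZ : (0 : ℤ) < n := by positivity
  have S3 : ∀ k l e g : ℤ, |k| ≤ n → |l| ≤ n → |e| ≤ n → |g| ≤ n →
      k * n + l * n + e * g = 0 → f (-((k : ℚ) * n) / (l * n)) = 0 := by
    intro k l e g hk hl he hg E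
    rw [← neg_mul, mul_div_mul_right _ _ n0]
    refine S2 k l (-(k + l)) hk hl ?_ (by ring)
    rw [abs_neg]
    have : |(k + l)| * n = |e| * |g| := by
      rw [← abs_mul, show e * g = -((k + l) * n) by linear_combination E, abs_neg, abs_mul, abs_of_pos nZ]
    nlinarith [abs_nonneg e, abs_nonneg g, abs_nonneg (k + l)]
  intro a b c d e g ha hb hc hd he hg E
  have E' : (a : ℚ) * b + c * d + e * g = 0 := by exact_mod_cast E
  rcases nf a b ha hb with ⟨a1, b1⟩ | ⟨k, hk, ek⟩
  · rcases nf c d hc hd with ⟨c1, d1⟩ | ⟨l, hl, el⟩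
    · rcases nf e g he hg with ⟨e1, g1⟩ | ⟨m, hm, em⟩
      · exact hE a b c d e g (by omega) (by omega) (by omega) (by omega) (by omega) (by omega) E
      · exact S1 a b c d m a1 b1 c1 d1 hm (by rw [← em]; exact E)
    · rcases nf e g he hg with ⟨e1, g1⟩ | ⟨m, hm, em⟩
      · have := S1 e g a b l e1 g1 a1 b1 hl (by rw [← el]; linear_combination E)
        exact h.tri_rot (by linear_combination E') this
      · have := S3 l m a b hl hm ha hb (by rw [← el, ← em]; linear_combination E)
        have el' : (c : ℚ) * d = l * n := by exact_mod_cast el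
        have em' : (e : ℚ) * g = m * n := by exact_mod_cast em
        rw [← el', ← em'] at this
        exact h.tri_rot (by linear_combination E') (h.tri_rot (by linear_combination E') this)
  · have ek' : (a : ℚ) * b = k * n := by exact_mod_cast ek
    rcases nf c d hc hd with ⟨c1, d1⟩ | ⟨l, hl, el⟩
    · rcases nf e g he hg with ⟨e1, g1⟩ | ⟨m, hm, em⟩
      · have := S1 c d e g k c1 d1 e1 g1 hk (by rw [← ek]; linear_combination E)
        exact h.tri_rot (by linear_combination E') (h.tri_rot (by linear_combination E') this)
      · have := S3 m k c d hm hk hc hd (by rw [← ek, ← em]; linear_combination E)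
        have em' : (e : ℚ) * g = m * n := by exact_mod_cast em
        rw [← ek', ← em'] at this
        exact h.tri_rot (by linear_combination E') this
    · have el' : (c : ℚ) * d = l * n := by exact_mod_cast el
      rw [ek', el']
      exact S3 k l e g hk hl he hg (by rw [← ek, ← el]; exact E)

end Alt

namespace Alt
variable {B : Type*} [AddCommGroup B] {f : ℚ → B} (h : Alt f)
include h

theorem sub_zero' {x y : ℚ} (e : y = 1 - x) (h0 : f x = 0) : f y = 0 := by
  rw [e, h.sub, h0, neg_zero]

theorem OneT_of_PosT (tf : TF2 B) {n : ℕ} (hn : 3 ≤ n) (hE : EE f (n - 1)) (hP : PosT f n) : OneT f n := by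
  have hn' : ((n - 1 : ℕ) : ℤ) = n - 1 := by push_cast [show 1 ≤ n by omega]; rfl
  unfold EE at hE; rw [hn'] at hE
  have n0 : (n : ℚ) ≠ 0 := by positivity
  have nZ : (0 : ℤ) < n := by positivity
  have M : ∀ a b c d k : ℤ, 0 < a → b < 0 → 0 < c → 0 < d → a < n → -n < b → c < n → d < n →
      a * d - b * c = k * n → f ((c : ℚ) / k) = 0 → f ((a : ℚ) * d / (k * (b + n))) = 0 →
      f ((a : ℚ) * d / (b * c)) = f (((b : ℚ) + n) / b) := by
    intro a b c d k ha hb hc hd ha' hb' hc' hd' e h1 h2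
    have a0 : (a : ℚ) ≠ 0 := by exact_mod_cast ha.ne'
    have b0 : (b : ℚ) ≠ 0 := by exact_mod_cast hb.ne
    have c0 : (c : ℚ) ≠ 0 := by exact_mod_cast hc.ne'
    have d0 : (d : ℚ) ≠ 0 := by exact_mod_cast hd.ne'
    have bn0 : (b : ℚ) + n ≠ 0 := by
      have : b + n ≠ 0 := by omega
      exact_mod_cast this
    have e' : (a : ℚ) * d - b * c = k * n := by exact_mod_cast e
    have := h.add n0 a0 b0 a0 bn0 c0 d0 (D12 := a) (D13 := k) (by ring) e'
      (by rw [mul_comm (k : ℚ), mul_div_mul_left _ _ a0]; exact h1) h2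
    rw [this]
    have := hP a (b + n) c d (k - c) ha (by omega) hc hd ha' (by omega) hc' hd' (by linear_combination e)
    push_cast at this
    rw [this, add_zero]; congr 1; field_simp
  have M1 : ∀ a b c d k : ℤ, 0 < a → b < 0 → 0 < c → 0 < d → a < n → -n < b → c < n → d < n →
      a * d - b * c = k * n → |k| < n → 
      f ((a : ℚ) * d / (b * c)) = f (((b : ℚ) + n) / b) := by
    intro a b c d k ha hb hc hd ha' hb' hc' hd' e hk
    have kp : 0 < k := by
      nlinarith
    rw [abs_of_pos kp] at hk
    refine M a b c d k ha hb hc hd ha' hb' hc' hd' e ?_ ?_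
    · have := hE c 1 (-k) 1 (k - c) 1 (by rw [abs_le]; omega) (by rw [abs_one]; omega)
        (by rw [abs_le]; omega) (by rw [abs_one]; omega) (by rw [abs_le]; omega) (by rw [abs_one]; omega)
        (by ring)
      rw [← this]; congr 1; push_cast; rw [mul_one, mul_one, neg_div_neg_eq]
    · have := hE a d (-k) (b + n) b (k - c) (by rw [abs_le]; omega) (by rw [abs_le]; omega)
        (by rw [abs_le]; omega) (by rw [abs_le]; omega) (by rw [abs_le]; omega) (by rw [abs_le]; omega)
        (by linear_combination e)
      rw [← this]; congr 1; push_cast; rw [neg_mul, neg_div_neg_eq]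
  have T : ∀ b : ℤ, b < 0 → -n < b → f (((b : ℚ) + n) / b) = 0 := by
    have T0 : ∀ b : ℤ, b < 0 → -n < b → f (((b : ℚ) + n) / b) = f ((((-1 : ℤ) : ℚ) + n) / (-1 : ℤ)) := by
      intro b hb hb'
      rw [← M1 1 (-1) (-b) (b + n) 1 (by omega) (by omega) (by omega) (by omega) (by omega) (by omega)
        (by omega) (by omega) (by ring) (by rw [abs_one]; omega)]
      congr 1; push_cast; simp
    intro b hb hb'
    have e1 := T0 b hb hb'
    have e2 := T0 (-(b + n)) (by omega) (by omega)
    have b0 : (b : ℚ) ≠ 0 := by exact_mod_cast hb.ne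
    have bn0 : (b : ℚ) + n ≠ 0 := by
      have : b + n ≠ 0 := by omega
      exact_mod_cast this
    rw [show (((-(b + n) : ℤ) : ℚ) + n) / (-(b + n) : ℤ) = (((b : ℚ) + n) / b)⁻¹ by
      push_cast; rw [inv_div]; field_simp; ring, h.inv, ← e1] at e2
    apply tf
    linear_combination (norm := module) -e2
  have M2 : ∀ a b c d k : ℤ, 0 < a → b < 0 → 0 < c → 0 < d → a < n → -n < b → c < n → d < n →
      a * d - b * c = k * n → |k| ≤ n → f ((a : ℚ) * d / (b * c)) = 0 := by
    intro a b c d k ha hb hc hd ha' hb' hc' hd' e hk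
    rcases hk.lt_or_eq with hk | hk
    · rw [M1 a b c d k ha hb hc hd ha' hb' hc' hd' e hk, T b hb hb']
    have kp : 0 < k := by
      nlinarith
    rw [abs_of_pos kp] at hk
    subst hk
    have bn0 : (b : ℚ) + n ≠ 0 := by
      have : b + n ≠ 0 := by omega
      exact_mod_cast this
    have e' : (a : ℚ) * d - b * c = n * n := by exact_mod_cast e
    rw [M a b c d n ha hb hc hd ha' hb' hc' hd' e ?_ ?_, T b hb hb']
    · have t := T (c - n) (by omega) (by omega)
      push_cast at t
      have := h.tri_rot (α := c) (β := n - c) (γ := -n) (by ring) (by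
        rw [← t]; congr 1; rw [← neg_div_neg_eq]; congr 1 <;> ring)
      refine h.sub_zero' ?_ this
      push_cast
      field_simp; ring
    · have t := hP a (-b) (n - c) d (b + n) ha (by omega) (by omega) hd ha' (by omega) (by omega) hd'
        (by linear_combination e)
      have := h.tri_rot (α := a * d) (β := b * (n - c)) (γ := -(n * (b + n)))
        (by linear_combination e') (by
        rw [← t]; congr 1; push_cast; rw [neg_mul, div_neg, neg_div])
      refine h.sub_zero' ?_ this
      push_cast
      field_simp; linear_combination e'
  have M3 : ∀ a b c d k : ℤ, 0 < a → 0 < c → b ≠ 0 → d ≠ 0 → a < n → |b| < n → c < n → |d| < n →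
      a * d - b * c = k * n → |k| ≤ n → f ((a : ℚ) * d / (b * c)) = 0 := by
    intro a b c d k ha hc hb hd ha' hb' hc' hd' e hk
    rw [abs_lt] at hb' hd'
    rcases lt_or_gt_of_ne hb with hb | hb <;> rcases lt_or_gt_of_ne hd with hd | hd
    · have := hP a (-b) c (-d) (-k) ha (by omega) hc (by omega) (by omega) (by omega) (by omega) (by omega)
        (by linear_combination -e)
      rw [← this]; congr 1; push_cast; rw [mul_neg, neg_mul, neg_div_neg_eq]
    · exact M2 a b c d k ha hb hc hd ha' hb'.1 hc' hd'.2 e hk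
    · have := M2 c d a b (-k) hc hd ha hb hc' hd'.1 ha' hb'.2 (by linear_combination -e)
        (by rwa [abs_neg])
      refine h.inv_zero ?_ this
      rw [inv_div]; congr 1 <;> ring
    · exact hP a b c d k ha hb hc hd ha' hb'.2 hc' hd'.2 e
  have M4 : ∀ a b c d k : ℤ, 0 < a → c ≠ 0 → b ≠ 0 → d ≠ 0 → a < n → |b| < n → |c| < n → |d| < n →
      a * d - b * c = k * n → |k| ≤ n → f ((a : ℚ) * d / (b * c)) = 0 := by
    intro a b c d k ha hc hb hd ha' hb' hc' hd' e hk
    rcases lt_or_gt_of_ne hc with hc | hc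
    · have := M3 a b (-c) (-d) (-k) ha (by omega) hb (by omega) ha' hb' (by rw [abs_lt] at hc'; omega)
        (by rwa [abs_neg]) (by linear_combination -e) (by rwa [abs_neg])
      rw [← this]; congr 1; push_cast; rw [mul_neg, mul_neg, neg_div_neg_eq]
    · exact M3 a b c d k ha hc hb hd ha' hb' (by rw [abs_lt] at hc'; omega) hd' e hk
  intro a b c d k ha hb hc hd hk e
  by_cases a0 : a = 0
  · simp [a0, h.zero]
  by_cases b0 : b = 0
  · simp [b0, h.zero]
  by_cases c0 : c = 0
  · simp [c0, h.zero]
  by_cases d0 : d = 0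
  · simp [d0, h.zero]
  rcases lt_or_gt_of_ne a0 with a0 | a0
  · have := M4 (-a) (-b) c d (-k) (by omega) c0 (by omega) d0 (by rw [abs_lt] at ha; omega)
      (by rwa [abs_neg]) hc hd (by linear_combination -e) (by rwa [abs_neg])
    rw [← this]; congr 1; push_cast; rw [neg_mul, neg_mul, neg_div_neg_eq]
  · exact M4 a b c d k a0 c0 b0 d0 (by rw [abs_lt] at ha; omega) hb hc hd e hk

/-- additivity for positive vectors -/
theorem addPos {n : ℕ} (hn : 3 ≤ n) (hE : EE f (n - 1)) {a1 b1 a2 b2 a3 b3 D12 D13 D23 : ℤ}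
    (A1 : 0 < a1 ∧ a1 < n) (B1 : 0 < b1 ∧ b1 < n) (A2 : 0 < a2 ∧ a2 < n) (B2 : 0 < b2 ∧ b2 < n)
    (A3 : 0 < a3 ∧ a3 < n) (B3 : 0 < b3 ∧ b3 < n)
    (e12 : a1 * b2 - b1 * a2 = D12 * n) (e13 : a1 * b3 - b1 * a3 = D13 * n)
    (e23 : a2 * b3 - b2 * a3 = D23 * n) :
    f ((a1 : ℚ) * b3 / (b1 * a3)) = f ((a1 : ℚ) * b2 / (b1 * a2)) + f ((a2 : ℚ) * b3 / (b2 * a3)) := by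
  have hn' : ((n - 1 : ℕ) : ℤ) = n - 1 := by push_cast [show 1 ≤ n by omega]; rfl
  unfold EE at hE; rw [hn'] at hE
  have n0 : (n : ℚ) ≠ 0 := by positivity
  have nZ : (0 : ℤ) < n := by positivity
  have bd : ∀ a b c d D : ℤ, (0 < a ∧ a < n) → (0 < b ∧ b < n) → (0 < c ∧ c < n) → (0 < d ∧ d < n) →
      a * d - b * c = D * n → |D| ≤ n - 1 := by
    intro a b c d D ha hb hc hd e
    have h1 : a * d < n * n := by nlinarith
    have h2 : b * c < n * n := by nlinarith
    have h3 : 0 < a * d := by nlinarith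
    have h4 : 0 < b * c := by nlinarith
    rw [abs_le]; constructor
    · nlinarith
    · nlinarith
  have b12 := bd _ _ _ _ _ A1 B1 A2 B2 e12
  have b13 := bd _ _ _ _ _ A1 B1 A3 B3 e13
  have b23 := bd _ _ _ _ _ A2 B2 A3 B3 e23
  have c0 : ∀ a : ℤ, (0 < a ∧ a < n) → (a : ℚ) ≠ 0 := fun a h => by exact_mod_cast h.1.ne'
  have cb : ∀ a : ℤ, (0 < a ∧ a < n) → |a| ≤ n - 1 := fun a h => by rw [abs_le]; omega
  refine h.add n0 (c0 _ A1) (c0 _ B1) (c0 _ A2) (c0 _ B2) (c0 _ A3) (c0 _ B3) (D12 := D12) (D13 := D13)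
    (by exact_mod_cast e12) (by exact_mod_cast e13) ?_ ?_
  · have := hE D12 a3 (-D13) a2 a1 D23 b12 (cb _ A3) (by rwa [abs_neg]) (cb _ A2) (cb _ A1) b23 (by
      have : (D12 * a3 + -D13 * a2 + a1 * D23) * n = 0 := by
        grind
      exact (mul_eq_zero.1 this).resolve_right nZ.ne')
    rw [← this]; congr 1; push_cast; rw [neg_mul, neg_div_neg_eq]
  · have := hE D12 b3 (-D13) b2 b1 D23 b12 (cb _ B3) (by rwa [abs_neg]) (cb _ B2) (cb _ B1) b23 (by
      have : (D12 * b3 + -D13 * b2 + b1 * D23) * n = 0 := by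
        grind
      exact (mul_eq_zero.1 this).resolve_right nZ.ne')
    rw [← this]; congr 1; push_cast; rw [neg_mul, neg_div_neg_eq]
end Alt


theorem Alt.PosT_comp {B : Type*} [AddCommGroup B] {f : ℚ → B} (h : Alt f)
    {n : ℕ} (hn : 3 ≤ n) (hE : EE f (n - 1)) {r s : ℕ} (hr : r < n) (hs : s < n)
    (hrs : n = r * s) : PosT f n := by
  have hn' : ((n - 1 : ℕ) : ℤ) = n - 1 := by push_cast [show 1 ≤ n by omega]; rfl
  have hE' := hE
  unfold EE at hE'; rw [hn'] at hE'
  have nZ : (0 : ℤ) < n := by positivity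
  have K1 : ∀ a b c d k : ℤ, 0 < a → 0 < b → 0 < c → 0 < d → a < n → b < n → c < n → d < n →
      a * d - b * c = k * n → (k = 1 ∨ k = -1) → f ((a : ℚ) * d / (b * c)) = 0 := by
    intro a b c d k ha hb hc hd ha' hb' hc' hd' e hk
    have := hE' a d (-b) c (-k * r) s (by rw [abs_le]; omega) (by rw [abs_le]; omega)
      (by rw [abs_le]; omega) (by rw [abs_le]; omega)
      (by rw [abs_le]; rcases hk with hk | hk <;> rw [hk] <;> omega) (by rw [abs_le]; omega)
      (by have : (n : ℤ) = r * s := by exact_mod_cast hrs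
          rw [this] at e; linear_combination e)
    rw [← this]; congr 1; push_cast; rw [neg_mul, neg_div_neg_eq]
  have K : ∀ K : ℕ, ∀ a b c d k : ℤ, k.natAbs ≤ K → 0 < a → 0 < b → 0 < c → 0 < d → a < n → b < n →
      c < n → d < n → a * d - b * c = k * n → f ((a : ℚ) * d / (b * c)) = 0 := by
    intro K
    induction K using Nat.strong_induction_on with
    | _ K ih =>
    have P : ∀ a b c d k : ℤ, k.natAbs ≤ K → 0 < k → 0 < a → 0 < b → 0 < c → 0 < d → a < n → b < n →
      c < n → d < n → a * d - b * c = k * n → f ((a : ℚ) * d / (b * c)) = 0 := by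
      intro a b c d k hk k0 ha hb hc hd ha' hb' hc' hd' e
      by_cases k1 : k = 1
      · exact K1 a b c d k ha hb hc hd ha' hb' hc' hd' e (Or.inl k1)
      have R : ∀ r1 r2 : ℤ, 0 ≤ r1 → 0 ≤ r2 → r1 < k → r2 < k → (r1 ≠ 0 ∨ r2 ≠ 0) → r1 + r2 ≤ k →
          k ∣ r1 * a + r2 * c → k ∣ r1 * b + r2 * d → f ((a : ℚ) * d / (b * c)) = 0 := by
        intro r1 r2 h1 h2 h1' h2' h12 hs ⟨x, hx⟩ ⟨y, hy⟩
        have pos : ∀ u v : ℤ, 0 < u → 0 < v → 0 < r1 * u + r2 * v := by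
          intro u v hu hv
          rcases h12 with h | h
          · positivity
          · positivity
        have x0 : 0 < x := by
          have := pos a c ha hc
          rw [hx] at this; exact pos_of_mul_pos_right this k0.le
        have y0 : 0 < y := by
          have := pos b d hb hd
          rw [hy] at this; exact pos_of_mul_pos_right this k0.le
        have x1 : x < n := by
          have : k * x < k * n := by rw [← hx]; nlinarith
          exact lt_of_mul_lt_mul_left this k0.le
        have y1 : y < n := by
          have : k * y < k * n := by rw [← hy]; nlinarith
          exact lt_of_mul_lt_mul_left this k0.le
        have e1 : a * y - b * x = r2 * n := by
          have : k * (a * y - b * x) = k * (r2 * n) := by linear_combination r2 * e + b * hx - a * hy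
          exact mul_left_cancel₀ k0.ne' this
        have e2 : x * d - y * c = r1 * n := by
          have : k * (x * d - y * c) = k * (r1 * n) := by linear_combination r1 * e + c * hy - d * hx
          exact mul_left_cancel₀ k0.ne' this
        rw [h.addPos hn hE (a2 := x) (b2 := y) ⟨ha, ha'⟩ ⟨hb, hb'⟩ ⟨x0, x1⟩ ⟨y0, y1⟩ ⟨hc, hc'⟩ ⟨hd, hd'⟩ e1 e e2,
          ih r2.natAbs (by omega) a b x y r2 le_rfl ha hb x0 y0 ha' hb' x1 y1 e1,
          ih r1.natAbs (by omega) x y c d r1 le_rfl x0 y0 hc hd x1 y1 hc' hd' e2, add_zero]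
      have R' : ∀ r1 r2 : ℤ, 0 ≤ r1 → 0 ≤ r2 → r1 < k → r2 < k → (r1 ≠ 0 ∨ r2 ≠ 0) →
          k ∣ r1 * a + r2 * c → k ∣ r1 * b + r2 * d → f ((a : ℚ) * d / (b * c)) = 0 := by
        intro r1 r2 h1 h2 h1' h2' h12 d1 d2
        by_cases hs : r1 + r2 ≤ k
        · exact R r1 r2 h1 h2 h1' h2' h12 hs d1 d2
        · refine R (k - r1) (k - r2) (by omega) (by omega) (by omega) (by omega) (by omega) (by omega) ?_ ?_
          · rw [show (k - r1) * a + (k - r2) * c = k * (a + c) - (r1 * a + r2 * c) by ring]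
            exact dvd_sub (dvd_mul_right _ _) d1
          · rw [show (k - r1) * b + (k - r2) * d = k * (b + d) - (r1 * b + r2 * d) by ring]
            exact dvd_sub (dvd_mul_right _ _) d2
      have R2 : ∀ s1 s2 : ℤ, ¬ (k ∣ s1 ∧ k ∣ s2) → 
          k ∣ s1 * a + s2 * c → k ∣ s1 * b + s2 * d → f ((a : ℚ) * d / (b * c)) = 0 := by
        intro s1 s2 hs d1 d2
        have key : ∀ u v : ℤ, k ∣ s1 * u + s2 * v → k ∣ (s1 % k) * u + (s2 % k) * v := by
          intro u v hd
          rw [Int.emod_def, Int.emod_def, show (s1 - k * (s1 / k)) * u + (s2 - k * (s2 / k)) * v =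
            (s1 * u + s2 * v) - k * (s1 / k * u + s2 / k * v) by ring]
          exact dvd_sub hd (dvd_mul_right _ _)
        refine R' (s1 % k) (s2 % k) (Int.emod_nonneg _ k0.ne') (Int.emod_nonneg _ k0.ne')
          (Int.emod_lt_of_pos _ k0) (Int.emod_lt_of_pos _ k0) ?_ (key _ _ d1) (key _ _ d2)
        by_contra hh; push Not at hh
        exact hs ⟨Int.dvd_of_emod_eq_zero hh.1, Int.dvd_of_emod_eq_zero hh.2⟩
      by_cases c1 : k ∣ d ∧ k ∣ -b
      swap
      · exact R2 d (-b) c1 ⟨n, by linear_combination e⟩ ⟨0, by ring⟩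
      by_cases c2 : k ∣ c ∧ k ∣ -a
      swap
      · exact R2 c (-a) c2 ⟨0, by ring⟩ ⟨-n, by linear_combination -e⟩
      obtain ⟨b', hb1⟩ := (dvd_neg.1 c1.2)
      obtain ⟨a', ha1⟩ := (dvd_neg.1 c2.2)
      have a0 : 0 < a' := by rw [ha1] at ha; exact pos_of_mul_pos_right ha k0.le
      have b0 : 0 < b' := by rw [hb1] at hb; exact pos_of_mul_pos_right hb k0.le
      have := K1 a' b' c d 1 a0 b0 hc hd (by nlinarith) (by nlinarith) hc' hd' (by
        have : k * (a' * d - b' * c) = k * (1 * n) := by rw [ha1, hb1] at e; linear_combination e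
        exact mul_left_cancel₀ k0.ne' this) (Or.inl rfl)
      rw [← this, ha1, hb1]; push_cast
      rw [mul_assoc, mul_assoc, mul_div_mul_left]
      exact_mod_cast k0.ne'
    intro a b c d k hk ha hb hc hd ha' hb' hc' hd' e
    rcases lt_trichotomy k 0 with k0 | k0 | k0
    · have := P c d a b (-k) (by omega) (by omega) hc hd ha hb hc' hd' ha' hb' (by linear_combination -e)
      refine h.inv_zero ?_ this
      rw [inv_div]; congr 1 <;> ring
    · rw [k0, zero_mul, sub_eq_zero] at e
      have : (a : ℚ) * d = b * c := by exact_mod_cast e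
      rw [this, div_self, h.one]
      positivity
    · exact P a b c d k hk k0 ha hb hc hd ha' hb' hc' hd' e
  intro a b c d k ha hb hc hd ha' hb' hc' hd' e
  exact K k.natAbs a b c d k le_rfl ha hb hc hd ha' hb' hc' hd' e

/-- coefficient of lambda -/
def lamc (v w : ℚ → ℤ) (x : ℚ) : ℤ := v x * w (1 - x) - v (1 - x) * w x

structure Val (v : ℚ → ℤ) : Prop where
  zero : v 0 = 0
  mul : ∀ x y, x ≠ 0 → y ≠ 0 → v (x * y) = v x + v y
  neg : ∀ x, v (-x) = v x

namespace Val
variable {v : ℚ → ℤ} (hv : Val v)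
include hv
theorem one : v 1 = 0 := by have := hv.mul 1 1 one_ne_zero one_ne_zero; rw [mul_one] at this; omega
theorem div {x y : ℚ} (hx : x ≠ 0) (hy : y ≠ 0) : v (x / y) = v x - v y := by
  have := hv.mul (x / y) y (by positivity) hy
  rw [div_mul_cancel₀ _ hy] at this; omega
theorem sub_comm (x y : ℚ) : v (x - y) = v (y - x) := by rw [← neg_sub, hv.neg]
end Val

theorem lamc_alt {v w : ℚ → ℤ} (hv : Val v) (hw : Val w) : Alt (lamc v w) := by
  refine ⟨?_, ?_, ?_, ?_, ?_⟩
  · simp [lamc, hv.zero, hw.zero, hv.one, hw.one]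
  · simp [lamc, hv.zero, hw.zero, hv.one, hw.one]
  · intro x
    by_cases x0 : x = 0
    · simp [x0, lamc, hv.zero, hw.zero]
    by_cases x1 : x = 1
    · simp [x1, lamc, hv.zero, hw.zero]
    have d : x - 1 ≠ 0 := sub_ne_zero.2 x1
    have e : 1 - x⁻¹ = (x - 1) / x := by field_simp
    have e' : x⁻¹ = 1 / x := by field_simp
    unfold lamc
    rw [e, e', hv.div one_ne_zero x0, hw.div one_ne_zero x0, hv.div d x0, hw.div d x0, hv.one, hw.one,
      hv.sub_comm, hw.sub_comm]; ring
  · intro x; unfold lamc; rw [sub_sub_cancel]; ring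
  · intro x y x0 x1 y0 y1
    by_cases xy : x = y
    · subst xy
      have d : 1 - x ≠ 0 := sub_ne_zero.2 (Ne.symm x1)
      rw [div_self x0, div_self d, div_self (by positivity)]
      simp [lamc, hv.zero, hw.zero, hv.one, hw.one]
    have d : 1 - x ≠ 0 := sub_ne_zero.2 (Ne.symm x1)
    have d' : 1 - y ≠ 0 := sub_ne_zero.2 (Ne.symm y1)
    have d2 : x - y ≠ 0 := sub_ne_zero.2 xy
    have e1 : 1 - y / x = (x - y) / x := by field_simp
    have e2 : 1 - y * (1 - x) / (x * (1 - y)) = (x - y) / (x * (1 - y)) := by field_simp; ring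
    have e3 : 1 - (1 - x) / (1 - y) = (x - y) / (1 - y) := by field_simp; ring
    have a1 : y * (1 - x) ≠ 0 := by positivity
    have a2 : x * (1 - y) ≠ 0 := by positivity
    unfold lamc
    rw [e1, e2, e3]
    rw [hv.div y0 x0, hw.div y0 x0, hv.div d2 x0, hw.div d2 x0, hv.div a1 a2, hw.div a1 a2,
      hv.div d2 a2, hw.div d2 a2, hv.div d d', hw.div d d', hv.div d2 d', hw.div d2 d',
      hv.mul _ _ y0 d, hw.mul _ _ y0 d, hv.mul _ _ x0 d', hw.mul _ _ x0 d']
    ring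

theorem val_padic (p : Nat.Primes) : Val (padicValRat p) := by
  have : Fact (p : ℕ).Prime := ⟨p.2⟩
  exact ⟨by simp, fun x y hx hy => padicValRat.mul hx hy, fun x => padicValRat.neg x⟩

theorem padic_finite (x : ℚ) : {p : Nat.Primes | padicValRat p x ≠ 0}.Finite := by
  refine ((x.num.natAbs.primeFactors ∪ x.den.primeFactors : Finset ℕ).finite_toSet.preimage
    (f := ((↑) : Nat.Primes → ℕ)) (Subtype.coe_injective.injOn)).subset ?_
  intro p hp
  change padicValRat p x ≠ 0 at hp
  simp only [Set.mem_preimage, Finset.coe_union, Set.mem_union, Finset.mem_coe]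
  by_contra hh
  push Not at hh
  apply hp
  by_cases x0 : x = 0
  · simp [x0]
  have n1 : ¬ (p : ℕ) ∣ x.num.natAbs := fun hd => hh.1 (Nat.mem_primeFactors.2 ⟨p.2, hd, by simpa using x0⟩)
  have n2 : ¬ (p : ℕ) ∣ x.den := fun hd => hh.2 (Nat.mem_primeFactors.2 ⟨p.2, hd, by simp⟩)
  rw [padicValRat_def, padicValNat.eq_zero_of_not_dvd n2, padicValInt, padicValNat.eq_zero_of_not_dvd n1]
  simp

abbrev LL := (Nat.Primes × Nat.Primes) →₀ ℤ

def lam (x : ℚ) : LL := Finsupp.ofSupportFinite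
  (fun pq => lamc (padicValRat pq.1) (padicValRat pq.2) x) (by
    refine (((padic_finite x).union (padic_finite (1 - x))).prod
      ((padic_finite x).union (padic_finite (1 - x)))).subset ?_
    rintro ⟨p, q⟩ h
    simp only [Function.mem_support, lamc] at h
    simp only [Set.mem_prod, Set.mem_union, Set.mem_ofPred_eq]
    by_contra hh
    apply h
    by_cases h1 : padicValRat p x = 0 <;> by_cases h2 : padicValRat p (1 - x) = 0 <;>
    by_cases h3 : padicValRat q x = 0 <;> by_cases h4 : padicValRat q (1 - x) = 0 <;> simp_all)

theorem lam_apply (x : ℚ) (p q : Nat.Primes) : lam x (p, q) =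
  lamc (padicValRat p) (padicValRat q) x := rfl

theorem lam_alt : Alt lam := by
  have L := fun p q => lamc_alt (val_padic p) (val_padic q)
  refine ⟨?_, ?_, ?_, ?_, ?_⟩
  · ext ⟨p, q⟩; exact (L p q).zero
  · ext ⟨p, q⟩; exact (L p q).one
  · intro x; ext ⟨p, q⟩; exact (L p q).inv x
  · intro x; ext ⟨p, q⟩; exact (L p q).sub x
  · intro x y h1 h2 h3 h4; ext ⟨p, q⟩; exact (L p q).ft x y h1 h2 h3 h4

theorem Alt.addhom {B : Type*} [AddCommGroup B] {f : ℚ → B} (h : Alt f) (b : LL →+ B) :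
    Alt (fun x => f x + b (lam x)) := by
  refine ⟨?_, ?_, ?_, ?_, ?_⟩
  · simp [h.zero, lam_alt.zero]
  · simp [h.one, lam_alt.one]
  · intro x; simp only [h.inv, lam_alt.inv, map_neg]; abel
  · intro x; simp only [h.sub, lam_alt.sub, map_neg]; abel
  · intro x y h1 h2 h3 h4
    have e1 := h.ft x y h1 h2 h3 h4
    have e2 := congrArg b (lam_alt.ft x y h1 h2 h3 h4)
    simp only [map_add, map_sub, map_zero] at e2
    linear_combination (norm := module) e1 + e2


def Divb (B : Type*) [AddCommGroup B] : Prop := ∀ n : ℕ, n ≠ 0 → ∀ b : B, ∃ c : B, n • c = b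

theorem cocycle_split {Γ : Type*} [CommGroup Γ] [Finite Γ] [IsCyclic Γ] {B : Type*} [AddCommGroup B]
    (dv : Divb B) (G : Γ → Γ → B)
    (hc : ∀ u v w, G u v + G (u * v) w = G v w + G u (v * w)) (h1 : ∀ v, G 1 v = 0) :
    ∃ φ : Γ → B, ∀ u v, G u v = φ u + φ v - φ (u * v) := by
  obtain ⟨g, hg⟩ := IsCyclic.exists_generator (α := Γ)
  have hG1 : ∀ u, G u 1 = 0 := by
    intro u
    have := hc u 1 1
    rw [mul_one, mul_one, h1] at this
    linear_combination (norm := module) this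
  have m0 : orderOf g ≠ 0 := (orderOf_pos g).ne'
  set m := orderOf g with hm
  let S : ℕ → B := fun j => ∑ i ∈ Finset.range j, G (g ^ i) g
  obtain ⟨α, hα⟩ := dv m m0 (S m)
  let ψ : ℕ → B := fun j => j • α - S j
  have per : Function.Periodic ψ m := by
    intro j
    simp only [ψ, S]
    rw [add_comm j m, Finset.sum_range_add]
    have : ∀ i, G (g ^ (m + i)) g = G (g ^ i) g := by
      intro i; rw [pow_add, hm, pow_orderOf_eq_one, one_mul]
    simp only [this]
    have : ∑ i ∈ Finset.range m, G (g ^ i) g = m • α := hα.symm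
    rw [this, add_smul]; abel
  have hj : ∀ u : Γ, ∃ j : ℕ, g ^ j = u := fun u => by
    obtain ⟨j, hj⟩ := (mem_powers_iff_mem_zpowers (x := g) (y := u)).2 (hg u)
    exact ⟨j, hj⟩
  choose J hJ using hj
  have hψ : ∀ i : ℕ, ψ (J (g ^ i)) = ψ i := by
    intro i
    have : J (g ^ i) % m = i % m := (pow_eq_pow_iff_modEq.1 (hJ (g ^ i)))
    rw [← per.map_mod_nat, this, per.map_mod_nat]
  refine ⟨fun u => ψ (J u), ?_⟩
  have step : ∀ u, G u g = ψ (J u) + ψ (J g) - ψ (J (u * g)) := by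
    intro u
    obtain ⟨i, rfl⟩ : ∃ i : ℕ, g ^ i = u := ⟨J u, hJ u⟩
    have e1 := hψ 1
    rw [pow_one] at e1
    rw [hψ, e1, ← pow_succ, hψ]
    simp only [ψ, S, Finset.sum_range_succ, Finset.sum_range_zero, pow_zero, h1]
    module
  have key : ∀ (j : ℕ) u, G u (g ^ j) = ψ (J u) + ψ (J (g ^ j)) - ψ (J (u * g ^ j)) := by
    intro j
    induction j with
    | zero => 
      intro u
      rw [hψ, pow_zero, mul_one, hG1]
      simp [ψ, S]
    | succ j ih =>
      intro u
      have e := hc u (g ^ j) g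
      rw [← pow_succ, ih, step, step, ← pow_succ, mul_assoc, ← pow_succ] at e
      linear_combination (norm := module) -e
  intro u v
  obtain ⟨i, rfl⟩ : ∃ i : ℕ, g ^ i = v := ⟨J v, hJ v⟩
  exact key i u

section
variable {p : ℕ} [hp : Fact p.Prime]

def nv (u : (ZMod p)ˣ) : ℤ := ((u : ZMod p).val : ℤ)
theorem nv_pos (u : (ZMod p)ˣ) : 0 < nv u := by
  unfold nv
  have : (u : ZMod p).val ≠ 0 := by rw [Ne, ZMod.val_eq_zero]; exact u.ne_zero
  omega
theorem nv_lt (u : (ZMod p)ˣ) : nv u < p := by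
  unfold nv; exact_mod_cast ZMod.val_lt _
theorem nv_cast (u : (ZMod p)ˣ) : ((nv u : ℤ) : ZMod p) = u := by
  unfold nv; simp
theorem nv_one : nv (1 : (ZMod p)ˣ) = 1 := by
  unfold nv; have := hp.out.one_lt; 
  have : Fact (1 < p) := ⟨this⟩
  simp [ZMod.val_one]

def uo (a : ℤ) : (ZMod p)ˣ := if h : ((a : ZMod p)) ≠ 0 then Units.mk0 _ h else 1
theorem uo_cast {a : ℤ} (h0 : 0 < a) (h1 : a < p) : ((uo a : (ZMod p)ˣ) : ZMod p) = a := by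
  have : (a : ZMod p) ≠ 0 := by
    rw [Ne, ZMod.intCast_zmod_eq_zero_iff_dvd]
    intro h; have := Int.le_of_dvd h0 h; omega
  unfold uo; rw [dif_pos this]; rfl
theorem nv_uo {a : ℤ} (h0 : 0 < a) (h1 : a < p) : nv (uo a : (ZMod p)ˣ) = a := by
  unfold nv; rw [uo_cast h0 h1]
  rw [ZMod.val_intCast, Int.emod_eq_of_lt h0.le h1]

theorem Alt.prime_step {B : Type*} [AddCommGroup B] (dv : Divb B) {f : ℚ → B} (h : Alt f)
    (h3 : 3 ≤ p) (hE : EE f (p - 1)) :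
    ∃ b : LL →+ B, EE (fun x => f x + b (lam x)) (p - 1) ∧ PosT (fun x => f x + b (lam x)) p := by
  let G : (ZMod p)ˣ → (ZMod p)ˣ → B := fun u v => f ((nv (u * v) : ℚ) / (nv u * nv v))
  have Q1 : ∀ u v w : (ZMod p)ˣ,
      f ((nv (u * v) : ℚ) * nv w / (nv u * nv (v * w))) = G u v - G v w := by
    intro u v w
    have ex : ∀ a b c d : (ZMod p)ˣ, a * d = b * c → ∃ D : ℤ, nv a * nv d - nv b * nv c = D * p := by
      intro a b c d e
      have : (p : ℤ) ∣ nv a * nv d - nv b * nv c := by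
        rw [← ZMod.intCast_zmod_eq_zero_iff_dvd]
        push_cast [nv_cast]
        rw [← Units.val_mul, e, Units.val_mul, sub_self]
      obtain ⟨D, hD⟩ := this
      exact ⟨D, by rw [hD, mul_comm]⟩
    obtain ⟨D12, e12⟩ := ex (u * v) u v 1 (mul_one _)
    obtain ⟨D13, e13⟩ := ex (u * v) u (v * w) w (mul_assoc _ _ _)
    obtain ⟨D23, e23⟩ := ex v 1 (v * w) w (one_mul _).symm
    have := h.addPos h3 hE ⟨nv_pos _, nv_lt _⟩ ⟨nv_pos _, nv_lt _⟩ ⟨nv_pos _, nv_lt _⟩ ⟨nv_pos _, nv_lt _⟩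
      ⟨nv_pos _, nv_lt _⟩ ⟨nv_pos _, nv_lt _⟩ e12 e13 e23
    rw [this, nv_one, Int.cast_one, mul_one, one_mul]
    simp only [G]
    rw [show (nv v : ℚ) * nv w / nv (v * w) = ((nv (v * w) : ℚ) / (nv v * nv w))⁻¹ by rw [inv_div], h.inv]
    abel
  have comm : ∀ u v, G u v = G v u := by
    grind
  have cocyc : ∀ t w v, G t w + G (t * w) v = G w v + G t (w * v) := by
    intro t w v
    have e1 := Q1 (t * w) v w
    have e2 := Q1 (v * w) t w
    rw [show v * w * t = t * w * v by rw [mul_comm t w, mul_comm v w, mul_assoc, mul_assoc, mul_comm v t],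
      mul_comm (nv (v * w) : ℚ), e1] at e2
    rw [comm w v, comm t (w * v), mul_comm w v]
    linear_combination (norm := module) e2
  have one : ∀ v, G 1 v = 0 := by
    intro v; simp only [G]; rw [one_mul, nv_one, Int.cast_one, one_mul, div_self, h.one]
    exact_mod_cast (nv_pos v).ne'
  obtain ⟨φ, hφ⟩ := cocycle_split dv G cocyc one
  let Φ : ℤ → B := fun a => φ (uo a)
  have F1 : ∀ a b c d k : ℤ, 0 < a → 0 < b → 0 < c → 0 < d → a < p → b < p → c < p → d < p →
      a * d - b * c = k * p → f ((a : ℚ) * d / (b * c)) = Φ b + Φ c - Φ a - Φ d := by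
    intro a b c d k ha hb hc hd ha' hb' hc' hd' e
    have := Q1 (uo b) (uo a / uo b) (uo d)
    have e1 : (uo b : (ZMod p)ˣ) * (uo a / uo b) = uo a := by simp
    have e2 : (uo a : (ZMod p)ˣ) / uo b * uo d = uo c := by
      rw [div_mul_eq_mul_div, div_eq_iff_eq_mul]
      ext
      rw [Units.val_mul, Units.val_mul, uo_cast ha ha', uo_cast hb hb', uo_cast hc hc', uo_cast hd hd',
        ← sub_eq_zero]
      have : ((a * d - b * c : ℤ) : ZMod p) = 0 := by rw [e]; simp
      push_cast at this; linear_combination this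
    rw [hφ, hφ, e1, e2, nv_uo ha ha', nv_uo hb hb', nv_uo hc hc', nv_uo hd hd'] at this
    rw [this]; simp only [Φ]; abel
  have F2 : ∀ a b : ℤ, 0 < a → 0 < b → a * b < p → Φ (a * b) = Φ a + Φ b := by
    intro a b ha hb hab
    have h1 : a < p := by nlinarith
    have h2 : b < p := by nlinarith
    have h0 := F1 (a * b) a b 1 0 (by positivity) ha hb one_pos hab h1 h2 (by omega) (by ring)
    have Φ1 : Φ 1 = 0 := by
      have := F1 1 1 1 1 0 one_pos one_pos one_pos one_pos (by omega) (by omega) (by omega) (by omega) (by ring)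
      have e := hφ 1 1
      rw [one, one_mul] at e
      have u1 : (uo 1 : (ZMod p)ˣ) = 1 := by
        ext; rw [uo_cast one_pos (by omega)]; simp
      simp only [Φ, u1]; linear_combination (norm := module) -e
    push_cast at h0
    rw [mul_one, div_self (by positivity), h.one, Φ1] at h0
    linear_combination (norm := module) h0
  have Φ1 : Φ 1 = 0 := by
    have := F2 1 1 one_pos one_pos (by omega)
    rw [mul_one] at this; linear_combination (norm := module) -this
  let S : Finset Nat.Primes := Finset.subtype Nat.Prime (Finset.range p)
  let P : Nat.Primes := ⟨p, hp.out⟩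
  let hh : ℚ → B := fun x => ∑ l ∈ S, padicValRat l x • Φ (l : ℕ)
  have hh_mul : ∀ x y, x ≠ 0 → y ≠ 0 → hh (x * y) = hh x + hh y := by
    intro x y hx hy; simp only [hh]
    rw [← Finset.sum_add_distrib]
    exact Finset.sum_congr rfl (fun l _ => by rw [(val_padic l).mul x y hx hy, add_smul])
  have hh_div : ∀ x y, x ≠ 0 → y ≠ 0 → hh (x / y) = hh x - hh y := by
    intro x y hx hy
    have := hh_mul (x / y) y (by positivity) hy
    rw [div_mul_cancel₀ _ hy] at this
    rw [this]; abel
  have hh_nat : ∀ n : ℕ, n ≠ 0 → n < p → hh n = Φ n := by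
    intro n
    induction n using Nat.recOnMul with
    | zero => intro h; exact absurd rfl h
    | one => intro _ _; simp [hh, Φ1]
    | prime q hq =>
      intro _ hqp
      simp only [hh]
      have : Fact q.Prime := ⟨hq⟩
      refine (Finset.sum_eq_single (M := B) (⟨q, hq⟩ : Nat.Primes) ?_ ?_).trans ?_
      rotate_left 2
      · simp [padicValRat.of_nat]
      · intro l _ hl
        have : Fact (l : ℕ).Prime := ⟨l.2⟩
        rw [padicValRat.of_nat, padicValNat_primes (fun e => hl (Subtype.ext e))]; simp
      · intro hh; exact absurd (Finset.mem_subtype.2 (Finset.mem_range.2 hqp)) hh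
    | mul a b iha ihb =>
      intro h0 hab
      have ha : a ≠ 0 := by rintro rfl; simp at h0
      have hb : b ≠ 0 := by rintro rfl; simp at h0
      push_cast
      rw [hh_mul _ _ (by positivity) (by positivity), iha ha (by nlinarith [Nat.pos_of_ne_zero hb]),
        ihb hb (by nlinarith [Nat.pos_of_ne_zero ha]), F2 a b (by positivity) (by positivity) (by exact_mod_cast hab)]
  have hh_int : ∀ a : ℤ, 0 < a → a < p → hh a = Φ a := by
    intro a h0 h1
    lift a to ℕ using h0.le
    exact_mod_cast hh_nat a (by omega) (by omega)
  let b : LL →+ B := ∑ l ∈ S, ((zmultiplesHom B (Φ (l : ℕ)))).comp (Finsupp.applyAddHom (l, P))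
  have hb : ∀ x, b (lam x) = ∑ l ∈ S, lamc (padicValRat l) (padicValRat p) x • Φ (l : ℕ) := by
    intro x; simp only [b, AddMonoidHom.finsetSum_apply]; rfl
  have vp0 : ∀ a : ℤ, a ≠ 0 → |a| < p → padicValRat p a = 0 := by
    intro a h0 h1
    rw [padicValRat.of_int, padicValInt.eq_zero_of_not_dvd]; · rfl
    intro hd
    have := Int.le_of_dvd (abs_pos.2 h0) ((dvd_abs _ _).2 hd)
    omega
  have vP := val_padic P
  change Val (padicValRat p) at vP
  refine ⟨b, ?_, ?_⟩
  · intro a1 b1 c1 d1 e1 g1 ha hb' hc hd he hg E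
    have hn' : ((p - 1 : ℕ) : ℤ) = p - 1 := by push_cast [show 1 ≤ p by omega]; rfl
    simp only
    rw [hE a1 b1 c1 d1 e1 g1 ha hb' hc hd he hg E, zero_add]
    rw [hn'] at ha hb' hc hd he hg
    have E' : (a1 : ℚ) * b1 + c1 * d1 + e1 * g1 = 0 := by exact_mod_cast E
    by_cases z1 : a1 = 0
    · simp [z1, lam_alt.zero]
    by_cases z2 : b1 = 0
    · simp [z2, lam_alt.zero]
    by_cases z3 : c1 = 0
    · simp [z3, lam_alt.zero]
    by_cases z4 : d1 = 0
    · simp [z4, lam_alt.zero]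
    have z1' : (a1 : ℚ) ≠ 0 := by exact_mod_cast z1
    have z2' : (b1 : ℚ) ≠ 0 := by exact_mod_cast z2
    have z3' : (c1 : ℚ) ≠ 0 := by exact_mod_cast z3
    have z4' : (d1 : ℚ) ≠ 0 := by exact_mod_cast z4
    by_cases z5 : e1 * g1 = 0
    · have : -((a1 : ℚ) * b1) / (c1 * d1) = 1 := by
        have : (e1 : ℚ) * g1 = 0 := by exact_mod_cast z5
        field_simp; linear_combination this - E'
      rw [this, lam_alt.one, map_zero]
    rw [hb]
    have z6 : e1 ≠ 0 := by rintro rfl; simp at z5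
    have z7 : g1 ≠ 0 := by rintro rfl; simp at z5
    have z6' : (e1 : ℚ) ≠ 0 := by exact_mod_cast z6
    have z7' : (g1 : ℚ) ≠ 0 := by exact_mod_cast z7
    have v1 : padicValRat p (-((a1 : ℚ) * b1) / (c1 * d1)) = 0 := by
      rw [vP.div (neg_ne_zero.2 (mul_ne_zero z1' z2')) (mul_ne_zero z3' z4'), vP.neg, vP.mul _ _ z1' z2', vP.mul _ _ z3' z4',
        vp0 a1 z1 (by omega), vp0 b1 z2 (by omega), vp0 c1 z3 (by omega), vp0 d1 z4 (by omega)]; rfl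
    have v2 : padicValRat p (1 - -((a1 : ℚ) * b1) / (c1 * d1)) = 0 := by
      rw [show 1 - -((a1 : ℚ) * b1) / (c1 * d1) = -(e1 * g1) / (c1 * d1) by
        field_simp; linear_combination E', vP.div (neg_ne_zero.2 (mul_ne_zero z6' z7')) (mul_ne_zero z3' z4'), vP.neg, vP.mul _ _ z6' z7', vP.mul _ _ z3' z4',
        vp0 e1 z6 (by omega), vp0 g1 z7 (by omega), vp0 c1 z3 (by omega), vp0 d1 z4 (by omega)]; rfl
    refine Finset.sum_eq_zero (fun l _ => ?_)
    unfold lamc; rw [v1, v2]; simp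
  · intro a1 b1 c1 d1 k ha hb' hc hd ha' hb1' hc' hd' E
    have z1' : (a1 : ℚ) ≠ 0 := by exact_mod_cast ha.ne'
    have z2' : (b1 : ℚ) ≠ 0 := by exact_mod_cast hb'.ne'
    have z3' : (c1 : ℚ) ≠ 0 := by exact_mod_cast hc.ne'
    have z4' : (d1 : ℚ) ≠ 0 := by exact_mod_cast hd.ne'
    have E' : (a1 : ℚ) * d1 - b1 * c1 = k * p := by exact_mod_cast E
    simp only
    have pZ : (0 : ℤ) < p := by omega
    have p0 : (p : ℚ) ≠ 0 := by exact_mod_cast pZ.ne'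
    by_cases k0 : k = 0
    · have : (a1 : ℚ) * d1 / (b1 * c1) = 1 := by
        rw [k0, Int.cast_zero] at E'
        field_simp; linear_combination E'
      rw [this, h.one, lam_alt.one, map_zero, add_zero]
    have k0' : (k : ℚ) ≠ 0 := by exact_mod_cast k0
    have hk : |k| < p := by
      have h1 : a1 * d1 < p * p := by nlinarith
      have h2 : b1 * c1 < p * p := by nlinarith
      have h3 : 0 < a1 * d1 := by nlinarith
      have h4 : 0 < b1 * c1 := by nlinarith
      rw [abs_lt]; constructor
      · nlinarith
      · nlinarith
    have v1 : padicValRat p ((a1 : ℚ) * d1 / (b1 * c1)) = 0 := by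
      rw [vP.div (mul_ne_zero z1' z4') (mul_ne_zero z2' z3'), vP.mul _ _ z1' z4', vP.mul _ _ z2' z3',
        vp0 a1 ha.ne' (by rw [abs_lt]; omega), vp0 b1 hb'.ne' (by rw [abs_lt]; omega), vp0 c1 hc.ne' (by rw [abs_lt]; omega), vp0 d1 hd.ne' (by rw [abs_lt]; omega)]; rfl
    have v2 : padicValRat p (1 - (a1 : ℚ) * d1 / (b1 * c1)) = 1 := by
      rw [show 1 - (a1 : ℚ) * d1 / (b1 * c1) = -(k * p) / (b1 * c1) by
        field_simp; linear_combination -E', vP.div (neg_ne_zero.2 (mul_ne_zero k0' p0)) (mul_ne_zero z2' z3'), vP.neg, vP.mul _ _ k0' p0, vP.mul _ _ z2' z3',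
        vp0 k k0 hk, vp0 b1 hb'.ne' (by rw [abs_lt]; omega), vp0 c1 hc.ne' (by rw [abs_lt]; omega), padicValRat.self hp.out.one_lt]; rfl
    have : b (lam ((a1 : ℚ) * d1 / (b1 * c1))) = hh ((a1 : ℚ) * d1 / (b1 * c1)) := by
      rw [hb]; refine Finset.sum_congr rfl (fun l _ => ?_)
      unfold lamc; rw [v1, v2]; simp
    rw [this, hh_div _ _ (mul_ne_zero z1' z4') (mul_ne_zero z2' z3'), hh_mul _ _ z1' z4', hh_mul _ _ z2' z3',
      hh_int _ ha ha', hh_int _ hb' hb1', hh_int _ hc hc', hh_int _ hd hd',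
      F1 a1 b1 c1 d1 k ha hb' hc hd ha' hb1' hc' hd' E]
    abel
end

theorem Alt.main {B : Type*} [AddCommGroup B] (tf : TF2 B) (dv : Divb B) {f : ℚ → B} (h : Alt f) (N : ℕ) :
    ∃ b : LL →+ B, EE (fun x => f x + b (lam x)) (N + 2) := by
  induction N with
  | zero =>
    refine ⟨0, ?_⟩
    intro a b c d e g ha hb hc hd he hg E
    have h2 : f 2 = 0 := by
      have e1 : f (-1) = 0 := by
        have := h.inv (-1); norm_num at this
        exact tf _ (by linear_combination (norm := module) this)
      have e2 := h.sub (-1); norm_num at e2; rw [e2, e1, neg_zero]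
    have hm : f (-1) = 0 := by
        have := h.inv (-1); norm_num at this
        exact tf _ (by linear_combination (norm := module) this)
    have hhalf : f (1/2) = 0 := by have := h.inv 2; rw [h2, neg_zero] at this; rw [← this]; norm_num
    simp only [AddMonoidHom.zero_apply, add_zero]
    have pr : ∀ a b : ℤ, |a| ≤ ((0 + 2 : ℕ) : ℤ) → |b| ≤ ((0 + 2 : ℕ) : ℤ) → a * b = 0 ∨ a * b = 1 ∨ a * b = -1 ∨ a * b = 2 ∨ a * b = -2
        ∨ a * b = 4 ∨ a * b = -4 := by
      intro a b ha hb
      rw [abs_le] at ha hb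
      obtain ⟨a1, a2⟩ := ha
      obtain ⟨b1, b2⟩ := hb
      push_cast at a1 a2 b1 b2
      norm_num at a1 a2 b1 b2
      interval_cases a <;> interval_cases b <;> simp
    have p1 := pr a b ha hb
    have p2 := pr c d hc hd
    have p3 := pr e g he hg
    rw [show (a : ℚ) * b = ((a * b : ℤ) : ℚ) by push_cast; rfl, show (c : ℚ) * d = ((c * d : ℤ) : ℚ) by push_cast; rfl]
    generalize a * b = x at *
    generalize c * d = y at *
    generalize e * g = z at *
    rcases p1 with rfl | rfl | rfl | rfl | rfl | rfl | rfl <;> 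
    rcases p2 with rfl | rfl | rfl | rfl | rfl | rfl | rfl <;> norm_num [h.zero, h.one, h2, hm, hhalf] <;> omega
  | succ N ih =>
    obtain ⟨b, hb⟩ := ih
    have ha := h.addhom b
    by_cases hp : (N + 3).Prime
    · have : Fact (N + 3).Prime := ⟨hp⟩
      obtain ⟨b', h1, h2⟩ := ha.prime_step (p := N + 3) dv (by omega) hb
      have ha' := ha.addhom b'
      have := ha'.EE_of_OneT (by omega) h1 (ha'.OneT_of_PosT tf (by omega) h1 h2)
      refine ⟨b + b', ?_⟩
      simp only [AddMonoidHom.add_apply, ← add_assoc]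
      exact this
    · obtain ⟨r, hr, r1, r2⟩ := Nat.exists_dvd_of_not_prime (by omega) hp
      obtain ⟨s, hs⟩ := hr
      have r0 : 0 < r := by
        grind
      have s0 : 0 < s := by
        grind
      have rl : r < N + 3 := by
        rw [hs]
        have : s ≠ 1 := by rintro rfl; omega
        have : 2 ≤ s := by omega
        nlinarith
      have sl : s < N + 3 := by
        rw [hs]
        have : 2 ≤ r := by omega
        nlinarith
      refine ⟨b, ?_⟩
      exact ha.EE_of_OneT (n := N + 3) (by omega) hb (ha.OneT_of_PosT tf (by omega) hb (ha.PosT_comp (by omega) hb rl sl hs))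


/-- data on the residue field -/
structure GD {k : Type*} [Field k] {A : Type*} [AddCommGroup A] (g : k → A) : Prop where
  qd : QD (fun _ => 1) g
  refl : ∀ a, g a + g (1 - a) = g 0
  three : g 0 + g 0 + g 0 = 0

section res
variable (p : ℕ) [Fact p.Prime]

/-- `x` is `p`-integral with residue `a` -/
def Res (x : ℚ) (a : ZMod p) : Prop := (x.den : ZMod p) ≠ 0 ∧ (x : ZMod p) = a

variable {p}
theorem Res_iff {x : ℚ} {a : ZMod p} : Res p x a ↔
    ∃ m n : ℤ, (n : ZMod p) ≠ 0 ∧ x = m / n ∧ (m : ZMod p) / n = a := by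
  constructor
  · rintro ⟨h1, h2⟩
    exact ⟨x.num, x.den, by exact_mod_cast h1, by simp [Rat.num_div_den],
      by rw [← h2, Rat.cast_def]; simp⟩
  · rintro ⟨m, n, h1, rfl, rfl⟩
    have hn : n ≠ 0 := by rintro rfl; simp at h1
    have hd : ((((m : ℚ) / n).den : ℤ)) ∣ n := by
      have := Rat.den_dvd m n
      rwa [Rat.divInt_eq_div] at this
    have h2 : ((((m : ℚ) / n).den : ℕ) : ZMod p) ≠ 0 := by
      intro h
      obtain ⟨c, hc⟩ := hd
      apply h1; rw [hc]; push_cast; rw [h, zero_mul]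
    refine ⟨h2, ?_⟩
    rw [Rat.cast_def, div_eq_div_iff h2 h1]
    have e : ((m : ℚ) / n).num * n = m * ((m : ℚ) / n).den := by
      have := Rat.num_div_den ((m : ℚ) / n)
      have hh : ((((m : ℚ) / n).den : ℕ) : ℚ) ≠ 0 := by positivity
      have hn' : (n : ℚ) ≠ 0 := by exact_mod_cast hn
      rw [div_eq_div_iff hh hn'] at this
      exact_mod_cast this
    exact_mod_cast congrArg (Int.cast : ℤ → ZMod p) e

theorem Res.uniq {x : ℚ} {a b : ZMod p} (h : Res p x a) (h' : Res p x b) : a = b := h.2.symm.trans h'.2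

theorem Res.mul {x y : ℚ} {a b : ZMod p} (h : Res p x a) (h' : Res p y b) : Res p (x * y) (a * b) := by
  rw [Res_iff] at *
  obtain ⟨m, n, h1, rfl, rfl⟩ := h
  obtain ⟨m', n', h1', rfl, rfl⟩ := h'
  exact ⟨m * m', n * n', by push_cast; exact mul_ne_zero h1 h1', by push_cast; rw [div_mul_div_comm],
    by push_cast; rw [div_mul_div_comm]⟩

theorem Res.sub {x y : ℚ} {a b : ZMod p} (h : Res p x a) (h' : Res p y b) : Res p (x - y) (a - b) := by
  rw [Res_iff] at *
  obtain ⟨m, n, h1, rfl, rfl⟩ := h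
  obtain ⟨m', n', h1', rfl, rfl⟩ := h'
  have hn : (n : ℚ) ≠ 0 := by rintro h; norm_cast at h; subst h; simp at h1
  have hn' : (n' : ℚ) ≠ 0 := by rintro h; norm_cast at h; subst h; simp at h1'
  exact ⟨m * n' - n * m', n * n', by push_cast; exact mul_ne_zero h1 h1',
    by push_cast; rw [div_sub_div _ _ hn hn'],
    by push_cast; rw [div_sub_div _ _ h1 h1']⟩

theorem Res.inv {x : ℚ} {a : ZMod p} (h : Res p x a) (ha : a ≠ 0) : Res p x⁻¹ a⁻¹ := by
  rw [Res_iff] at *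
  obtain ⟨m, n, h1, rfl, rfl⟩ := h
  refine ⟨n, m, fun h => ha (by rw [h, zero_div]), by rw [inv_div], by rw [inv_div]⟩

theorem Res.div {x y : ℚ} {a b : ZMod p} (h : Res p x a) (h' : Res p y b) (hb : b ≠ 0) :
    Res p (x / y) (a / b) := by
  rw [div_eq_mul_inv, div_eq_mul_inv]; exact h.mul (h'.inv hb)

theorem Res.int (n : ℤ) : Res p n (n : ZMod p) :=
  Res_iff.2 ⟨n, 1, by simp, by simp, by simp⟩
theorem Res.one : Res p 1 1 := by simpa using Res.int (p := p) 1
theorem Res.zero : Res p 0 0 := by simpa using Res.int (p := p) 0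

theorem Res.or (x : ℚ) : (∃ a, Res p x a) ∨ (Res p x⁻¹ 0 ∧ x ≠ 0) := by
  by_cases h : (x.den : ZMod p) = 0
  · right
    have hn : ((x.num : ℤ) : ZMod p) ≠ 0 := by
      intro h'
      rw [ZMod.natCast_eq_zero_iff] at h
      rw [ZMod.intCast_zmod_eq_zero_iff_dvd] at h'
      have := Nat.dvd_gcd (Int.natCast_dvd.1 h') h
      rw [x.reduced.gcd_eq_one] at this
      exact (Fact.out : p.Prime).one_lt.ne' (Nat.dvd_one.1 this)
    refine ⟨Res_iff.2 ⟨x.den, x.num, hn, ?_, by push_cast; rw [h, zero_div]⟩, ?_⟩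
    · conv_lhs => rw [← Rat.num_div_den x]
      rw [inv_div]; push_cast; rfl
    · rintro rfl; simp at hn
  · exact Or.inl ⟨_, h, rfl⟩

theorem Res.lift (a : ZMod p) : Res p (a.val : ℤ) a := by
  have := Res.int (p := p) (a.val : ℤ)
  simpa using this

theorem Res.ne {x : ℚ} {a : ZMod p} (h : Res p x a) (ha : a ≠ 0) : x ≠ 0 := by
  rintro rfl; exact ha (h.uniq Res.zero)
theorem Res.ne1 {x : ℚ} {a : ZMod p} (h : Res p x a) (ha : a ≠ 1) : x ≠ 1 := by
  rintro rfl; exact ha (h.uniq Res.one)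

theorem Res.not_inf {x : ℚ} {a : ZMod p} (h : Res p x a) (hx : x ≠ 0) : ¬ Res p x⁻¹ 0 := by
  intro h'
  have := h.mul h'
  rw [mul_inv_cancel₀ hx, mul_zero] at this
  exact zero_ne_one (this.uniq Res.one)

/-- lift to `ℚ` -/
def lft {A : Type*} [AddCommGroup A] (g : ZMod p → A) (x : ℚ) : A :=
  if (x.den : ZMod p) = 0 then - g 0 else g x

variable {A : Type*} [AddCommGroup A] {g : ZMod p → A}

theorem lft_res {x : ℚ} {a : ZMod p} (h : Res p x a) : lft g x = g a := by
  rw [lft, if_neg h.1, h.2]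

theorem lft_inf {x : ℚ} (hx : x ≠ 0) (h : Res p x⁻¹ 0) : lft g x = - g 0 := by
  rw [lft, if_pos]
  by_contra h'
  exact Res.not_inf ⟨h', rfl⟩ hx h

theorem GD.lft_inv (hg : GD g) (x : ℚ) (hx : x ≠ 0) : lft g x⁻¹ = - lft g x := by
  rcases Res.or (p := p) x with ⟨a, ha⟩ | ⟨h, _⟩
  · by_cases h0 : a = 0
    · subst h0
      rw [lft_res ha, lft_inf (inv_ne_zero hx) (by rwa [inv_inv])]
    · rw [lft_res ha, lft_res (ha.inv h0)]; exact hg.qd.inv a h0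
  · rw [lft_res h, lft_inf hx h, neg_neg]

end res

section lifts
variable {p : ℕ} [Fact p.Prime] {A : Type*} [AddCommGroup A] {g : ZMod p → A}

theorem GD.g1 (hg : GD g) : g 1 = 0 := hg.qd.one

theorem GD.lift (hg : GD g) {χ : ℚ → ℤ} (hχ : Chi χ) (hu : ∀ x (a : ZMod p), Res p x a → a ≠ 0 → χ x = 1) :
    QD χ (lft g) := by
  have inf : ∀ w : ℚ, w ≠ 0 → Res p w⁻¹ 0 → lft g w = - g 0 := fun w => lft_inf
  have res : ∀ {w : ℚ} {a : ZMod p}, Res p w a → lft g w = g a := fun h => lft_res h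
  have I : ∀ {w : ℚ} {a : ZMod p}, Res p w⁻¹ a → w ≠ 0 → lft g w = - g a := by
    intro w a h hw
    have := hg.lft_inv w hw
    rw [res h] at this; rw [this, neg_neg]
  have J : ∀ {w a : ℚ}, Res p w 1 → a ≠ 0 → lft g (a * w) = lft g a := by
    intro w a hw ha
    have hw0 : w ≠ 0 := hw.ne one_ne_zero
    rcases Res.or (p := p) a with ⟨b, hb⟩ | ⟨h, _⟩
    · have := hb.mul hw; rw [mul_one] at this; rw [res this, res hb]
    · have := h.mul (hw.inv one_ne_zero); rw [zero_mul, ← mul_inv] at this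
      rw [I this (mul_ne_zero ha hw0), I h ha]
  have o : Res p 1 1 := Res.one
  refine ⟨by rw [res o, hg.g1], fun x hx => hg.lft_inv x hx, ?_⟩
  intro x y hx hx1 hy hy1
  have sx : 1 - x ≠ 0 := sub_ne_zero.2 (Ne.symm hx1)
  have sy : 1 - y ≠ 0 := sub_ne_zero.2 (Ne.symm hy1)
  have g1 := hg.g1
  have g3 := hg.three
  have T1 : y / x ≠ 0 := by positivity
  have T2 : y * (1 - x) / (x * (1 - y)) ≠ 0 := by positivity
  have T3 : (1 - x) / (1 - y) ≠ 0 := by positivity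
  rcases Res.or (p := p) x with ⟨a, ha⟩ | ⟨ha, _⟩
  · have h1a : Res p (1 - x) (1 - a) := o.sub ha
    by_cases a0 : a = 0
    · subst a0; rw [sub_zero] at h1a
      have e1 : χ (1 - x) = 1 := hu _ _ h1a one_ne_zero
      rw [e1, mul_one]
      rcases Res.or (p := p) y with ⟨b, hb⟩ | ⟨hb, _⟩
      · have h1b : Res p (1 - y) (1 - b) := o.sub hb
        by_cases b0 : b = 0
        · subst b0; rw [sub_zero] at h1b
          have hU : Res p ((1 - x) / (1 - y)) 1 := by simpa using h1a.div h1b one_ne_zero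
          have : y * (1 - x) / (x * (1 - y)) = y / x * ((1 - x) / (1 - y)) := by field_simp
          rw [this, J hU T1, res hU, res ha, res hb, g1]
          module
        by_cases b1 : b = 1
        · subst b1; rw [sub_self] at h1b
          have t1 : Res p (y / x)⁻¹ 0 := by rw [inv_div]; simpa using ha.div hb one_ne_zero
          have t2 : Res p (y * (1 - x) / (x * (1 - y)))⁻¹ 0 := by
            rw [inv_div]; simpa using (ha.mul h1b).div (hb.mul h1a) (by simp)
          have t3 : Res p ((1 - x) / (1 - y))⁻¹ 0 := by rw [inv_div]; simpa using h1b.div h1a one_ne_zero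
          rw [res ha, res hb, I t1 T1, I t2 T2, I t3 T3, g1]; module
        · have b1' : 1 - b ≠ 0 := sub_ne_zero.2 (Ne.symm b1)
          have t1 : Res p (y / x)⁻¹ 0 := by rw [inv_div]; simpa using ha.div hb b0
          have t2 : Res p (y * (1 - x) / (x * (1 - y)))⁻¹ 0 := by
            rw [inv_div]; simpa using (ha.mul h1b).div (hb.mul h1a) (by simpa using b0)
          have t3 : Res p ((1 - x) / (1 - y))⁻¹ (1 - b) := by rw [inv_div]; simpa using h1b.div h1a one_ne_zero
          rw [res ha, res hb, I t1 T1, I t2 T2, I t3 T3]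
          linear_combination (norm := module) - hg.refl b
      · have hc : Res p (1 - y⁻¹) 1 := by simpa using o.sub hb
        have t1 : Res p (y / x)⁻¹ 0 := by
          have : (y / x)⁻¹ = x * y⁻¹ := by field_simp
          rw [this]; simpa using ha.mul hb
        have t2 : Res p (y * (1 - x) / (x * (1 - y)))⁻¹ 0 := by
          have : (y * (1 - x) / (x * (1 - y)))⁻¹ = x * (y⁻¹ - 1) / (1 - x) := by field_simp
          rw [this]; simpa using (ha.mul (hb.sub o)).div h1a one_ne_zero
        have t3 : Res p ((1 - x) / (1 - y)) 0 := by
          have : y⁻¹ - 1 ≠ 0 := by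
            grind
          have : (1 - x) / (1 - y) = (1 - x) * y⁻¹ / (y⁻¹ - 1) := by field_simp
          rw [this]; simpa using (h1a.mul hb).div (hb.sub o) (by simp)
        rw [res ha, I hb hy, I t1 T1, I t2 T2, res t3]; linear_combination (norm := module) g3
    by_cases a1 : a = 1
    · subst a1; rw [sub_self] at h1a
      have e1 : χ x = 1 := hu _ _ ha one_ne_zero
      rw [e1, one_mul]
      rcases Res.or (p := p) y with ⟨b, hb⟩ | ⟨hb, _⟩
      · have h1b : Res p (1 - y) (1 - b) := o.sub hb
        by_cases b1 : b = 1
        · subst b1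
          have hU : Res p (y / x) 1 := by simpa using hb.div ha one_ne_zero
          have : y * (1 - x) / (x * (1 - y)) = (1 - x) / (1 - y) * (y / x) := by field_simp
          rw [this, J hU T3, res hU, res ha, res hb, g1]; module
        · have b1' : 1 - b ≠ 0 := sub_ne_zero.2 (Ne.symm b1)
          have t1 : Res p (y / x) b := by simpa using hb.div ha one_ne_zero
          have t2 : Res p (y * (1 - x) / (x * (1 - y))) 0 := by
            simpa using (hb.mul h1a).div (ha.mul h1b) (by simpa using b1')
          have t3 : Res p ((1 - x) / (1 - y)) 0 := by simpa using h1a.div h1b b1'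
          rw [res ha, res hb, res t1, res t2, res t3, g1]; module
      · have nz : y⁻¹ - 1 ≠ 0 := by
          grind
        have t1 : Res p (y / x)⁻¹ 0 := by
          have : (y / x)⁻¹ = x * y⁻¹ := by field_simp
          rw [this]; simpa using ha.mul hb
        have t2 : Res p (y * (1 - x) / (x * (1 - y))) 0 := by
          have : y * (1 - x) / (x * (1 - y)) = (1 - x) / (x * (y⁻¹ - 1)) := by field_simp
          rw [this]; simpa using h1a.div (ha.mul (hb.sub o)) (by simp)
        have t3 : Res p ((1 - x) / (1 - y)) 0 := by
          have : (1 - x) / (1 - y) = (1 - x) * y⁻¹ / (y⁻¹ - 1) := by field_simp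
          rw [this]; simpa using (h1a.mul hb).div (hb.sub o) (by simp)
        rw [res ha, I hb hy, I t1 T1, res t2, res t3, g1]; module
    · have a1' : 1 - a ≠ 0 := sub_ne_zero.2 (Ne.symm a1)
      rw [hu _ _ ha a0, hu _ _ h1a a1']
      rcases Res.or (p := p) y with ⟨b, hb⟩ | ⟨hb, _⟩
      · have h1b : Res p (1 - y) (1 - b) := o.sub hb
        by_cases b0 : b = 0
        · subst b0; rw [sub_zero] at h1b
          have t1 : Res p (y / x) 0 := by simpa using hb.div ha a0
          have t2 : Res p (y * (1 - x) / (x * (1 - y))) 0 := by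
            simpa using (hb.mul h1a).div (ha.mul h1b) (by simpa using a0)
          have t3 : Res p ((1 - x) / (1 - y)) (1 - a) := by simpa using h1a.div h1b one_ne_zero
          rw [res ha, res hb, res t1, res t2, res t3]
          linear_combination (norm := module) hg.refl a
        by_cases b1 : b = 1
        · subst b1; rw [sub_self] at h1b
          have t1 : Res p (y / x)⁻¹ a := by rw [inv_div]; simpa using ha.div hb one_ne_zero
          have t2 : Res p (y * (1 - x) / (x * (1 - y)))⁻¹ 0 := by
            rw [inv_div]; simpa using (ha.mul h1b).div (hb.mul h1a) (by simpa using a1')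
          have t3 : Res p ((1 - x) / (1 - y))⁻¹ 0 := by rw [inv_div]; simpa using h1b.div h1a a1'
          rw [res ha, res hb, I t1 T1, I t2 T2, I t3 T3, g1]; module
        · have b1' : 1 - b ≠ 0 := sub_ne_zero.2 (Ne.symm b1)
          rw [res ha, res hb, res (hb.div ha a0), res ((hb.mul h1a).div (ha.mul h1b) (mul_ne_zero a0 b1')),
            res (h1a.div h1b b1')]
          exact hg.qd.ft a b a0 a1 b0 b1
      · have nz : y⁻¹ - 1 ≠ 0 := by
          grind
        have t1 : Res p (y / x)⁻¹ 0 := by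
          have : (y / x)⁻¹ = x * y⁻¹ := by field_simp
          rw [this]; simpa using ha.mul hb
        have t2 : Res p (y * (1 - x) / (x * (1 - y))) (1 - a⁻¹) := by
          have : y * (1 - x) / (x * (1 - y)) = (1 - x) / (x * (y⁻¹ - 1)) := by field_simp
          rw [this]
          have e : 1 - a⁻¹ = (1 - a) / (a * (0 - 1)) := by field_simp; ring
          rw [e]; exact h1a.div (ha.mul (hb.sub o)) (by simpa using a0)
        have t3 : Res p ((1 - x) / (1 - y)) 0 := by
          have : (1 - x) / (1 - y) = (1 - x) * y⁻¹ / (y⁻¹ - 1) := by field_simp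
          rw [this]; simpa using (h1a.mul hb).div (hb.sub o) (by simp)
        rw [res ha, I hb hy, I t1 T1, res t2, res t3]
        linear_combination (norm := module) hg.qd.inv a a0 - hg.refl a⁻¹
  · have nx : x⁻¹ - 1 ≠ 0 := by
      grind
    have hcx : Res p (x⁻¹ - 1) (-1) := by simpa using ha.sub o
    have e1 : χ (1 - x) = χ x := by
      have : 1 - x = x * (x⁻¹ - 1) := by field_simp
      rw [this, hχ.mul _ _ hx nx, hu _ _ hcx (by simp), mul_one]
    have e2 : χ x * χ x = 1 := by rcases hχ.pm x hx with h | h <;> rw [h] <;> norm_num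
    rw [e1, e2]
    rcases Res.or (p := p) y with ⟨b, hb⟩ | ⟨hb, _⟩
    · have h1b : Res p (1 - y) (1 - b) := o.sub hb
      by_cases b1 : b = 1
      · subst b1; rw [sub_self] at h1b
        have t1 : Res p (y / x) 0 := by rw [div_eq_mul_inv]; simpa using hb.mul ha
        have t2 : Res p (y * (1 - x) / (x * (1 - y)))⁻¹ 0 := by
          have : (y * (1 - x) / (x * (1 - y)))⁻¹ = (1 - y) / (y * (x⁻¹ - 1)) := by field_simp
          rw [this]; simpa using h1b.div (hb.mul hcx) (by simp)
        have t3 : Res p ((1 - x) / (1 - y))⁻¹ 0 := by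
          have : ((1 - x) / (1 - y))⁻¹ = (1 - y) * x⁻¹ / (x⁻¹ - 1) := by field_simp
          rw [this]; simpa using (h1b.mul ha).div hcx (by simp)
        rw [I ha hx, res hb, res t1, I t2 T2, I t3 T3, g1]; module
      · have b1' : 1 - b ≠ 0 := sub_ne_zero.2 (Ne.symm b1)
        have t1 : Res p (y / x) 0 := by rw [div_eq_mul_inv]; simpa using hb.mul ha
        have t2 : Res p (y * (1 - x) / (x * (1 - y))) (-b / (1 - b)) := by
          have : y * (1 - x) / (x * (1 - y)) = y * (x⁻¹ - 1) / (1 - y) := by field_simp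
          rw [this]; simpa using (hb.mul hcx).div h1b b1'
        have t3 : Res p ((1 - x) / (1 - y))⁻¹ 0 := by
          have : ((1 - x) / (1 - y))⁻¹ = (1 - y) * x⁻¹ / (x⁻¹ - 1) := by field_simp
          rw [this]; simpa using (h1b.mul ha).div hcx (by simp)
        rw [I ha hx, res hb, res t1, res t2, I t3 T3]
        by_cases b0 : b = 0
        · subst b0; simp only [neg_zero, zero_div]; linear_combination (norm := module) -g3
        · have e : -b / (1 - b) = (1 - b⁻¹)⁻¹ := by
            field_simp; ring
          have nb : 1 - b⁻¹ ≠ 0 := by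
            grind
          rw [e, hg.qd.inv _ nb]
          linear_combination (norm := module) hg.refl b⁻¹ - hg.qd.inv b b0
    · have ny : y⁻¹ - 1 ≠ 0 := by
        grind
      have hcy : Res p (y⁻¹ - 1) (-1) := by simpa using hb.sub o
      have hU : Res p ((x⁻¹ - 1) / (y⁻¹ - 1)) 1 := by simpa using hcx.div hcy (by simp)
      have : y * (1 - x) / (x * (1 - y)) = (x⁻¹ - 1) / (y⁻¹ - 1) := by field_simp
      rw [this]
      have : (1 - x) / (1 - y) = (y / x)⁻¹ * ((x⁻¹ - 1) / (y⁻¹ - 1)) := by field_simp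
      rw [this, J hU (inv_ne_zero T1), res hU, I ha hx, I hb hy, hg.lft_inv _ T1, g1]; module

theorem GD.lift_one (hg : GD g) : QD (fun _ : ℚ => 1) (lft g) :=
  hg.lift one_chi (fun _ _ _ _ => rfl)

theorem Res.val {x : ℚ} {a : ZMod p} (h : Res p x a) (hx : x ≠ 0) : 0 ≤ padicValRat p x := by
  by_contra hneg
  push Not at hneg
  rw [padicValRat_def] at hneg
  have hd : p ∣ x.den := by
    by_contra hd; rw [padicValNat.eq_zero_of_not_dvd hd] at hneg; omega
  exact h.1 ((ZMod.natCast_eq_zero_iff _ _).2 hd)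

theorem Res.val_unit {x : ℚ} {a : ZMod p} (h : Res p x a) (ha : a ≠ 0) : padicValRat p x = 0 := by
  have h1 := h.val (h.ne ha)
  have h2 := (h.inv ha).val (inv_ne_zero (h.ne ha))
  rw [padicValRat.inv] at h2; omega

theorem Res.chip {x : ℚ} {a : ZMod p} (h : Res p x a) (ha : a ≠ 0) : chip p x = 1 := by
  unfold _root_.chip; rw [h.val_unit ha]; simp

theorem GD.lift_chip (hg : GD g) : QD (chip p) (lft g) :=
  hg.lift (chip_chi p) (fun _ _ h ha => h.chip ha)

end lifts

section upper
variable {p : ℕ} [Fact p.Prime] {A : Type*} [AddCommGroup A] {f : ℚ → A}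

theorem Res.val_pos {x : ℚ} (h : Res p x 0) (hx : x ≠ 0) : 1 ≤ padicValRat p x := by
  rw [padicValRat_def, padicValNat.eq_zero_of_not_dvd (fun hd => h.1 ((ZMod.natCast_eq_zero_iff _ _).2 hd))]
  have h2 := h.2
  rw [Rat.cast_def, div_eq_zero_iff, or_iff_left h.1, ZMod.intCast_zmod_eq_zero_iff_dvd] at h2
  have := (padicValInt_dvd_iff 1 x.num).1 (by simpa using h2)
  have h3 : x.num ≠ 0 := Rat.num_ne_zero.2 hx
  have := this.resolve_left h3
  omega

theorem res_of_val {x : ℚ} (hx : x ≠ 0) (h : 1 ≤ padicValRat p x) : Res p x 0 := by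
  rcases Res.or (p := p) x with ⟨a, ha⟩ | ⟨h', _⟩
  · by_cases h0 : a = 0
    · rwa [h0] at ha
    · have := ha.val_unit h0; omega
  · have := h'.val_pos (inv_ne_zero hx); rw [padicValRat.inv] at this; omega

theorem chip_p : chip p (p : ℚ) = -1 := by
  unfold chip; rw [padicValRat.self (Fact.out : p.Prime).one_lt]; simp

theorem res_p : Res p (p : ℚ) 0 := by simpa using Res.int (p := p) (p : ℤ)

theorem chip_p_sub {z : ℚ} (hz : Res p z 0) (h : z = 0 ∨ chip p z = 1) : chip p (p - z) = -1 := by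
  have hp : (p : ℚ) ≠ 0 := by exact_mod_cast (Fact.out : p.Prime).ne_zero
  rcases eq_or_ne z 0 with rfl | h0
  · rw [sub_zero]; exact chip_p
  have h1 := h.resolve_left h0
  have h2 : Res p (z / p) 0 := by
    apply res_of_val (by positivity)
    have := hz.val_pos h0
    have he : Even (padicValRat p z) := by
      unfold chip at h1; by_contra hne; rw [if_neg hne] at h1; norm_num at h1
    rw [padicValRat.div h0 hp, padicValRat.self (Fact.out : p.Prime).one_lt]
    obtain ⟨k, hk⟩ := he; omega
  have h3 : Res p (1 - z / p) 1 := by simpa using Res.one.sub h2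
  have e : (p : ℚ) - z = p * (1 - z / p) := by field_simp
  rw [e, (chip_chi p).mul _ _ hp (h3.ne one_ne_zero), chip_p, h3.chip one_ne_zero]; norm_num

theorem QD.to_res (q : QD (chip p) f) (tf : TF2 A) : ∃ g : ZMod p → A, GD g ∧ ∀ x, x ≠ 0 → f x = lft g x := by
  have hχ := chip_chi p
  have k2 : (2 : ℚ) ≠ 0 := two_ne_zero
  have hp0 : (p : ℚ) ≠ 0 := by exact_mod_cast (Fact.out : p.Prime).ne_zero
  have o : Res p 1 1 := Res.one
  have hz : ∀ z, Res p z 0 → z ≠ 0 → f z = f 2 := by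
    intro z h h0
    have h1 : Res p (1 - z) 1 := by simpa using o.sub h
    rcases hχ.pm z h0 with e | e
    · have hx1 : (p : ℚ) ≠ 1 := res_p.ne1 zero_ne_one
      have hne : (p : ℚ) ≠ z := by
        intro h'; rw [← h', chip_p] at e; norm_num at e
      have h1p : Res p (1 - p : ℚ) 1 := by simpa using o.sub (res_p (p := p))
      exact q.mpm hχ tf k2 hp0 hx1 h0 (h.ne1 zero_ne_one) hne e (h1.chip one_ne_zero) chip_p
        (h1p.chip one_ne_zero) (chip_p_sub h (Or.inr e))
    · rw [q.odd hχ tf k2 h0 e, h1.chip one_ne_zero, one_smul]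
  have h1 : ∀ z, Res p z 1 → f z = 0 := by
    intro z h
    rcases eq_or_ne z 1 with rfl | hne
    · exact q.one
    have := q.refl tf k2 (h.ne one_ne_zero) hne
    rw [hz (1 - z) (by simpa using o.sub h) (sub_ne_zero.2 hne.symm)] at this
    linear_combination (norm := module) this
  have hg0 : ∀ z z' (a : ZMod p), Res p z a → Res p z' a → a ≠ 0 → a ≠ 1 → chip p (z - z') = -1 → f z' = f z := by
    intro z z' a h h' a0 a1 e
    have a1' : 1 - a ≠ 0 := sub_ne_zero.2 (Ne.symm a1)
    have hne : z ≠ z' := by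
      rintro rfl; rw [sub_self] at e; unfold chip at e; simp at e
    exact q.ppm hχ tf k2 (h.ne a0) (h.ne1 a1) (h'.ne a0) (h'.ne1 a1) hne (h'.chip a0)
      ((o.sub h').chip a1') (h.chip a0) ((o.sub h).chip a1') e
  have hg : ∀ z z' (a : ZMod p), Res p z a → Res p z' a → a ≠ 0 → f z' = f z := by
    intro z z' a h h' a0
    rcases eq_or_ne a 1 with rfl | a1
    · rw [h1 z h, h1 z' h']
    have hd : Res p (z' - z) 0 := by simpa using h'.sub h
    rcases eq_or_ne z' z with rfl | hne
    · rfl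
    rcases hχ.pm (z' - z) (sub_ne_zero.2 hne) with e | e
    · have hw : Res p (z - (-(p:ℤ) : ℤ)) a := by simpa using h.sub (Res.int (p := p) (-(p : ℤ)))
      have e1 := hg0 _ z a hw h a0 a1 (by
        have : z - (-(p:ℤ) : ℤ) - z = p := by push_cast; ring
        rw [this]; exact chip_p)
      have e2 := hg0 _ z' a hw h' a0 a1 (by
        have : z - (-(p:ℤ) : ℤ) - z' = p - (z' - z) := by push_cast; ring
        rw [this]; exact chip_p_sub hd (Or.inr e))
      rw [e1, e2]
    · exact (hg0 z' z a h' h a0 a1 e).symm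
  let g : ZMod p → A := fun a => if a = 0 then f 2 else f (a.val : ℤ)
  have hgr : ∀ x (a : ZMod p), Res p x a → x ≠ 0 → f x = g a := by
    intro x a h hx
    simp only [g]
    split_ifs with h0
    · subst h0; exact hz x h hx
    · exact hg _ _ a (Res.lift a) h h0
  have three := q.three tf k2
  have g0 : g 0 = f 2 := by simp [g]
  have G : GD g := by
    refine ⟨⟨?_, ?_, ?_⟩, ?_, ?_⟩
    · rw [← hgr 1 1 o one_ne_zero]; exact q.one
    · intro a ha
      have hl := Res.lift a
      rw [← hgr _ _ hl (hl.ne ha), ← hgr _ _ (hl.inv ha) (inv_ne_zero (hl.ne ha))]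
      exact q.inv _ (hl.ne ha)
    · intro a b a0 a1 b0 b1
      have ha := Res.lift a
      have hb := Res.lift b
      have a1' : 1 - a ≠ 0 := sub_ne_zero.2 (Ne.symm a1)
      have b1' : 1 - b ≠ 0 := sub_ne_zero.2 (Ne.symm b1)
      have R1 := hb.div ha a0
      have R2 := (hb.mul (o.sub ha)).div (ha.mul (o.sub hb)) (mul_ne_zero a0 b1')
      have R3 := (o.sub ha).div (o.sub hb) b1'
      rw [← hgr _ _ ha (ha.ne a0), ← hgr _ _ hb (hb.ne b0), ← hgr _ _ R1 (R1.ne (by positivity)),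
        ← hgr _ _ R2 (R2.ne (by positivity)), ← hgr _ _ R3 (R3.ne (by positivity))]
      have := q.ft _ _ (ha.ne a0) (ha.ne1 a1) (hb.ne b0) (hb.ne1 b1)
      rw [ha.chip a0, (o.sub ha).chip a1'] at this
      simpa using this
    · intro a
      have g1 : g 1 = 0 := by rw [← hgr 1 1 o one_ne_zero]; exact q.one
      rcases eq_or_ne a 0 with rfl | a0
      · rw [sub_zero, g1, add_zero]
      rcases eq_or_ne a 1 with rfl | a1
      · rw [sub_self, g1, zero_add]
      have a1' : 1 - a ≠ 0 := sub_ne_zero.2 (Ne.symm a1)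
      have ha := Res.lift a
      rw [← hgr _ _ ha (ha.ne a0), ← hgr _ _ (o.sub ha) ((o.sub ha).ne a1'), g0]
      exact q.refl tf k2 (ha.ne a0) (ha.ne1 a1)
    · rw [g0]; exact three
  refine ⟨g, G, fun x hx => ?_⟩
  rcases Res.or (p := p) x with ⟨a, ha⟩ | ⟨h', _⟩
  · rw [lft_res ha, hgr x a ha hx]
  · rw [lft_inf hx h', g0, ← hz _ h' (inv_ne_zero hx), q.inv x hx, neg_neg]

end upper

section coh
variable {n : ℕ} [NeZero n] {A : Type*} [AddCommGroup A]

def carry (u v : ZMod n) : ℕ := if n ≤ u.val + v.val then 1 else 0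

theorem carry_spec (u v : ZMod n) : u.val + v.val = (u + v).val + n * carry u v := by
  unfold carry
  split_ifs with h
  · rw [mul_one, ← ZMod.val_add_val_of_le h]
  · rw [ZMod.val_add_of_lt (by omega)]; ring

theorem carry_cocycle (i j k : ZMod n) :
    carry j k + carry i (j + k) = carry (i + j) k + carry i j := by
  have h1 := carry_spec j k
  have h2 := carry_spec i (j + k)
  have h3 := carry_spec (i + j) k
  have h4 := carry_spec i j
  rw [add_assoc] at h3
  have hn : 0 < n := NeZero.pos n
  have : n * (carry j k + carry i (j + k)) = n * (carry (i + j) k + carry i j) := by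
    grind
  exact Nat.eq_of_mul_eq_mul_left hn this

theorem carry_zero (j : ZMod n) : carry j 0 = 0 := by
  unfold carry; rw [if_neg]; have := ZMod.val_lt j; simp; omega
theorem zero_carry (j : ZMod n) : carry 0 j = 0 := by
  unfold carry; rw [if_neg]; have := ZMod.val_lt j; simp; omega

/-- inhomogeneous 3-cocycles -/
def Coc (F : ZMod n → ZMod n → ZMod n → A) : Prop := ∀ i j k l,
  F j k l - F (i + j) k l + F i (j + k) l - F i j (k + l) + F i j k = 0

def cst (j k l : ZMod n) : ZMod n := (carry j k : ZMod n) * l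

theorem cst_coc : Coc (cst : ZMod n → ZMod n → ZMod n → ZMod n) := by
  intro i j k l
  have := congrArg (Nat.cast : ℕ → ZMod n) (carry_cocycle i j k)
  unfold cst
  push_cast at this
  linear_combination l * this

theorem coh {F : ZMod n → ZMod n → ZMod n → A} (h0 : ∀ k l, F 0 k l = 0) (hF : Coc F) :
    ∃ (N : ZMod n →+ A) (S : ZMod n → ZMod n → A), ∀ j k l,
      F j k l = carry j k • N l + S (j + k) l - S k l - S j (k + l) + S j k := by
  let T : ℕ → ZMod n → A := fun m l => ∑ i ∈ Finset.range m, F 1 i l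
  have T1 : ∀ m k (l : ZMod n), ∑ i ∈ Finset.range m, F 1 (i + (k : ℕ)) l = T (k + m) l - T k l := by
    intro m k l
    simp only [T]
    rw [Finset.sum_range_add, add_sub_cancel_left]
    exact Finset.sum_congr rfl (fun i _ => by push_cast; rw [add_comm])
  have T2 : ∀ m l, T (n + m) l = T n l + T m l := by
    intro m l
    simp only [T]
    rw [Finset.sum_range_add]
    congr 1
    exact Finset.sum_congr rfl (fun i _ => by simp)
  have key : ∀ (m : ℕ) (k : ℕ) (l : ZMod n), F m k l = T (k + m) l - T k l - T m (k + l) + T m k := by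
    intro m k l
    rw [← T1]
    simp only [T]
    rw [← Finset.sum_sub_distrib, ← Finset.sum_add_distrib]
    induction m with
    | zero => simp [h0]
    | succ m ih =>
      rw [Finset.sum_range_succ, ← ih]
      have := hF 1 m k l
      push_cast
      rw [add_comm (1 : ZMod n) m] at this
      linear_combination (norm := module) -this
  have vv : ∀ k : ZMod n, ((k.val : ℕ) : ZMod n) = k := fun k => ZMod.natCast_zmod_val k
  have Nadd : ∀ k l, T n (k + l) = T n k + T n l := by
    intro k l
    have := key n k.val l
    rw [vv, ZMod.natCast_self, h0, add_comm k.val n, T2] at this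
    linear_combination (norm := module) this
  refine ⟨AddMonoidHom.mk' (T n) Nadd, fun j l => T j.val l, ?_⟩
  intro j k l
  have := key j.val k.val l
  rw [vv, vv] at this
  have h1 : T (k.val + j.val) l = carry j k • T n l + T (j + k).val l := by
    rw [add_comm k.val, carry_spec]
    unfold carry
    split_ifs
    · rw [mul_one, add_comm, T2, one_smul]
    · simp
  rw [this, h1]; simp only [AddMonoidHom.mk'_apply]

end coh

section cross
variable {k : Type*} [Field k] {A : Type*} [AddCommGroup A] {g : k → A}

def GG (g : k → A) (r s : k) : A := if s = 0 then - g 0 else g (r / s)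

theorem GG_scale {t : k} (ht : t ≠ 0) (r s : k) : GG g (t * r) (t * s) = GG g r s := by
  unfold GG
  by_cases h : s = 0
  · simp [h]
  · rw [if_neg h, if_neg (mul_ne_zero ht h), mul_div_mul_left _ _ ht]

theorem GG_eq {t r s r' s' : k} (ht : t ≠ 0) (hr : t * r = r') (hs : t * s = s') : GG g r' s' = GG g r s := by
  rw [← hr, ← hs, GG_scale ht]

theorem GG_swap (hg : GD g) {r s : k} (h : r ≠ 0 ∨ s ≠ 0) : GG g s r = - GG g r s := by
  unfold GG
  by_cases hs : s = 0
  · simp_all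
  · by_cases hr : r = 0
    · simp [hs, hr]
    · rw [if_neg hs, if_neg hr, ← hg.qd.inv _ (by positivity), inv_div]

theorem GG_refl (hg : GD g) {r s : k} : GG g (s - r) s + GG g r s = g 0 := by
  unfold GG
  by_cases hs : s = 0
  · rw [if_pos hs, if_pos hs]; linear_combination (norm := module) -hg.three
  · rw [if_neg hs, if_neg hs, sub_div, div_self hs, add_comm]; exact hg.refl _

theorem GG_rot (hg : GD g) {r s : k} (h : r ≠ 0 ∨ s ≠ 0) : GG g (r - s) r = g 0 + GG g r s := by
  have h1 := GG_refl hg (r := s) (s := r)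
  rw [GG_swap hg h] at h1
  linear_combination (norm := module) h1

theorem GG_ft (hg : GD g) {x r s : k} (hx : x ≠ 0) (hx1 : x ≠ 1) (h : r ≠ 0 ∨ s ≠ 0) :
    GG g (x * (s - r)) (r * (1 - x)) - GG g (s - r) (s * (1 - x)) + GG g r (s * x) - GG g r s + g x = 0 := by
  have hx' : 1 - x ≠ 0 := sub_ne_zero.2 hx1.symm
  have g1 : g 1 = 0 := hg.qd.one
  by_cases hs : s = 0
  · subst hs
    have hr : r ≠ 0 := by simpa using h
    have e1 : GG g (x * (0 - r)) (r * (1 - x)) = GG g x (x - 1) := by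
      rw [← GG_scale (t := -r) (by simpa using hr) x]; congr 1 <;> ring
    have e2 : GG g x (x - 1) = - (g 0 + g x) := by
      rw [GG_swap hg (Or.inr hx), GG_rot hg (Or.inl hx)]
      unfold GG; rw [if_neg one_ne_zero, div_one]
    rw [e1, e2]
    unfold GG; simp
  by_cases hr : r = 0
  · subst hr
    have e : GG g (s - 0) (s * (1 - x)) = GG g 1 (1 - x) := by
      rw [← GG_scale hs 1]; congr 1; ring
    rw [e, GG_swap hg (Or.inl hx')]
    unfold GG
    simp [hx, hs]
    linear_combination (norm := module) hg.refl x
  by_cases hrs : r = s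
  · subst hrs
    unfold GG
    simp [hr, hx, hx']
    rw [div_mul_cancel_left₀ hr, hg.qd.inv x hx, g1]; module
  have hd : s - r ≠ 0 := sub_ne_zero.2 (Ne.symm hrs)
  have hy : r / s ≠ 0 := by positivity
  have hy1 : r / s ≠ 1 := by rw [Ne, div_eq_one_iff_eq hs]; exact hrs
  have ft := hg.qd.ft x (r / s) hx hx1 hy hy1
  have e0 : (1 : k) - r / s = (s - r) / s := by field_simp
  have e1 : (1 - x) / (1 - r / s) = (s - r)⁻¹ * (s * (1 - x)) := by rw [e0]; field_simp
  have e2 : r / s * (1 - x) / (x * (1 - r / s)) = r * (1 - x) / (x * (s - r)) := by rw [e0]; field_simp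
  have e3 := hg.qd.inv (x * (s - r) / (r * (1 - x))) (by positivity)
  have e4 := hg.qd.inv ((s - r) / (s * (1 - x))) (by positivity)
  rw [inv_div] at e3 e4
  have e5 : (1 - x) / (1 - r / s) = s * (1 - x) / (s - r) := by rw [e0]; field_simp
  rw [e2, e5, e3, e4] at ft
  unfold GG
  rw [if_neg (by positivity), if_neg (by positivity), if_neg (by positivity), if_neg hs]
  rw [div_div] at ft
  simp only [one_smul, mul_one] at ft
  linear_combination (norm := module) ft

def det2 (w v : k × k) : k := w.1 * v.2 - w.2 * v.1

theorem det2_dep {w v : k × k} (hw : w ≠ 0) (hv : v ≠ 0) (h : det2 w v = 0) : ∃ s : k, s ≠ 0 ∧ v = s • w := by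
  obtain ⟨a, b⟩ := w
  obtain ⟨c, d⟩ := v
  unfold det2 at h
  simp only at h
  have key : ∃ s : k, (c, d) = s • (a, b) := by
    by_cases ha : a = 0
    · have hb : b ≠ 0 := by rintro rfl; exact hw (by simp [ha])
      subst ha
      have hc : c = 0 := by simpa [hb] using h
      exact ⟨d / b, by ext <;> simp [hc, hb]⟩
    · refine ⟨c / a, by ext <;> simp [ha]; field_simp; linear_combination h⟩
  obtain ⟨s, hs⟩ := key
  refine ⟨s, ?_, hs⟩
  rintro rfl
  exact hv (by rw [hs]; simp)

def cW (g : k → A) (w0 w1 w2 w3 : k × k) : A :=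
  if det2 w0 w1 = 0 ∨ det2 w0 w2 = 0 ∨ det2 w1 w2 = 0 then 0
  else GG g (det2 w1 w3 * det2 w0 w2) (det2 w0 w3 * det2 w1 w2)

theorem det2_smul (s t : k) (w v : k × k) : det2 (s • w) (t • v) = s * t * det2 w v := by
  unfold det2; simp; ring

theorem cW_smul {s0 s1 s2 s3 : k} (h0 : s0 ≠ 0) (h1 : s1 ≠ 0) (h2 : s2 ≠ 0) (h3 : s3 ≠ 0) (w0 w1 w2 w3 : k × k) :
    cW g (s0 • w0) (s1 • w1) (s2 • w2) (s3 • w3) = cW g w0 w1 w2 w3 := by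
  unfold cW
  simp only [det2_smul, mul_eq_zero, h0, h1, h2, false_or]
  congr 1
  rw [← GG_scale (t := s0 * s1 * s2 * s3) (by positivity) (det2 w1 w3 * det2 w0 w2)]
  congr 1 <;> ring

theorem cW_smul' {s : k} (h : s ≠ 0) (w0 w1 w2 w3 : k × k) :
    cW g (s • w0) w1 w2 w3 = cW g w0 w1 w2 w3 ∧ cW g w0 (s • w1) w2 w3 = cW g w0 w1 w2 w3 ∧
    cW g w0 w1 (s • w2) w3 = cW g w0 w1 w2 w3 ∧ cW g w0 w1 w2 (s • w3) = cW g w0 w1 w2 w3 := by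
  have o := one_ne_zero (α := k)
  refine ⟨?_, ?_, ?_, ?_⟩
  · simpa using cW_smul (g := g) h o o o w0 w1 w2 w3
  · simpa using cW_smul (g := g) o h o o w0 w1 w2 w3
  · simpa using cW_smul (g := g) o o h o w0 w1 w2 w3
  · simpa using cW_smul (g := g) o o o h w0 w1 w2 w3

theorem det2_self (w : k × k) : det2 w w = 0 := by unfold det2; ring
theorem det2_symm (w v : k × k) : det2 w v = - det2 v w := by unfold det2; ring
theorem plucker (a b c d : k × k) : det2 a b * det2 c d - det2 a c * det2 b d + det2 a d * det2 b c = 0 := by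
  unfold det2; ring

theorem det2_or {a b d : k × k} (h : det2 a b ≠ 0) (hd : d ≠ 0) : det2 a d ≠ 0 ∨ det2 b d ≠ 0 := by
  by_contra! hc
  obtain ⟨h1, h2⟩ := hc
  apply hd
  unfold det2 at *
  have e1 : (a.1 * b.2 - a.2 * b.1) * d.1 = 0 := by linear_combination b.1 * h1 - a.1 * h2
  have e2 : (a.1 * b.2 - a.2 * b.1) * d.2 = 0 := by linear_combination b.2 * h1 - a.2 * h2
  ext
  · simpa [h] using e1
  · simpa [h] using e2

theorem cW_dep01 {a b c d : k × k} (h : det2 a b = 0) : cW g a b c d = 0 := by unfold cW; simp [h]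
theorem cW_dep02 {a b c d : k × k} (h : det2 a c = 0) : cW g a b c d = 0 := by unfold cW; simp [h]
theorem cW_dep12 {a b c d : k × k} (h : det2 b c = 0) : cW g a b c d = 0 := by unfold cW; simp [h]
theorem cW_ind {a b c d : k × k} (h1 : det2 a b ≠ 0) (h2 : det2 a c ≠ 0) (h3 : det2 b c ≠ 0) :
    cW g a b c d = GG g (det2 b d * det2 a c) (det2 a d * det2 b c) := by
  unfold cW; rw [if_neg]; simp [h1, h2, h3]

theorem cW_cocycle (hg : GD g) {w0 w1 w2 w3 w4 : k × k} (h0 : w0 ≠ 0) (h1 : w1 ≠ 0) (h2 : w2 ≠ 0) (h3 : w3 ≠ 0)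
    (h4 : w4 ≠ 0) :
    cW g w1 w2 w3 w4 - cW g w0 w2 w3 w4 + cW g w0 w1 w3 w4 - cW g w0 w1 w2 w4 + cW g w0 w1 w2 w3 = 0 := by
  have nz : ∀ {x y : k}, x ≠ 0 → y ≠ 0 → x * y ≠ 0 := fun h h' => mul_ne_zero h h'
  by_cases d01 : det2 w0 w1 = 0
  · obtain ⟨s, hs, rfl⟩ := det2_dep h0 h1 d01
    rw [(cW_smul' hs w0 w2 w3 w4).1, cW_dep01 d01, cW_dep01 d01, cW_dep01 d01]; abel
  by_cases d12 : det2 w1 w2 = 0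
  · obtain ⟨s, hs, rfl⟩ := det2_dep h1 h2 d12
    rw [(cW_smul' hs w0 w1 w3 w4).2.1, cW_dep01 d12, cW_dep12 d12, cW_dep12 d12]; abel
  by_cases d23 : det2 w2 w3 = 0
  · obtain ⟨s, hs, rfl⟩ := det2_dep h2 h3 d23
    rw [(cW_smul' hs w0 w1 w2 w4).2.2.1, cW_dep12 d23, cW_dep12 d23, (cW_smul' hs w0 w1 w2 w2).2.2.2]
    by_cases d02 : det2 w0 w2 = 0
    · rw [cW_dep02 d02, cW_dep02 d02]; abel
    · rw [cW_ind d01 d02 d12 (d := w2)]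
      unfold GG; rw [if_neg (nz d02 d12), mul_comm, div_self (nz d02 d12), hg.qd.one]; abel
  have s10 : det2 w1 w0 ≠ 0 := by rw [det2_symm]; simpa using d01
  have s21 : det2 w2 w1 ≠ 0 := by rw [det2_symm]; simpa using d12
  by_cases d02 : det2 w0 w2 = 0
  · obtain ⟨s, hs, rfl⟩ := det2_dep h0 h2 d02
    rw [(cW_smul' hs w1 w0 w3 w4).2.1, cW_dep01 d02, cW_dep02 d02, cW_dep02 d02]
    by_cases d13 : det2 w1 w3 = 0
    · rw [cW_dep02 d13, cW_dep12 d13]; abel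
    have d03 : det2 w0 w3 ≠ 0 := by
      intro h; apply d23; have := det2_smul s 1 w0 w3; rw [one_smul] at this; rw [this, h, mul_zero]
    rw [cW_ind s10 d13 d03, cW_ind d01 d03 d13, GG_swap hg]
    · abel
    · rcases det2_or d01 h4 with h | h
      · right; positivity
      · left; positivity
  have s20 : det2 w2 w0 ≠ 0 := by rw [det2_symm]; simpa using d02
  have P := plucker w0 w1 w2 w4
  by_cases d13 : det2 w1 w3 = 0
  · obtain ⟨s, hs, rfl⟩ := det2_dep h1 h3 d13
    rw [(cW_smul' hs w0 w2 w1 w4).2.2.1, cW_dep02 d13, cW_dep12 d13, (cW_smul' hs w0 w1 w2 w1).2.2.2,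
      cW_ind d01 d02 d12, cW_ind d02 d01 s21, cW_ind d01 d02 d12, det2_self]
    have e : GG g (det2 w2 w4 * det2 w0 w1) (det2 w0 w4 * det2 w2 w1) =
        GG g (det2 w0 w4 * det2 w1 w2 - det2 w1 w4 * det2 w0 w2) (det2 w0 w4 * det2 w1 w2) := by
      apply GG_eq (t := -1) (by simp)
      · linear_combination -P
      · rw [det2_symm w2 w1]; ring
    rw [e]
    have := GG_refl hg (r := det2 w1 w4 * det2 w0 w2) (s := det2 w0 w4 * det2 w1 w2)
    have e2 : GG g (0 * det2 w0 w2) (det2 w0 w1 * det2 w1 w2) = g 0 := by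
      unfold GG; rw [if_neg (nz d01 d12)]; simp
    rw [e2]; linear_combination (norm := module) -this
  by_cases d03 : det2 w0 w3 = 0
  · obtain ⟨s, hs, rfl⟩ := det2_dep h0 h3 d03
    rw [(cW_smul' hs w1 w2 w0 w4).2.2.1, cW_dep02 d03, cW_dep02 d03, (cW_smul' hs w0 w1 w2 w0).2.2.2,
      cW_ind d12 s10 s20, cW_ind d01 d02 d12, cW_ind d01 d02 d12]
    have e : GG g (det2 w2 w4 * det2 w1 w0) (det2 w1 w4 * det2 w2 w0) =
        GG g (det2 w1 w4 * det2 w0 w2 - det2 w0 w4 * det2 w1 w2) (det2 w1 w4 * det2 w0 w2) := by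
      apply GG_eq (t := -1) (by simp)
      · rw [det2_symm w1 w0]; linear_combination P
      · rw [det2_symm w2 w0]; ring
    rw [e, GG_rot hg]
    · have e2 : GG g (det2 w1 w0 * det2 w0 w2) (det2 w0 w0 * det2 w1 w2) = - g 0 := by
        unfold GG; rw [det2_self]; simp
      rw [e2]; module
    · rcases det2_or d01 h4 with h | h
      · right; positivity
      · left; positivity
  have P2 := plucker w0 w1 w2 w3
  rw [cW_ind d12 d13 d23, cW_ind d02 d03 d23, cW_ind d01 d03 d13, cW_ind d01 d02 d12, cW_ind d01 d02 d12]
  set x := det2 w1 w3 * det2 w0 w2 / (det2 w0 w3 * det2 w1 w2) with hx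
  have hx0 : x ≠ 0 := by positivity
  have hx1 : 1 - x = - (det2 w0 w1 * det2 w2 w3) / (det2 w0 w3 * det2 w1 w2) := by
    grind
  have hx1' : x ≠ 1 := by
    grind
  have ft := GG_ft hg hx0 hx1' (r := det2 w1 w4 * det2 w0 w2) (s := det2 w0 w4 * det2 w1 w2) (by
    rcases det2_or d01 h4 with h | h
    · right; positivity
    · left; positivity)
  have hsr : det2 w0 w4 * det2 w1 w2 - det2 w1 w4 * det2 w0 w2 = - (det2 w0 w1 * det2 w2 w4) := by
    linear_combination P
  rw [hx1, hsr] at ft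
  have G5 : GG g (det2 w1 w3 * det2 w0 w2) (det2 w0 w3 * det2 w1 w2) = g x := by
    unfold GG; rw [if_neg (nz d03 d12)]
  have E1 : GG g (x * -(det2 w0 w1 * det2 w2 w4))
      (det2 w1 w4 * det2 w0 w2 * (- (det2 w0 w1 * det2 w2 w3) / (det2 w0 w3 * det2 w1 w2))) =
      GG g (det2 w2 w4 * det2 w1 w3) (det2 w1 w4 * det2 w2 w3) := by
    apply GG_eq (t := -(det2 w0 w2 * det2 w0 w1) / (det2 w0 w3 * det2 w1 w2))
    · exact div_ne_zero (neg_ne_zero.2 (nz d02 d01)) (nz d03 d12)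
    · rw [hx]; ring
    · ring
  have E2 : GG g (-(det2 w0 w1 * det2 w2 w4))
      (det2 w0 w4 * det2 w1 w2 * (- (det2 w0 w1 * det2 w2 w3) / (det2 w0 w3 * det2 w1 w2))) =
      GG g (det2 w2 w4 * det2 w0 w3) (det2 w0 w4 * det2 w2 w3) := by
    apply GG_eq (t := -(det2 w0 w1) / (det2 w0 w3))
    · exact div_ne_zero (neg_ne_zero.2 d01) d03
    · field_simp
    · field_simp
  have E3 : GG g (det2 w1 w4 * det2 w0 w2) (det2 w0 w4 * det2 w1 w2 * x) =
      GG g (det2 w1 w4 * det2 w0 w3) (det2 w0 w4 * det2 w1 w3) := by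
    apply GG_eq (t := det2 w0 w2 / det2 w0 w3)
    · positivity
    · field_simp
    · rw [hx]; field_simp
  rw [E1, E2, E3] at ft
  rw [G5]; exact ft

end cross

section logd
variable (p : ℕ) [Fact p.Prime] (K : Type) [Field K] [Algebra (ZMod p) K]

structure LD (L : K → ZMod (p + 1)) (τ : K) : Prop where
  t0 : τ ≠ 0
  mul : ∀ u v, u ≠ 0 → v ≠ 0 → L (u * v) = L u + L v
  pow : ∀ m : ℕ, L (τ ^ m) = m
  base : ∀ a : ZMod p, a ≠ 0 → L (algebraMap (ZMod p) K a) = 0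
  eq : ∀ u v, u ≠ 0 → v ≠ 0 → L u = L v → ∃ a : ZMod p, a ≠ 0 ∧ u = algebraMap (ZMod p) K a * v
  gen : ∀ u, u ≠ 0 → ∃ m : ℕ, u = τ ^ m
  ord : ∀ m m' : ℕ, τ ^ m = τ ^ m' ↔ m ≡ m' [MOD (p + 1) * (p - 1)]
  fix : ∀ x : K, x ^ p = x → ∃ a : ZMod p, algebraMap (ZMod p) K a = x

theorem fix_aux (x : K) (hx : x ^ p = x) : ∃ a : ZMod p, algebraMap (ZMod p) K a = x := by
  have hp := (Fact.out : p.Prime)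
  have inj : Function.Injective (algebraMap (ZMod p) K) := (algebraMap (ZMod p) K).injective
  let P : Polynomial K := Polynomial.X ^ p - Polynomial.X
  have hP : P ≠ 0 := FiniteField.X_pow_card_sub_X_ne_zero K hp.one_lt
  have hd : P.natDegree = p := FiniteField.X_pow_card_sub_X_natDegree_eq K hp.one_lt
  let S : Finset K := Finset.univ.image (algebraMap (ZMod p) K)
  have hS : S ⊆ P.roots.toFinset := by
    intro y hy
    obtain ⟨a, _, rfl⟩ := Finset.mem_image.1 hy
    rw [Multiset.mem_toFinset, Polynomial.mem_roots hP, Polynomial.IsRoot.def]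
    simp [P, ← map_pow]
  have hc : S.card = p := by
    rw [Finset.card_image_of_injective _ inj, Finset.card_univ, ZMod.card]
  have : S = P.roots.toFinset := by
    apply Finset.eq_of_subset_of_card_le hS
    rw [hc, ← hd]
    exact (Multiset.toFinset_card_le _).trans (Polynomial.card_roots' _)
  have hx' : x ∈ P.roots.toFinset := by
    rw [Multiset.mem_toFinset, Polynomial.mem_roots hP, Polynomial.IsRoot.def]
    simp [P, hx]
  rw [← this] at hx'
  obtain ⟨a, _, h⟩ := Finset.mem_image.1 hx'
  exact ⟨a, h⟩

theorem LD_exists [Fintype K] (hc : Fintype.card K = p ^ 2) : ∃ L τ, LD p K L τ := by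
  have hp := (Fact.out : p.Prime)
  have hN : (p + 1) * (p - 1) = p ^ 2 - 1 := by
    have := Nat.sq_sub_sq p 1
    rw [one_pow] at this; exact this.symm
  obtain ⟨t, ht⟩ := IsCyclic.exists_generator (α := Kˣ)
  have ho : orderOf t = (p + 1) * (p - 1) := by
    rw [orderOf_eq_card_of_forall_mem_zpowers ht, Nat.card_eq_fintype_card, Fintype.card_units, hc, hN]
  have ord : ∀ m m' : ℕ, (t : K) ^ m = (t : K) ^ m' ↔ m ≡ m' [MOD (p + 1) * (p - 1)] := by
    intro m m'
    rw [← ho, ← pow_eq_pow_iff_modEq, Units.ext_iff]; simp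
  have gen : ∀ u : K, u ≠ 0 → ∃ m : ℕ, u = (t : K) ^ m := by
    intro u hu
    have := ht (Units.mk0 u hu)
    rw [← mem_powers_iff_mem_zpowers] at this
    obtain ⟨m, hm⟩ := this
    exact ⟨m, by have := congrArg Units.val hm; simpa using this.symm⟩
  choose! l hl using gen
  let L : K → ZMod (p + 1) := fun u => (l u : ZMod (p + 1))
  have pow : ∀ m : ℕ, L ((t : K) ^ m) = m := by
    intro m
    have h1 := hl ((t : K) ^ m) (pow_ne_zero _ t.ne_zero)
    rw [ord] at h1
    exact ((ZMod.natCast_eq_natCast_iff _ _ _).2 (h1.of_mul_right _)).symm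
  have gen : ∀ u : K, u ≠ 0 → ∃ m : ℕ, u = (t : K) ^ m := fun u hu => ⟨_, hl u hu⟩
  have mul : ∀ u v : K, u ≠ 0 → v ≠ 0 → L (u * v) = L u + L v := by
    intro u v hu hv
    obtain ⟨a, rfl⟩ := gen u hu
    obtain ⟨b, rfl⟩ := gen v hv
    rw [← pow_add, pow, pow, pow]; push_cast; rfl
  have hp1 : 0 < p - 1 := by have := hp.one_lt; omega
  refine ⟨L, t, t.ne_zero, mul, pow, ?_, ?_, gen, ord, fix_aux p K⟩
  · intro a ha
    obtain ⟨m, hm⟩ := gen (algebraMap (ZMod p) K a) (by simpa using ha)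
    rw [hm, pow]
    have h1 : (t : K) ^ (m * (p - 1)) = (t : K) ^ 0 := by
      rw [pow_mul, ← hm, ← map_pow, ZMod.pow_card_sub_one_eq_one ha]; simp
    rw [ord, Nat.modEq_zero_iff_dvd] at h1
    exact (ZMod.natCast_eq_zero_iff _ _).2 (Nat.dvd_of_mul_dvd_mul_right hp1 h1)
  · intro u v hu hv h
    have hw : u / v ≠ 0 := div_ne_zero hu hv
    have hL : L (u / v) = 0 := by
      have := mul (u / v) v hw hv
      rw [div_mul_cancel₀ _ hv, h] at this; simpa using this
    obtain ⟨m, hm⟩ := gen _ hw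
    rw [hm, pow, ZMod.natCast_eq_zero_iff] at hL
    have h1 : (u / v) ^ p = u / v := by
      have h2 : (u / v) ^ (p - 1) = 1 := by
        rw [hm, ← pow_mul]
        have : (t : K) ^ (m * (p - 1)) = (t : K) ^ 0 := by
          rw [ord, Nat.modEq_zero_iff_dvd]; exact Nat.mul_dvd_mul_right hL _
        rw [this, pow_zero]
      calc (u / v) ^ p = (u / v) ^ (p - 1 + 1) := by congr 1; omega
        _ = u / v := by rw [pow_succ, h2, one_mul]
    obtain ⟨a, ha⟩ := fix_aux p K _ h1
    refine ⟨a, ?_, ?_⟩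
    · rintro rfl; rw [map_zero] at ha; exact hw ha.symm
    · rw [ha, div_mul_cancel₀ _ hv]

end logd

section evs
variable {p : ℕ} [Fact p.Prime] {K : Type} [Field K] [Algebra (ZMod p) K]

def ev (θ : K) (w : ZMod p × ZMod p) : K := algebraMap (ZMod p) K w.1 - algebraMap (ZMod p) K w.2 * θ

def bra (p : ℕ) (u v : K) : K := u * v ^ p - u ^ p * v

variable (p K) in
def NF (θ : K) : Prop := ∀ a : ZMod p, algebraMap (ZMod p) K a ≠ θ

theorem ev_pow (θ : K) (w : ZMod p × ZMod p) : (ev θ w) ^ p = ev (θ ^ p) w := by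
  have : CharP K p := charP_of_injective_algebraMap (algebraMap (ZMod p) K).injective p
  unfold ev
  rw [sub_pow_char, mul_pow, ← map_pow, ← map_pow, ZMod.pow_card, ZMod.pow_card]

theorem bra_ev (θ : K) (w v : ZMod p × ZMod p) :
    bra p (ev θ w) (ev θ v) = algebraMap (ZMod p) K (det2 w v) * (θ - θ ^ p) := by
  unfold bra; rw [ev_pow, ev_pow]; unfold ev det2; simp only [map_sub, map_mul]; ring

theorem ev_eq_zero {θ : K} (h : NF p K θ) {w : ZMod p × ZMod p} (hw : ev θ w = 0) : w = 0 := by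
  unfold ev at hw
  have h2 : w.2 = 0 := by
    by_contra h2
    apply h (w.1 / w.2)
    have : algebraMap (ZMod p) K w.2 ≠ 0 := by simpa using h2
    rw [map_div₀]; field_simp; linear_combination hw
  rw [h2] at hw
  have h1 : w.1 = 0 := by simpa using hw
  exact Prod.ext h1 h2

theorem ev_surj {θ : K} [Fintype K] (hc : Fintype.card K = p ^ 2) (h : NF p K θ) (u : K) :
    ∃ w : ZMod p × ZMod p, ev θ w = u := by
  have hi : Function.Injective (ev θ : ZMod p × ZMod p → K) := by
    intro w v e
    have : ev θ (w - v) = 0 := by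
      unfold ev at *; simp only [Prod.fst_sub, Prod.snd_sub, map_sub]; linear_combination e
    exact sub_eq_zero.1 (ev_eq_zero h this)
  have : Function.Bijective (ev θ : ZMod p × ZMod p → K) :=
    (Fintype.bijective_iff_injective_and_card _).2 ⟨hi, by rw [hc, Fintype.card_prod, ZMod.card]; ring⟩
  exact this.2 u

variable {A : Type*} [AddCommGroup A] (g : ZMod p → A)

def gt (x : K) : A := g (Function.invFun (algebraMap (ZMod p) K) x)

theorem gt_map (a : ZMod p) : gt g (algebraMap (ZMod p) K a) = g a := by
  unfold gt; rw [Function.leftInverse_invFun (algebraMap (ZMod p) K).injective]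

def cK (u0 u1 u2 u3 : K) : A :=
  if bra p u0 u1 = 0 ∨ bra p u0 u2 = 0 ∨ bra p u1 u2 = 0 then 0
  else if bra p u0 u3 * bra p u1 u2 = 0 then - g 0
  else gt g (bra p u1 u3 * bra p u0 u2 / (bra p u0 u3 * bra p u1 u2))

variable {g}
theorem cK_congr {u0 u1 u2 u3 v0 v1 v2 v3 : K} {s0 s1 s2 s3 κ : K} (h0 : s0 ≠ 0) (h1 : s1 ≠ 0)
    (h2 : s2 ≠ 0) (h3 : s3 ≠ 0) (hκ : κ ≠ 0)
    (e01 : bra p v0 v1 = s0 * s1 * κ * bra p u0 u1)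
    (e02 : bra p v0 v2 = s0 * s2 * κ * bra p u0 u2)
    (e12 : bra p v1 v2 = s1 * s2 * κ * bra p u1 u2)
    (e03 : bra p v0 v3 = s0 * s3 * κ * bra p u0 u3)
    (e13 : bra p v1 v3 = s1 * s3 * κ * bra p u1 u3) :
    cK g v0 v1 v2 v3 = cK g u0 u1 u2 u3 := by
  unfold cK
  rw [e01, e02, e12, e03, e13]
  simp only [mul_eq_zero, h0, h1, h2, h3, hκ, false_or]
  split_ifs with c1 c2
  · rfl
  · rfl
  · grind

theorem cK_ev {θ : K} (hθ : θ - θ ^ p ≠ 0) (w0 w1 w2 w3 : ZMod p × ZMod p) :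
    cK g (ev θ w0) (ev θ w1) (ev θ w2) (ev θ w3) = cW g w0 w1 w2 w3 := by
  unfold cK cW GG
  simp only [bra_ev, mul_eq_zero, hθ, or_false, FaithfulSMul.algebraMap_eq_zero_iff]
  split_ifs with c1 c2
  · rfl
  · rfl
  · rw [← gt_map (K := K) g]
    congr 1
    rw [map_div₀, map_mul, map_mul]
    rw [show ∀ a b c : K, a * c * (b * c) = c ^ 2 * (a * b) by intros; ring,
      show ∀ a b c : K, a * c * (b * c) = c ^ 2 * (a * b) by intros; ring,
      mul_div_mul_left _ _ (by positivity)]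

theorem bra_smul (a b : ZMod p) (u v : K) :
    bra p (algebraMap (ZMod p) K a * u) (algebraMap (ZMod p) K b * v) =
      algebraMap (ZMod p) K a * algebraMap (ZMod p) K b * bra p u v := by
  unfold bra
  rw [mul_pow, mul_pow, ← map_pow, ← map_pow, ZMod.pow_card, ZMod.pow_card]; ring

variable {L : K → ZMod (p + 1)} {τ : K}

namespace LD
variable (h : LD p K L τ)
include h

theorem nf_pow {θ : K} (hθ : NF p K θ) : θ - θ ^ p ≠ 0 := by
  intro e
  obtain ⟨a, ha⟩ := h.fix θ (sub_eq_zero.1 e).symm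
  exact hθ a ha

/-- `c` on exponents -/
theorem cK_L {u0 u1 u2 u3 : K} (h0 : u0 ≠ 0) (h1 : u1 ≠ 0) (h2 : u2 ≠ 0) (h3 : u3 ≠ 0) :
    cK g (τ ^ (L u0).val) (τ ^ (L u1).val) (τ ^ (L u2).val) (τ ^ (L u3).val) = cK g u0 u1 u2 u3 := by
  have key : ∀ u, u ≠ 0 → ∃ a : ZMod p, a ≠ 0 ∧ τ ^ (L u).val = algebraMap (ZMod p) K a * u := by
    intro u hu
    exact h.eq _ _ (pow_ne_zero _ h.t0) hu (by rw [h.pow, ZMod.natCast_zmod_val])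
  obtain ⟨a0, n0, e0⟩ := key u0 h0
  obtain ⟨a1, n1, e1⟩ := key u1 h1
  obtain ⟨a2, n2, e2⟩ := key u2 h2
  obtain ⟨a3, n3, e3⟩ := key u3 h3
  rw [e0, e1, e2, e3]
  have inj : ∀ {a : ZMod p}, a ≠ 0 → algebraMap (ZMod p) K a ≠ 0 := fun h => by simpa using h
  apply cK_congr (inj n0) (inj n1) (inj n2) (inj n3) one_ne_zero <;> rw [bra_smul] <;> ring

theorem cK_mul {u0 u1 u2 u3 κ : K} (hκ : κ ≠ 0) :
    cK g (κ * u0) (κ * u1) (κ * u2) (κ * u3) = cK g u0 u1 u2 u3 := by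
  have hb : ∀ u v, bra p (κ * u) (κ * v) = 1 * 1 * κ ^ (p + 1) * bra p u v := by
    intro u v; unfold bra; ring
  apply cK_congr one_ne_zero one_ne_zero one_ne_zero one_ne_zero (pow_ne_zero (p + 1) hκ) <;> exact hb _ _

def cn (_ : LD p K L τ) (g : ZMod p → A) (t0 t1 t2 t3 : ZMod (p + 1)) : A :=
  cK g (τ ^ t0.val) (τ ^ t1.val) (τ ^ t2.val) (τ ^ t3.val)

theorem cn_add (t0 t1 t2 t3 s : ZMod (p + 1)) :
    h.cn g (t0 + s) (t1 + s) (t2 + s) (t3 + s) = h.cn g t0 t1 t2 t3 := by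
  have hs := pow_ne_zero s.val h.t0
  have hm : ∀ t : ZMod (p + 1), τ ^ s.val * τ ^ t.val ≠ 0 := fun t => mul_ne_zero hs (pow_ne_zero _ h.t0)
  have e : ∀ t : ZMod (p + 1), t + s = L (τ ^ s.val * τ ^ t.val) := by
    intro t
    rw [h.mul _ _ hs (pow_ne_zero _ h.t0), h.pow, h.pow, ZMod.natCast_zmod_val, ZMod.natCast_zmod_val,
      add_comm t s]
  unfold cn
  rw [e, e, e, e, h.cK_L (hm _) (hm _) (hm _) (hm _), h.cK_mul hs]

theorem cW_cn {θ : K} (hθ : NF p K θ) {w0 w1 w2 w3 : ZMod p × ZMod p} (h0 : w0 ≠ 0) (h1 : w1 ≠ 0)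
    (h2 : w2 ≠ 0) (h3 : w3 ≠ 0) :
    cW g w0 w1 w2 w3 = h.cn g (L (ev θ w0)) (L (ev θ w1)) (L (ev θ w2)) (L (ev θ w3)) := by
  have nz : ∀ {w : ZMod p × ZMod p}, w ≠ 0 → ev θ w ≠ 0 := fun hw e => hw (ev_eq_zero hθ e)
  unfold cn
  rw [h.cK_L (nz h0) (nz h1) (nz h2) (nz h3), cK_ev (h.nf_pow hθ)]

theorem exists_nf [Fintype K] (hc : Fintype.card K = p ^ 2) : ∃ θ : K, NF p K θ := by
  by_contra! hcon
  unfold NF at hcon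
  push Not at hcon
  have : Fintype.card K ≤ Fintype.card (ZMod p) := Fintype.card_le_of_surjective _ hcon
  rw [hc, ZMod.card] at this
  have := (Fact.out : p.Prime).one_lt
  nlinarith

theorem cn_coc [Fintype K] (hc : Fintype.card K = p ^ 2) (hg : GD g) :
    Coc (fun i j k => h.cn g 0 i (i + j) (i + j + k)) := by
  obtain ⟨θ, hθ⟩ := h.exists_nf hc
  have co : ∀ t : ZMod (p + 1), ∃ w : ZMod p × ZMod p, w ≠ 0 ∧ t = L (ev θ w) := by
    intro t
    obtain ⟨w, hw⟩ := ev_surj hc hθ (τ ^ t.val)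
    refine ⟨w, ?_, by rw [hw, h.pow, ZMod.natCast_zmod_val]⟩
    rintro rfl
    simp [ev] at hw
    exact pow_ne_zero _ h.t0 hw.symm
  have C : ∀ t0 t1 t2 t3 t4, h.cn g t1 t2 t3 t4 - h.cn g t0 t2 t3 t4 + h.cn g t0 t1 t3 t4 - h.cn g t0 t1 t2 t4
      + h.cn g t0 t1 t2 t3 = 0 := by
    intro t0 t1 t2 t3 t4
    obtain ⟨w0, n0, e0⟩ := co t0
    obtain ⟨w1, n1, e1⟩ := co t1
    obtain ⟨w2, n2, e2⟩ := co t2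
    obtain ⟨w3, n3, e3⟩ := co t3
    obtain ⟨w4, n4, e4⟩ := co t4
    rw [e0, e1, e2, e3, e4, ← h.cW_cn hθ n1 n2 n3 n4, ← h.cW_cn hθ n0 n2 n3 n4, ← h.cW_cn hθ n0 n1 n3 n4,
      ← h.cW_cn hθ n0 n1 n2 n4, ← h.cW_cn hθ n0 n1 n2 n3]
    exact cW_cocycle hg n0 n1 n2 n3 n4
  intro i j k l
  have := C 0 i (i + j) (i + j + k) (i + j + k + l)
  have e := h.cn_add (g := g) 0 j (j + k) (j + k + l) i
  rw [zero_add, add_comm j i, show j + k + i = i + j + k by ring, show j + k + l + i = i + j + k + l by ring] at e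
  rw [e] at this
  simp only [← add_assoc] at this ⊢
  exact this

theorem cn_F (t0 t1 t2 t3 : ZMod (p + 1)) :
    h.cn g t0 t1 t2 t3 = h.cn g 0 (t1 - t0) (t1 - t0 + (t2 - t1)) (t1 - t0 + (t2 - t1) + (t3 - t2)) := by
  rw [← h.cn_add 0 (t1 - t0) _ _ t0]
  congr 1 <;> ring

end LD
end evs

section sums
variable {p : ℕ} [Fact p.Prime] {K : Type} [Field K] [Algebra (ZMod p) K] [Fintype K]

variable (p K) in
def TT : Finset K := Finset.univ.filter (NF p K)

theorem mem_TT {θ : K} : θ ∈ TT p K ↔ NF p K θ := by simp [TT]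

def mv (a b c d : ZMod p) (w : ZMod p × ZMod p) : ZMod p × ZMod p := (a * w.1 + b * w.2, c * w.1 + d * w.2)

def mob (a b c d : ZMod p) (θ : K) : K :=
  (algebraMap (ZMod p) K d * θ - algebraMap (ZMod p) K b) / (algebraMap (ZMod p) K a - algebraMap (ZMod p) K c * θ)

variable {a b c d : ZMod p}

theorem mob_den (hd : a * d - b * c ≠ 0) {θ : K} (hθ : NF p K θ) :
    algebraMap (ZMod p) K a - algebraMap (ZMod p) K c * θ ≠ 0 := by
  intro h
  have := ev_eq_zero hθ (w := (a, c)) h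
  simp only [Prod.mk_eq_zero] at this
  apply hd; rw [this.1, this.2]; ring

theorem ev_mv (hd : a * d - b * c ≠ 0) {θ : K} (hθ : NF p K θ) (w : ZMod p × ZMod p) :
    ev θ (mv a b c d w) = (algebraMap (ZMod p) K a - algebraMap (ZMod p) K c * θ) * ev (mob a b c d θ) w := by
  have := mob_den hd hθ
  unfold ev mv mob
  simp only [map_add, map_mul]
  field_simp
  ring

theorem mob_NF (hd : a * d - b * c ≠ 0) {θ : K} (hθ : NF p K θ) : NF p K (mob a b c d θ) := by
  intro e he
  have hden := mob_den hd hθ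
  unfold mob at he
  rw [eq_div_iff hden] at he
  have := ev_eq_zero hθ (w := (e * a + b, e * c + d)) (by
    unfold ev; simp only [map_add, map_mul]; linear_combination he)
  simp only [Prod.mk_eq_zero] at this
  apply hd
  linear_combination a * this.2 - c * this.1

theorem mob_inj (hd : a * d - b * c ≠ 0) {θ φ : K} (hθ : NF p K θ) (hφ : NF p K φ)
    (h : mob a b c d θ = mob a b c d φ) : θ = φ := by
  have h1 := mob_den hd hθ
  have h2 := mob_den hd hφ
  unfold mob at h
  rw [div_eq_div_iff h1 h2] at h
  have h3 : algebraMap (ZMod p) K (a * d - b * c) ≠ 0 := by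
    rw [Ne, map_eq_zero]; exact hd
  apply sub_eq_zero.1
  apply (mul_eq_zero.1 (_ : algebraMap (ZMod p) K (a * d - b * c) * (θ - φ) = 0)).resolve_left h3
  simp only [map_sub, map_mul]
  linear_combination h

theorem sum_mob {B : Type*} [AddCommGroup B] (hd : a * d - b * c ≠ 0) (f : K → B) :
    ∑ θ ∈ TT p K, f (mob a b c d θ) = ∑ θ ∈ TT p K, f θ := by
  have hm : Set.MapsTo (mob a b c d) (TT p K : Set K) (TT p K : Set K) := by
    intro θ hθ
    simp only [Finset.mem_coe, mem_TT] at hθ ⊢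
    exact mob_NF hd hθ
  have hi : Set.InjOn (mob a b c d) (TT p K : Set K) := by
    intro θ hθ φ hφ h
    simp only [Finset.mem_coe, mem_TT] at hθ hφ
    exact mob_inj hd hθ hφ h
  exact Finset.sum_nbij (mob a b c d) hm hi (Finset.surjOn_of_injOn_of_card_le _ hm hi le_rfl) (fun _ _ => rfl)

variable {L : K → ZMod (p + 1)} {τ : K} {A : Type*} [AddCommGroup A]
  {Φ : ZMod (p + 1) → ZMod (p + 1) → ZMod (p + 1) → ZMod (p + 1) → A}

def sm (L : K → ZMod (p + 1)) (Φ : ZMod (p + 1) → ZMod (p + 1) → ZMod (p + 1) → ZMod (p + 1) → A)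
    (w0 w1 w2 w3 : ZMod p × ZMod p) : A :=
  ∑ θ ∈ TT p K, Φ (L (ev θ w0)) (L (ev θ w1)) (L (ev θ w2)) (L (ev θ w3))

def TI (Φ : ZMod (p + 1) → ZMod (p + 1) → ZMod (p + 1) → ZMod (p + 1) → A) : Prop :=
  ∀ s t0 t1 t2 t3, Φ (s + t0) (s + t1) (s + t2) (s + t3) = Φ t0 t1 t2 t3

namespace LD
variable (h : LD p K L τ)
include h

omit [Fintype K] in
theorem ev_ne {θ : K} (hθ : NF p K θ) {w : ZMod p × ZMod p} (hw : w ≠ 0) : ev θ w ≠ 0 :=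
  fun e => hw (ev_eq_zero hθ e)

omit [Fintype K] in
theorem L_smul {θ : K} (hθ : NF p K θ) {w : ZMod p × ZMod p} (hw : w ≠ 0) {s : ZMod p} (hs : s ≠ 0) :
    L (ev θ (s • w)) = L (ev θ w) := by
  have : ev θ (s • w) = algebraMap (ZMod p) K s * ev θ w := by
    unfold ev; simp; ring
  rw [this, h.mul _ _ (by simpa using hs) (h.ev_ne hθ hw), h.base s hs, zero_add]

theorem sm_mv (hΦ : TI Φ) (hd : a * d - b * c ≠ 0) {w0 w1 w2 w3 : ZMod p × ZMod p}
    (h0 : w0 ≠ 0) (h1 : w1 ≠ 0) (h2 : w2 ≠ 0) (h3 : w3 ≠ 0) :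
    sm L Φ (mv a b c d w0) (mv a b c d w1) (mv a b c d w2) (mv a b c d w3) = sm L Φ w0 w1 w2 w3 := by
  unfold sm
  rw [← sum_mob hd (fun θ => Φ (L (ev θ w0)) (L (ev θ w1)) (L (ev θ w2)) (L (ev θ w3)))]
  apply Finset.sum_congr rfl
  intro θ hθ
  rw [mem_TT] at hθ
  have hn := mob_NF hd hθ
  have e : ∀ {w : ZMod p × ZMod p}, w ≠ 0 → L (ev θ (mv a b c d w)) =
      L (algebraMap (ZMod p) K a - algebraMap (ZMod p) K c * θ) + L (ev (mob a b c d θ) w) := by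
    intro w hw
    rw [ev_mv hd hθ, h.mul _ _ (mob_den hd hθ) (h.ev_ne hn hw)]
  rw [e h0, e h1, e h2, e h3, hΦ]

theorem sm_smul {w0 w1 w2 w3 : ZMod p × ZMod p} (h0 : w0 ≠ 0) (h1 : w1 ≠ 0) (h2 : w2 ≠ 0) (h3 : w3 ≠ 0)
    {s0 s1 s2 s3 : ZMod p} (k0 : s0 ≠ 0) (k1 : s1 ≠ 0) (k2 : s2 ≠ 0) (k3 : s3 ≠ 0) :
    sm L Φ (s0 • w0) (s1 • w1) (s2 • w2) (s3 • w3) = sm L Φ w0 w1 w2 w3 := by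
  unfold sm
  apply Finset.sum_congr rfl
  intro θ hθ
  rw [mem_TT] at hθ
  rw [h.L_smul hθ h0 k0, h.L_smul hθ h1 k1, h.L_smul hθ h2 k2, h.L_smul hθ h3 k3]

omit h [Fintype K] [Field K] [Algebra (ZMod p) K] in
theorem ne_of_det {w v : ZMod p × ZMod p} (hh : det2 w v ≠ 0) : w ≠ 0 ∧ v ≠ 0 := by
  constructor
  · rintro rfl; apply hh; simp [det2]
  · rintro rfl; apply hh; simp [det2]

theorem sm_normal (hΦ : TI Φ) {w0 w1 w2 w3 : ZMod p × ZMod p} (h01 : det2 w0 w1 ≠ 0) (h02 : det2 w0 w2 ≠ 0)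
    (h12 : det2 w1 w2 ≠ 0) (h03 : det2 w0 w3 ≠ 0) :
    sm L Φ w0 w1 w2 w3 = sm L Φ (1, 0) (0, 1) (1, 1) (det2 w1 w3 * det2 w0 w2 / (det2 w0 w3 * det2 w1 w2), 1) := by
  have o : (1 : ZMod p) ≠ 0 := one_ne_zero
  have h21 : det2 w2 w1 ≠ 0 := by rw [det2_symm]; exact neg_ne_zero.2 h12
  have hD : det2 w2 w1 * w0.1 * (det2 w0 w2 * w1.2) - det2 w0 w2 * w1.1 * (det2 w2 w1 * w0.2) ≠ 0 := by
    have : det2 w2 w1 * w0.1 * (det2 w0 w2 * w1.2) - det2 w0 w2 * w1.1 * (det2 w2 w1 * w0.2) =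
      det2 w2 w1 * det2 w0 w2 * det2 w0 w1 := by unfold det2; ring
    rw [this]; positivity
  rw [← h.sm_mv hΦ hD (w0 := (1, 0)) (w1 := (0, 1)) (w2 := (1, 1)) (w3 := (_, 1)) (by simp) (by simp) (by simp) (by simp),
    ← h.sm_smul (ne_of_det h01).1 (ne_of_det h01).2 (ne_of_det h02).2 (ne_of_det h03).2 h21 h02 h01
      (s3 := det2 w0 w2 * det2 w0 w1 / det2 w0 w3) (by positivity)]
  congr 1
  · ext <;> simp [mv]
  · ext <;> simp [mv]
  · ext <;> simp [mv, det2] <;> ring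
  · ext <;> simp only [mv, Prod.smul_fst, Prod.smul_snd, smul_eq_mul] <;> field_simp <;> unfold det2 <;> ring

theorem tri_const {β : ZMod (p + 1) → ZMod (p + 1) → A} {w0 w1 w2 : ZMod p × ZMod p} (h01 : det2 w0 w1 ≠ 0)
    (h02 : det2 w0 w2 ≠ 0) (h12 : det2 w1 w2 ≠ 0) :
    ∑ θ ∈ TT p K, β (L (ev θ w1) - L (ev θ w0)) (L (ev θ w2) - L (ev θ w1)) =
    ∑ θ ∈ TT p K, β (L (ev (p := p) θ (0, 1)) - L (ev (p := p) θ (1, 0))) (L (ev (p := p) θ (1, 1)) - L (ev (p := p) θ (0, 1))) := by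
  have hΦ : TI (fun t0 t1 t2 _ : ZMod (p + 1) => β (t1 - t0) (t2 - t1)) := by
    intro s t0 t1 t2 t3; simp
  exact h.sm_normal hΦ h01 h02 h12 (w3 := w1) h01

end LD

def PC (t0 t1 t2 t3 : ZMod (p + 1)) : ZMod (p + 1) := cst (t1 - t0) (t2 - t1) (t3 - t2)
omit [Fact p.Prime] in
theorem PC_TI : TI (PC (p := p)) := by
  intro s t0 t1 t2 t3; unfold PC; simp

def DD (L : K → ZMod (p + 1)) (x : ZMod p) : ZMod (p + 1) := sm L PC (1, 0) (0, 1) (1, 1) (x, 1)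

theorem LD.main (h : LD p K L τ) (hc : Fintype.card K = p ^ 2) {g : ZMod p → A} (hg : GD g) :
    ∃ N : ZMod (p + 1) →+ A, ∀ x, x ≠ 0 → x ≠ 1 → (TT p K).card • g x = N (DD L x) := by
  obtain ⟨N, S, hN⟩ := coh (F := fun i j k => h.cn g 0 i (i + j) (i + j + k)) (by
    intro k l
    obtain ⟨θ, hθ⟩ := h.exists_nf hc
    unfold LD.cn cK
    rw [if_pos]; left; unfold bra; ring) (h.cn_coc hc hg)
  refine ⟨N, fun x hx hx1 => ?_⟩
  have e : g x = cW g (1, 0) (0, 1) (1, 1) (x, 1) := by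
    rw [cW_ind] <;> simp [det2, GG]
  have key : ∀ θ ∈ TT p K, cW g (1, 0) (0, 1) (1, 1) (x, 1) =
      N (PC (L (ev (p := p) θ (1, 0))) (L (ev (p := p) θ (0, 1))) (L (ev (p := p) θ (1, 1))) (L (ev (p := p) θ (x, 1))))
      + S (L (ev (p := p) θ (1, 1)) - L (ev (p := p) θ (1, 0))) (L (ev (p := p) θ (x, 1)) - L (ev (p := p) θ (1, 1)))
      - S (L (ev (p := p) θ (1, 1)) - L (ev (p := p) θ (0, 1))) (L (ev (p := p) θ (x, 1)) - L (ev (p := p) θ (1, 1)))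
      - S (L (ev (p := p) θ (0, 1)) - L (ev (p := p) θ (1, 0))) (L (ev (p := p) θ (x, 1)) - L (ev (p := p) θ (0, 1)))
      + S (L (ev (p := p) θ (0, 1)) - L (ev (p := p) θ (1, 0))) (L (ev (p := p) θ (1, 1)) - L (ev (p := p) θ (0, 1))) := by
    intro θ hθ
    rw [mem_TT] at hθ
    rw [h.cW_cn hθ (by simp) (by simp) (by simp) (by simp), h.cn_F]
    refine (hN _ _ _).trans ?_
    unfold PC cst
    rw [← nsmul_eq_mul, map_nsmul]
    congr 4 <;> simp
  have hx1' : x - 1 ≠ 0 := sub_ne_zero.2 hx1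
  have h1x : 1 - x ≠ 0 := sub_ne_zero.2 hx1.symm
  rw [e, ← Finset.sum_const, Finset.sum_congr rfl key]
  simp only [Finset.sum_add_distrib, Finset.sum_sub_distrib, ← map_sum]
  rw [h.tri_const (w0 := (1, 0)) (w1 := (1, 1)) (w2 := (x, 1)), h.tri_const (w0 := (0, 1)) (w1 := (1, 1)) (w2 := (x, 1)),
    h.tri_const (w0 := (1, 0)) (w1 := (0, 1)) (w2 := (x, 1))]
  · unfold DD sm; abel
  all_goals simp [det2, hx, hx1', h1x]
end sums

section tors
variable {k : Type*} [Field k] [Fintype k] {A : Type*} [AddCommGroup A] {g : k → A}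

theorem sum_units_zero (q : QD (fun _ => 1) g) (tf : TF2 A) : ∑ y ∈ Finset.univ.erase (0 : k), g y = 0 := by
  apply tf
  have : ∑ y ∈ Finset.univ.erase (0 : k), g y = ∑ y ∈ Finset.univ.erase (0 : k), g y⁻¹ := by
    apply Finset.sum_nbij' (fun y => y⁻¹) (fun y => y⁻¹) <;> simp
  nth_rewrite 2 [this]
  rw [← Finset.sum_add_distrib]
  apply Finset.sum_eq_zero
  intro y hy
  simp only [Finset.mem_erase, Finset.mem_univ, and_true] at hy
  rw [q.inv y hy]; abel

theorem sum_perm (q : QD (fun _ => 1) g) (tf : TF2 A) {b : k} (hb : b ≠ 0) (σ : k → k)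
    (h1 : ∀ y, y ≠ 0 → y ≠ 1 → σ y ≠ 0 ∧ σ y ≠ b) (h2 : ∀ y z, y ≠ 0 → y ≠ 1 → z ≠ 0 → z ≠ 1 → σ y = σ z → y = z) :
    ∑ y ∈ (Finset.univ.erase (0 : k)).erase 1, g (σ y) = - g b := by
  have hm : Set.MapsTo σ ((Finset.univ.erase (0 : k)).erase 1 : Finset k) ((Finset.univ.erase (0 : k)).erase b : Finset k) := by
    intro y hy
    simp only [Finset.mem_coe, Finset.mem_erase, Finset.mem_univ, and_true] at hy ⊢
    have := h1 y hy.2 hy.1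
    exact ⟨this.2, this.1⟩
  have hi : Set.InjOn σ ((Finset.univ.erase (0 : k)).erase 1 : Finset k) := by
    intro y hy z hz h
    simp only [Finset.mem_coe, Finset.mem_erase, Finset.mem_univ, and_true] at hy hz
    exact h2 y z hy.2 hy.1 hz.2 hz.1 h
  have hs := Finset.sum_nbij (f := fun y => g (σ y)) (g := g) σ hm hi (Finset.surjOn_of_injOn_of_card_le _ hm hi (by
    rw [Finset.card_erase_of_mem (a := b) (by simp [hb]), Finset.card_erase_of_mem (a := (1 : k)) (by simp)])) (fun _ _ => rfl)
  rw [hs]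
  have := Finset.add_sum_erase (Finset.univ.erase (0 : k)) g (a := b) (by simp [hb])
  rw [sum_units_zero q tf] at this
  exact eq_neg_of_add_eq_zero_right this

theorem GD.tors (hg : GD g) (tf : TF2 A) {x : k} (hx : x ≠ 0) (hx1 : x ≠ 1) : (Fintype.card k + 1) • g x = 0 := by
  have q := hg.qd
  have a1 : 1 - x ≠ 0 := sub_ne_zero.2 hx1.symm
  have s1 : ∑ y ∈ (Finset.univ.erase (0 : k)).erase 1, g y = - g 1 :=
    sum_perm q tf one_ne_zero (fun y => y) (fun y h h' => ⟨h, h'⟩) (fun y z _ _ _ _ h => h)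
  have s2 : ∑ y ∈ (Finset.univ.erase (0 : k)).erase 1, g (y / x) = - g (1 / x) := by
    apply sum_perm q tf (one_div_ne_zero hx) (fun y => y / x)
    · grind
    · simp_all
  have s3 : ∑ y ∈ (Finset.univ.erase (0 : k)).erase 1, g (y * (1 - x) / (x * (1 - y))) = - g (1 - 1 / x) := by
    apply sum_perm q tf (by rw [show 1 - 1 / x = - ((1 - x) / x) by field_simp; ring]; exact neg_ne_zero.2 (by positivity))
      (fun y => (y * (1 - x) / (x * (1 - y))))
    · grind
    · grind
  have s4 : ∑ y ∈ (Finset.univ.erase (0 : k)).erase 1, g ((1 - x) / (1 - y)) = - g (1 - x) := by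
    apply sum_perm q tf a1 (fun y => (1 - x) / (1 - y))
    · grind
    · grind
  have hsum : ∑ y ∈ (Finset.univ.erase (0 : k)).erase 1, (g x - g y + g (y / x)
      - g (y * (1 - x) / (x * (1 - y))) + g ((1 - x) / (1 - y))) = 0 := by
    apply Finset.sum_eq_zero
    intro y hy
    simp only [Finset.mem_erase, Finset.mem_univ, and_true] at hy
    have := q.ft x y hx hx1 hy.2 hy.1
    simpa using this
  simp only [Finset.sum_add_distrib, Finset.sum_sub_distrib, s1, s2, s3, s4, Finset.sum_const] at hsum
  rw [Finset.card_erase_of_mem (by simp), Finset.card_erase_of_mem (by simp), Finset.card_univ] at hsum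
  have hc : 2 ≤ Fintype.card k := Fintype.one_lt_card
  obtain ⟨m, hm⟩ := Nat.exists_eq_add_of_le hc
  rw [hm] at hsum ⊢
  rw [show 2 + m - 1 - 1 = m by omega] at hsum
  have r1 := hg.refl x
  have r2 := hg.refl (1 / x)
  have r3 := q.inv x hx
  rw [← one_div] at r3
  have r4 := q.one
  linear_combination (norm := module) hsum + r1 - r2 + 2 • r3 - r4

end tors

section gp
variable {p : ℕ} [Fact p.Prime] {K : Type} [Field K] [Algebra (ZMod p) K] [Fintype K]

theorem card_TT (hc : Fintype.card K = p ^ 2) : (TT p K).card = p ^ 2 - p := by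
  have inj : Function.Injective (algebraMap (ZMod p) K) := (algebraMap (ZMod p) K).injective
  have : TT p K = (Finset.univ.image (algebraMap (ZMod p) K))ᶜ := by
    ext θ; simp [mem_TT, NF]
  rw [this, Finset.card_compl, Finset.card_image_of_injective _ inj, hc, Finset.card_univ, ZMod.card]

variable {L : K → ZMod (p + 1)} {τ : K}

omit [Fact p.Prime] in
theorem PC_coc (t0 t1 t2 t3 t4 : ZMod (p + 1)) :
    PC t1 t2 t3 t4 - PC t0 t2 t3 t4 + PC t0 t1 t3 t4 - PC t0 t1 t2 t4 + PC t0 t1 t2 t3 = 0 := by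
  have := cst_coc (t1 - t0) (t2 - t1) (t3 - t2) (t4 - t3)
  unfold PC
  rw [← this]
  congr 4 <;> (try congr 1) <;> (try congr 1) <;> ring

theorem sm_coc (w0 w1 w2 w3 w4 : ZMod p × ZMod p) :
    sm L PC w1 w2 w3 w4 - sm L PC w0 w2 w3 w4 + sm L PC w0 w1 w3 w4 - sm L PC w0 w1 w2 w4 + sm L PC w0 w1 w2 w3 = 0 := by
  unfold sm
  simp only [← Finset.sum_add_distrib, ← Finset.sum_sub_distrib]
  apply Finset.sum_eq_zero
  intro θ _
  exact PC_coc _ _ _ _ _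

namespace LD
variable (h : LD p K L τ)
include h

theorem DD_cr {w0 w1 w2 w3 : ZMod p × ZMod p} (h01 : det2 w0 w1 ≠ 0) (h02 : det2 w0 w2 ≠ 0)
    (h12 : det2 w1 w2 ≠ 0) (h03 : det2 w0 w3 ≠ 0) :
    sm L PC w0 w1 w2 w3 = DD L (det2 w1 w3 * det2 w0 w2 / (det2 w0 w3 * det2 w1 w2)) :=
  h.sm_normal PC_TI h01 h02 h12 h03

theorem DD_ft {x y : ZMod p} (hx : x ≠ 0) (hx1 : x ≠ 1) (hy : y ≠ 0) (hy1 : y ≠ 1) (hxy : x ≠ y) :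
    DD L (x * (1 - y) / (y * (1 - x))) - DD L ((1 - y) / (1 - x)) + DD L (y / x) - DD L y + DD L x = 0 := by
  have a1 : 1 - x ≠ 0 := sub_ne_zero.2 hx1.symm
  have a2 : 1 - y ≠ 0 := sub_ne_zero.2 hy1.symm
  have a3 : x - y ≠ 0 := sub_ne_zero.2 hxy
  have := sm_coc (L := L) (1, 0) (0, 1) (1, 1) (x, 1) (y, 1)
  rw [h.DD_cr (w0 := (0, 1)), h.DD_cr (w0 := (1, 0)) (w1 := (1, 1)), h.DD_cr (w0 := (1, 0)) (w1 := (0, 1)) (w2 := (x, 1))] at this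
  · rw [← this]
    unfold DD
    congr 4
    all_goals congr 1
    all_goals simp [det2]
    ring
  all_goals simp [det2, a1, hx, hy]

variable {n' : ℕ} (hn : n' ∣ p + 1)

def gq (L : K → ZMod (p + 1)) (hn : n' ∣ p + 1) (x : ZMod p) : ZMod n' :=
  if x = 1 then 0 else if x = 0 then ZMod.castHom hn _ (DD L 2) else ZMod.castHom hn _ (DD L x)

theorem gq_GD (tf : TF2 (ZMod n')) (hp : 5 ≤ p) : GD (gq L hn) := by
  have e1 : gq L hn 1 = 0 := by simp [gq]
  have e : ∀ x : ZMod p, x ≠ 0 → x ≠ 1 → gq L hn x = ZMod.castHom hn _ (DD L x) := by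
    intro x h0 h1; rw [gq, if_neg h1, if_neg h0]
  have R : ∀ x y : ZMod p, x ≠ 0 → x ≠ 1 → y ≠ 0 → y ≠ 1 → x ≠ y →
      gq L hn (x * (1 - y) / (y * (1 - x))) - gq L hn ((1 - y) / (1 - x)) + gq L hn (y / x) - gq L hn y + gq L hn x = 0 := by
    intro x y hx hx1 hy hy1 hxy
    have a1 : 1 - x ≠ 0 := sub_ne_zero.2 hx1.symm
    have a2 : 1 - y ≠ 0 := sub_ne_zero.2 hy1.symm
    have a3 : x - y ≠ 0 := sub_ne_zero.2 hxy
    rw [e x hx hx1, e y hy hy1, e _ (by positivity) _, e _ (by positivity) _, e _ (by positivity) _]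
    · simp only [← map_sub, ← map_add]; rw [h.DD_ft hx hx1 hy hy1 hxy, map_zero]
    all_goals
      intro hh
      field_simp at hh
      apply a3
      first | linear_combination hh | linear_combination -hh
  have P : ∀ u Y : ZMod p, u ≠ 0 → u ≠ 1 → Y ≠ 0 → Y ≠ 1 → u ≠ Y →
      gq L hn (Y / u) + gq L hn (u / Y) = gq L hn Y + gq L hn Y⁻¹ - (gq L hn u + gq L hn u⁻¹) := by
    intro u Y hu hu1 hY hY1 huY
    have b1 : Y - u ≠ 0 := sub_ne_zero.2 huY.symm
    have b2 : Y - 1 ≠ 0 := sub_ne_zero.2 hY1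
    have b3 : 1 - u ≠ 0 := sub_ne_zero.2 hu1.symm
    obtain ⟨x, hx⟩ : ∃ x, x = (Y - 1) / (Y - u) := ⟨_, rfl⟩
    obtain ⟨y, hy⟩ : ∃ y, y = u * (Y - 1) / (Y - u) := ⟨_, rfl⟩
    have x0 : x ≠ 0 := by rw [hx]; positivity
    have y0 : y ≠ 0 := by rw [hy]; positivity
    have x1 : 1 - x = (1 - u) / (Y - u) := by rw [hx]; field_simp; ring
    have y1 : 1 - y = Y * (1 - u) / (Y - u) := by rw [hy]; field_simp; ring
    have xy : x - y = (1 - u) * (Y - 1) / (Y - u) := by rw [hx, hy]; field_simp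
    have x1' : x ≠ 1 := by
      grind
    have y1' : y ≠ 1 := by
      grind
    have xy' : x ≠ y := by
      simp_all
    have r1 := R x y x0 x1' y0 y1' xy'
    have r2 := R y x y0 y1' x0 x1' xy'.symm
    rw [x1, y1] at r1 r2
    rw [hx, hy] at r1 r2
    rw [show (Y - 1) / (Y - u) * (Y * (1 - u) / (Y - u)) / (u * (Y - 1) / (Y - u) * ((1 - u) / (Y - u))) = Y / u by
        field_simp,
      show Y * (1 - u) / (Y - u) / ((1 - u) / (Y - u)) = Y by field_simp,
      show u * (Y - 1) / (Y - u) / ((Y - 1) / (Y - u)) = u by field_simp] at r1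
    rw [show u * (Y - 1) / (Y - u) * ((1 - u) / (Y - u)) / ((Y - 1) / (Y - u) * (Y * (1 - u) / (Y - u))) = u / Y by
        field_simp,
      show (1 - u) / (Y - u) / (Y * (1 - u) / (Y - u)) = Y⁻¹ by field_simp,
      show (Y - 1) / (Y - u) / (u * (Y - 1) / (Y - u)) = u⁻¹ by field_simp] at r2
    linear_combination r1 + r2
  have inv : ∀ v : ZMod p, v ≠ 0 → gq L hn v⁻¹ = - gq L hn v := by
    intro v hv
    by_cases hv1 : v = 1
    · rw [hv1, inv_one, e1, neg_zero]
    obtain ⟨u, hu⟩ : ∃ u : ZMod p, u ∉ ({0, 1, v⁻¹} : Finset (ZMod p)) := by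
      by_contra! hcon
      have : (Finset.univ : Finset (ZMod p)).card ≤ ({0, 1, v⁻¹} : Finset (ZMod p)).card :=
        Finset.card_le_card (fun u _ => hcon u)
      rw [Finset.card_univ, ZMod.card] at this
      have := this.trans Finset.card_le_three
      omega
    simp only [Finset.mem_insert, Finset.mem_singleton, not_or] at hu
    obtain ⟨u0, u1, uv⟩ := hu
    have hY1 : u * v ≠ 1 := fun h => uv (eq_inv_of_mul_eq_one_left h)
    have hYu : u ≠ u * v := fun h => hv1 (by
      have : u * (v - 1) = 0 := by linear_combination -h
      exact sub_eq_zero.1 ((mul_eq_zero.1 this).resolve_left u0))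
    have p1 := P u (u * v) u0 u1 (by positivity) hY1 hYu
    have p2 := P (u * v) u (by positivity) hY1 u0 u1 hYu.symm
    rw [show u * v / u = v by field_simp, show u / (u * v) = v⁻¹ by field_simp] at p1 p2
    apply eq_neg_of_add_eq_zero_left
    apply tf
    linear_combination p1 + p2
  have q : QD (fun _ : ZMod p => 1) (gq L hn) := by
    refine ⟨e1, inv, ?_⟩
    intro x y hx hx1 hy hy1
    have a1 : 1 - x ≠ 0 := sub_ne_zero.2 hx1.symm
    have a2 : 1 - y ≠ 0 := sub_ne_zero.2 hy1.symm
    simp only [one_smul, mul_one]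
    by_cases hxy : x = y
    · simp_all
    · grind
  have k2 : (2 : ZMod p) ≠ 0 := by
    intro h2
    have : ((2 : ℕ) : ZMod p) = 0 := by exact_mod_cast h2
    rw [ZMod.natCast_eq_zero_iff] at this
    exact absurd (Nat.le_of_dvd (by norm_num) this) (by omega)
  have k21 : (2 : ZMod p) ≠ 1 := fun h => one_ne_zero (α := ZMod p) (by linear_combination h)
  have e0 : gq L hn 0 = gq L hn 2 := by
    rw [e 2 k2 k21]; simp [gq]
  refine ⟨q, ?_, by rw [e0]; exact q.three tf k2⟩
  intro a
  by_cases ha : a = 0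
  · rw [ha, sub_zero, e1, add_zero]
  by_cases ha1 : a = 1
  · rw [ha1, sub_self, e1, zero_add]
  rw [e0]; exact q.refl tf k2 ha ha1

end LD
end gp

section gamma
variable {p : ℕ} [Fact p.Prime]

omit [Fact p.Prime] in
theorem cone_sum (Y : ZMod (p + 1) → ZMod (p + 1)) :
    ∑ j, ∑ k, PC (Y j) (Y (j + 1)) (Y k) (Y (k + 1)) = 0 := by
  have hb : ∀ x y z w : ZMod (p + 1), PC x y z w = PC 0 y z w - PC 0 x z w + (PC 0 x y w - PC 0 x y z) := by
    intro x y z w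
    linear_combination PC_coc 0 x y z w
  simp_rw [fun j k => hb (Y j) (Y (j + 1)) (Y k) (Y (k + 1)), Finset.sum_add_distrib, Finset.sum_sub_distrib]
  have e := Equiv.sum_comp (Equiv.addRight (1 : ZMod (p + 1))) (fun j => ∑ k, PC 0 (Y j) (Y k) (Y (k + 1)))
  simp only [Equiv.coe_addRight] at e
  rw [e, sub_self, zero_add, sub_eq_zero]
  apply Finset.sum_congr rfl
  intro j _
  exact Equiv.sum_comp (Equiv.addRight (1 : ZMod (p + 1))) (fun k => PC 0 (Y j) (Y (j + 1)) (Y k))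

theorem val_one_n : (1 : ZMod (p + 1)).val = 1 := by
  have := (Fact.out : p.Prime).two_le
  rw [ZMod.val_one_eq_one_mod, Nat.mod_eq_of_lt (by omega)]

theorem carry_one (i : ZMod (p + 1)) : carry 1 i = if i = -1 then 1 else 0 := by
  unfold carry
  have h : i = -1 ↔ i.val = p := by
    rw [← (ZMod.val_injective (p + 1)).eq_iff, ZMod.val_neg_one]
  have h2 := ZMod.val_lt i
  simp only [h, val_one_n]
  split_ifs <;> omega

theorem carry_neg_one (i : ZMod (p + 1)) : carry (-1) i = if i = 0 then 0 else 1 := by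
  unfold carry
  have h : i = 0 ↔ i.val = 0 := (ZMod.val_eq_zero i).symm
  simp only [h, ZMod.val_neg_one]
  split_ifs <;> omega

variable {K : Type} [Field K] [Algebra (ZMod p) K] [Fintype K] {L : K → ZMod (p + 1)} {τ : K}

/-- the parameter -/
def thz (p : ℕ) (θ ζ : K) : K := (θ - ζ * θ ^ p) / (1 - ζ)

omit [Fintype K] in
theorem ev_thz {θ ζ : K} (hζ : 1 - ζ ≠ 0) (w : ZMod p × ZMod p) :
    (1 - ζ) * ev (thz p θ ζ) w = ev θ w - ζ * (ev θ w) ^ p := by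
  rw [ev_pow]; unfold ev thz; field_simp; ring

namespace LD
variable (h : LD p K L τ)
include h

omit [Fintype K] in
theorem exp_ne (a m : ℕ) (ha : a + 1 < p - 1) : 1 - τ ^ (a + 1 + (p - 1) * m) ≠ 0 := by
  intro e
  have e1 : τ ^ (a + 1 + (p - 1) * m) = τ ^ 0 := by rw [pow_zero]; linear_combination -e
  rw [h.ord] at e1
  have e2 := e1.of_mul_left (p + 1)
  have e3 : (p - 1) ∣ (a + 1 + (p - 1) * m) := (Nat.modEq_zero_iff_dvd).1 e2
  rw [Nat.dvd_add_left (Dvd.intro _ rfl)] at e3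
  have := Nat.le_of_dvd (by omega) e3
  omega

omit [Fintype K] in
theorem thz_NF {θ : K} (hθ : NF p K θ) (a m : ℕ) (ha : a + 1 < p - 1) : NF p K (thz p θ (τ ^ (a + 1 + (p - 1) * m))) := by
  intro c hcc
  have h1 := h.exp_ne a m ha
  have e := ev_thz (θ := θ) h1 (c, 1)
  rw [show ev (thz p θ (τ ^ (a + 1 + (p - 1) * m))) (c, 1) = 0 by rw [← hcc]; simp [ev], mul_zero] at e
  obtain ⟨k, hk⟩ := h.gen (ev θ (c, 1)) (h.ev_ne hθ (by simp))
  rw [hk, ← pow_mul, ← pow_add] at e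
  have e1 := (h.ord _ _).1 (sub_eq_zero.1 e.symm)
  have e2 := e1.of_mul_left (p + 1)
  have hp := (Fact.out : p.Prime).two_le
  have e3 : k + 0 ≡ k + (a + 1) + (p - 1) * (m + k) [MOD (p - 1)] := by
    refine e2.trans ?_
    rw [show a + 1 + (p - 1) * m + k * p = k + (a + 1) + (p - 1) * (m + k) by
      obtain ⟨s, rfl⟩ := Nat.exists_eq_add_of_le hp
      simp only [show 2 + s - 1 = s + 1 by omega]; ring]
  have e4 : k + 0 ≡ k + (a + 1) [MOD (p - 1)] := by
    simp_all
  have e5 := Nat.ModEq.add_left_cancel' k e4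
  have e6 := (Nat.modEq_zero_iff_dvd).1 e5.symm
  have := Nat.le_of_dvd (by omega) e6
  omega

omit [Fintype K] in
theorem ell_thz {θ : K} (hθ : NF p K θ) {w : ZMod (p + 1) → ZMod p × ZMod p} (hw : ∀ i, ev θ (w i) = τ ^ i.val)
    (a : ℕ) (ha : a + 1 < p - 1) (i j : ZMod (p + 1)) :
    L (ev (thz p θ (τ ^ (a + 1 + (p - 1) * j.val))) (w i)) =
      (- j - L (1 - τ ^ (a + 1 + (p - 1) * j.val))) + ((j + i) + L (1 - τ ^ (a + 1 + (p - 1) * (j + i).val))) := by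
  have h1 := h.exp_ne a j.val ha
  have e := ev_thz (θ := θ) h1 (w i)
  have hp := (Fact.out : p.Prime).two_le
  have e2 : τ ^ (a + 1 + (p - 1) * j.val) * (τ ^ i.val) ^ p = τ ^ i.val * τ ^ (a + 1 + (p - 1) * (j + i).val) := by
    rw [← pow_mul, ← pow_add, ← pow_add, h.ord]
    have m1 : (p - 1) * (j.val + i.val) ≡ (p - 1) * (j + i).val [MOD (p + 1) * (p - 1)] := by
      rw [mul_comm (p + 1)]
      apply Nat.ModEq.mul_left'
      rw [ZMod.val_add]
      exact (Nat.mod_modEq _ _).symm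
    have m2 := (m1.add_left (i.val + (a + 1)))
    rw [show a + 1 + (p - 1) * j.val + i.val * p = i.val + (a + 1) + (p - 1) * (j.val + i.val) by
      obtain ⟨s, rfl⟩ := Nat.exists_eq_add_of_le hp
      simp only [show 2 + s - 1 = s + 1 by omega]; ring, show i.val + (a + 1 + (p - 1) * (j + i).val) = i.val + (a + 1) + (p - 1) * (j + i).val by ring]
    exact m2
  rw [hw, e2, ← mul_one_sub] at e
  have h3 := h.exp_ne a (j + i).val ha
  have hnz : ev (thz p θ (τ ^ (a + 1 + (p - 1) * j.val))) (w i) ≠ 0 := by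
    intro h0
    rw [h0, mul_zero] at e
    exact mul_ne_zero (pow_ne_zero _ h.t0) h3 e.symm
  have e4 := congrArg L e
  rw [h.mul _ _ h1 hnz, h.mul _ _ (pow_ne_zero _ h.t0) h3, h.pow, ZMod.natCast_zmod_val] at e4
  linear_combination e4

theorem gamma (hc : Fintype.card K = p ^ 2) (hp : 5 ≤ p) {θ : K} (hθ : NF p K θ) {w : ZMod (p + 1) → ZMod p × ZMod p}
    (hw : ∀ i, ev θ (w i) = τ ^ i.val) :
    ∑ i, sm L PC (w 0) (w 1) (w (i + 1)) (w (i + 2)) = 2 := by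
  have hpn : ((p : ℕ) : ZMod (p + 1)) = -1 := by
    have : ((p + 1 : ℕ) : ZMod (p + 1)) = 0 := ZMod.natCast_self _
    push_cast at this
    linear_combination this
  have hθp : θ - θ ^ p ≠ 0 := h.nf_pow hθ
  unfold sm
  rw [Finset.sum_comm]
  obtain ⟨G, hG⟩ : ∃ G : K → ZMod (p + 1), G = fun θ => ∑ i, PC (L (ev θ (w 0))) (L (ev θ (w 1))) (L (ev θ (w (i + 1))))
    (L (ev θ (w (i + 2)))) := ⟨_, rfl⟩
  have hθpN : NF p K (θ ^ p) := by
    intro a ha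
    have := ev_pow θ ((a, 1) : ZMod p × ZMod p)
    rw [show ev (θ ^ p) ((a, 1) : ZMod p × ZMod p) = 0 by rw [← ha]; simp [ev]] at this
    exact h.ev_ne hθ (w := (a, 1)) (by simp) (pow_eq_zero_iff ((Fact.out : p.Prime).ne_zero) |>.1 this)
  have m1 : θ ∈ TT p K := mem_TT.2 hθ
  have m2 : θ ^ p ∈ (TT p K).erase θ := by
    rw [Finset.mem_erase]; exact ⟨fun e => hθp (by rw [e, sub_self]), mem_TT.2 hθpN⟩
  change ∑ y ∈ TT p K, _ = _
  rw [show (∑ y ∈ TT p K, ∑ x, PC (L (ev y (w 0))) (L (ev y (w 1))) (L (ev y (w (x + 1)))) (L (ev y (w (x + 2))))) =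
    ∑ y ∈ TT p K, G y by rw [hG]]
  rw [← Finset.add_sum_erase _ _ m1, ← Finset.add_sum_erase _ _ m2]
  have g1 : G θ = 1 := by
    rw [hG]
    simp only [hw, h.pow, ZMod.natCast_zmod_val]
    have : ∀ i : ZMod (p + 1), PC 0 1 (i + 1) (i + 2) = if i = -1 then 1 else 0 := by
      intro i
      unfold PC cst
      rw [show (1 : ZMod (p + 1)) - 0 = 1 by ring, show i + 1 - 1 = i by ring, show i + 2 - (i + 1) = 1 by ring, carry_one]
      simp
    simp only [this, Finset.sum_ite_eq', Finset.mem_univ, if_true]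
  have g2 : G (θ ^ p) = 1 := by
    rw [hG]
    simp only [← ev_pow, hw, ← pow_mul, h.pow]
    push_cast
    simp only [ZMod.natCast_zmod_val, hpn]
    have : ∀ i : ZMod (p + 1), PC (0 * -1) (1 * -1) ((i + 1) * -1) ((i + 2) * -1) = (if i = 0 then 1 else 0) - 1 := by
      intro i
      unfold PC cst
      rw [show (1 : ZMod (p + 1)) * -1 - 0 * -1 = -1 by ring, show (i + 1) * -1 - 1 * -1 = -i by ring,
        show (i + 2) * -1 - (i + 1) * -1 = -1 by ring, carry_neg_one]
      simp only [neg_eq_zero]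
      split_ifs <;> simp
    simp only [this, Finset.sum_sub_distrib, Finset.sum_ite_eq', Finset.mem_univ, if_true, Finset.sum_const,
      Finset.card_univ, ZMod.card]
    rw [nsmul_eq_mul, ZMod.natCast_self]; ring
  have g3 : ∑ y ∈ ((TT p K).erase θ).erase (θ ^ p), G y = 0 := by
    let E : ℕ × ZMod (p + 1) → K := fun a => thz p θ (τ ^ (a.1 + 1 + (p - 1) * a.2.val))
    have hr : ∀ a : ℕ × ZMod (p + 1), a ∈ ((Finset.range (p - 2)) ×ˢ (Finset.univ : Finset (ZMod (p + 1))) : Finset _) → a.1 + 1 < p - 1 := by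
      grind
    have hm : Set.MapsTo E ((Finset.range (p - 2)) ×ˢ (Finset.univ : Finset (ZMod (p + 1))) : Finset _)
        ((((TT p K).erase θ).erase (θ ^ p) : Finset K) : Set K) := by
      intro a ha
      have ha' := hr a ha
      have h1 := h.exp_ne a.1 a.2.val ha'
      simp only [Finset.mem_coe, Finset.mem_erase, mem_TT]
      refine ⟨?_, ?_, h.thz_NF hθ _ _ ha'⟩
      · intro e
        simp only [E, thz] at e
        rw [div_eq_iff h1] at e
        apply hθp; linear_combination e
      · intro e
        simp only [E, thz] at e
        rw [div_eq_iff h1] at e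
        apply (mul_ne_zero (pow_ne_zero (a.1 + 1 + (p - 1) * a.2.val) h.t0) hθp); linear_combination e
    have hi : Set.InjOn E ((Finset.range (p - 2)) ×ˢ (Finset.univ : Finset (ZMod (p + 1))) : Finset _) := by
      intro a ha b hb e
      have ha' := hr a ha
      have hb' := hr b hb
      have h1 := h.exp_ne a.1 a.2.val ha'
      have h2 := h.exp_ne b.1 b.2.val hb'
      simp only [E, thz] at e
      rw [div_eq_div_iff h1 h2] at e
      have e1 : τ ^ (a.1 + 1 + (p - 1) * a.2.val) = τ ^ (b.1 + 1 + (p - 1) * b.2.val) := by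
        grind
      rw [h.ord] at e1
      have v1 := ZMod.val_lt a.2
      have v2 := ZMod.val_lt b.2
      have bound : ∀ r v : ℕ, r + 1 < p - 1 → v < p + 1 → r + 1 + (p - 1) * v < (p + 1) * (p - 1) := by
        intro r v hr hv
        have : (p - 1) * v ≤ (p - 1) * p := Nat.mul_le_mul_left _ (by omega)
        have : (p + 1) * (p - 1) = (p - 1) * p + (p - 1) := by ring
        omega
      have e2 := Nat.ModEq.eq_of_lt_of_lt e1 (bound _ _ ha' v1) (bound _ _ hb' v2)
      have e3 := congrArg (· % (p - 1)) e2
      simp only [Nat.add_mul_mod_self_left] at e3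
      rw [Nat.mod_eq_of_lt ha', Nat.mod_eq_of_lt hb'] at e3
      have e4 : a.1 = b.1 := by omega
      rw [e4] at e2
      have e5 : (p - 1) * a.2.val = (p - 1) * b.2.val := by omega
      have e6 := Nat.eq_of_mul_eq_mul_left (by omega) e5
      exact Prod.ext e4 (ZMod.val_injective _ e6)
    have hs := Finset.sum_nbij (f := fun a => G (E a)) (g := G) E hm hi (Finset.surjOn_of_injOn_of_card_le _ hm hi (by
      rw [Finset.card_erase_of_mem m2, Finset.card_erase_of_mem m1, card_TT hc, Finset.card_product, Finset.card_univ, ZMod.card,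
        Finset.card_range]
      obtain ⟨s, rfl⟩ := Nat.exists_eq_add_of_le hp
      simp only [show 5 + s - 2 = s + 3 by omega]
      rw [show (5 + s) ^ 2 - (5 + s) = (s + 3) * (5 + s + 1) + 2 by
        rw [Nat.sub_eq_iff_eq_add (by nlinarith)]; ring]
      omega)) (fun _ _ => rfl)
    rw [← hs, Finset.sum_product]
    apply Finset.sum_eq_zero
    intro r hr'
    have hr2 : r + 1 < p - 1 := by simp at hr'; omega
    rw [← cone_sum (fun m => m + L (1 - τ ^ (r + 1 + (p - 1) * m.val)))]
    apply Finset.sum_congr rfl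
    intro j _
    simp only [hG, E]
    symm
    rw [← Equiv.sum_comp (Equiv.addLeft (j + 1))]
    symm
    apply Finset.sum_congr rfl
    intro i _
    simp only [h.ell_thz hθ hw r hr2]
    rw [PC_TI]
    simp only [Equiv.coe_addLeft]
    rw [show j + 0 = j by ring, show j + (i + 1) = j + 1 + i by ring, show j + (i + 2) = j + 1 + i + 1 by ring]
  rw [g1, g2, g3]; norm_num
end LD
end gamma

section surj
variable {p : ℕ} [Fact p.Prime] {K : Type} [Field K] [Algebra (ZMod p) K] [Fintype K] {L : K → ZMod (p + 1)} {τ : K}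

theorem sm_12 (a b d : ZMod p × ZMod p) : sm L PC a b b d = 0 := by
  unfold sm
  apply Finset.sum_eq_zero
  intro θ _
  unfold PC cst
  rw [sub_self, carry_zero]; simp
theorem sm_01 (a b d : ZMod p × ZMod p) : sm L PC a a b d = 0 := by
  unfold sm
  apply Finset.sum_eq_zero
  intro θ _
  unfold PC cst
  rw [sub_self, zero_carry]; simp

variable (L) in
def HD : AddSubgroup (ZMod (p + 1)) := AddSubgroup.closure {y | ∃ x : ZMod p, x ≠ 0 ∧ x ≠ 1 ∧ y = DD L x}

namespace LD
variable (h : LD p K L τ)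
include h

theorem kap {a b d a' b' d' : ZMod p × ZMod p} (h1 : det2 a b ≠ 0) (h2 : det2 a d ≠ 0) (h3 : det2 b d ≠ 0)
    (h1' : det2 a' b' ≠ 0) (h2' : det2 a' d' ≠ 0) (h3' : det2 b' d' ≠ 0) : sm L PC a b a d = sm L PC a' b' a' d' := by
  have e : ∀ a b d, sm L PC a b a d = ∑ θ ∈ TT p K, (fun u v => cst u (-u) (u + v)) (L (ev θ b) - L (ev θ a)) (L (ev θ d) - L (ev θ b)) := by
    intro a b d
    unfold sm PC
    apply Finset.sum_congr rfl
    intro θ _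
    simp
  rw [e, e, h.tri_const (β := fun u v => cst u (-u) (u + v)) h1 h2 h3, h.tri_const (β := fun u v => cst u (-u) (u + v)) h1' h2' h3']

theorem sm_abab {a b d : ZMod p × ZMod p} (h1 : det2 a b ≠ 0) (h2 : det2 a d ≠ 0) (h3 : det2 b d ≠ 0) :
    sm L PC a b a b = 0 := by
  have c := sm_coc (L := L) a b a b d
  rw [sm_01, sm_12, h.kap (a := b) (b := a) (a' := a) (b' := b) (d' := d) (by rw [det2_symm]; exact neg_ne_zero.2 h1) h3 h2 h1 h2 h3] at c
  linear_combination c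

theorem DD_mem {a b c d : ZMod p × ZMod p} (h01 : det2 a b ≠ 0) (h02 : det2 a c ≠ 0) (h03 : det2 a d ≠ 0)
    (h12 : det2 b c ≠ 0) (h13 : det2 b d ≠ 0) (h23 : det2 c d ≠ 0) : sm L PC a b c d ∈ HD L := by
  rw [h.DD_cr h01 h02 h12 h03]
  apply AddSubgroup.subset_closure
  refine ⟨_, by positivity, ?_, rfl⟩
  intro e
  rw [div_eq_one_iff_eq (by positivity)] at e
  apply mul_ne_zero h01 h23
  linear_combination plucker a b c d + e

theorem sm_abca {a b c d : ZMod p × ZMod p} (h01 : det2 a b ≠ 0) (h02 : det2 a c ≠ 0) (h03 : det2 a d ≠ 0)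
    (h12 : det2 b c ≠ 0) (h13 : det2 b d ≠ 0) (h23 : det2 c d ≠ 0) : sm L PC a b c a ∈ HD L := by
  have hc := sm_coc (L := L) a b c a d
  rw [h.kap (a := a) (b := c) (a' := a) (b' := b) (d' := d) h02 h03 h23 h01 h03 h13] at hc
  have : sm L PC a b c a = sm L PC a b c d - sm L PC b c a d := by linear_combination hc
  rw [this]
  apply AddSubgroup.sub_mem _ (h.DD_mem h01 h02 h03 h12 h13 h23)
  have s : ∀ {w v : ZMod p × ZMod p}, det2 w v ≠ 0 → det2 v w ≠ 0 := by
    intro w v hh; rw [det2_symm]; exact neg_ne_zero.2 hh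
  exact h.DD_mem h12 (s h01) h13 (s h02) h23 h03

theorem two_mem (hc : Fintype.card K = p ^ 2) (hp : 5 ≤ p) : (2 : ZMod (p + 1)) ∈ HD L := by
  obtain ⟨θ, hθ⟩ := h.exists_nf hc
  choose w hw using fun i : ZMod (p + 1) => ev_surj hc hθ (τ ^ i.val)
  rw [← h.gamma hc hp hθ hw]
  apply AddSubgroup.sum_mem
  have wn : ∀ i, w i ≠ 0 := by
    intro i e
    have := hw i
    rw [e] at this
    simp [ev] at this
    exact pow_ne_zero _ h.t0 this.symm
  have dn : ∀ i j, i ≠ j → det2 (w i) (w j) ≠ 0 := by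
    intro i j hij e
    obtain ⟨s, hs, e1⟩ := det2_dep (wn i) (wn j) e
    apply hij
    have := h.L_smul hθ (wn i) hs
    rw [← e1, hw, hw, h.pow, h.pow, ZMod.natCast_zmod_val, ZMod.natCast_zmod_val] at this
    exact this.symm
  have cst : ∀ m : ℕ, 0 < m → m < p + 1 → ((m : ℕ) : ZMod (p + 1)) ≠ 0 := by
    intro m h1 h2 e
    rw [ZMod.natCast_eq_zero_iff] at e
    exact absurd (Nat.le_of_dvd h1 e) (by omega)
  have c1 : (1 : ZMod (p + 1)) ≠ 0 := by exact_mod_cast cst 1 (by omega) (by omega)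
  have c2 : (2 : ZMod (p + 1)) ≠ 0 := by exact_mod_cast cst 2 (by omega) (by omega)
  have c3 : (3 : ZMod (p + 1)) ≠ 0 := by exact_mod_cast cst 3 (by omega) (by omega)
  have d01 : (0 : ZMod (p + 1)) ≠ 1 := c1.symm
  have d02 : (0 : ZMod (p + 1)) ≠ 2 := c2.symm
  have d12 : (1 : ZMod (p + 1)) ≠ 2 := fun e => c1 (by linear_combination -e)
  intro i _
  by_cases i0 : i = 0
  · rw [i0, zero_add, sm_12]; exact zero_mem _
  by_cases i1 : i = -1
  · rw [show i + 1 = 0 by rw [i1]; ring, show i + 2 = 1 by rw [i1]; ring, h.sm_abab (dn 0 1 d01) (dn 0 2 d02) (dn 1 2 d12)]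
    exact zero_mem _
  by_cases i2 : i = -2
  · rw [show i + 1 = -1 by rw [i2]; ring, show i + 2 = 0 by rw [i2]; ring]
    apply h.sm_abca (dn 0 1 d01) (dn 0 _ _) (dn 0 2 d02) (dn 1 _ _) (dn 1 2 d12) (dn _ 2 _)
    · exact fun e => c1 (by linear_combination e)
    · exact fun e => c2 (by linear_combination e)
    · exact fun e => c3 (by linear_combination -e)
  · apply h.DD_mem (dn 0 1 d01) (dn _ _ _) (dn _ _ _) (dn _ _ _) (dn _ _ _) (dn _ _ _)
    · exact fun e => i1 (by linear_combination -e)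
    · exact fun e => i2 (by linear_combination -e)
    · exact fun e => i0 (by linear_combination -e)
    · exact fun e => i1 (by linear_combination -e)
    · exact fun e => c1 (by linear_combination -e)
end LD

theorem oddPart_dvd (m : ℕ) : oddPart m ∣ m := by
  unfold oddPart
  exact Nat.ordCompl_dvd m 2
theorem oddPart_spec (m : ℕ) : m = 2 ^ (m.factorization 2) * oddPart m := by
  unfold oddPart
  exact (Nat.ordProj_mul_ordCompl_eq_self m 2).symm
theorem oddPart_odd {m : ℕ} (hm : m ≠ 0) : ∃ h, oddPart m = 2 * h + 1 := by
  have := Nat.not_dvd_ordCompl Nat.prime_two hm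
  change ¬ 2 ∣ oddPart m at this
  exact ⟨oddPart m / 2, by omega⟩

theorem TF2.pow {A : Type*} [AddCommGroup A] (tf : TF2 A) (k : ℕ) {a : A} (h : (2 ^ k) • a = 0) : a = 0 := by
  induction k with
  | zero => simpa using h
  | succ k ih =>
    apply ih; apply tf; rw [← two_nsmul, smul_smul, ← pow_succ']; exact h

theorem TF2.odd {A : Type*} [AddCommGroup A] (tf : TF2 A) {m : ℕ} {a : A} (h : m • a = 0) : oddPart m • a = 0 := by
  apply tf.pow (m.factorization 2)
  rw [smul_smul, ← oddPart_spec, h]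

theorem ZMod_TF2 {m h : ℕ} (hm : m = 2 * h + 1) : TF2 (ZMod m) := by
  intro a ha
  subst hm
  have : ((2 * h + 1 : ℕ) : ZMod (2 * h + 1)) * a = 0 := by rw [ZMod.natCast_self, zero_mul]
  push_cast at this
  linear_combination this - (h : ZMod (2 * h + 1)) * ha

/-- universal property of a residue datum -/
def Univ (p : ℕ) [Fact p.Prime] (g : ZMod p → ZMod (oddPart (p + 1))) : Prop :=
  GD g ∧ (∀ (A : Type) [AddCommGroup A], TF2 A → ∀ g' : ZMod p → A, GD g' →
    ∃ φ : ZMod (oddPart (p + 1)) →+ A, ∀ a, g' a = φ (g a)) ∧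
  AddSubgroup.closure (Set.range g) = ⊤

theorem gp_big (hp : 5 ≤ p) : ∃ g, Univ p g := by
  have hc0 : Nat.card (GaloisField p 2) = p ^ 2 := GaloisField.card p 2 (by norm_num)
  have : Finite (GaloisField p 2) := by infer_instance
  have := Fintype.ofFinite (GaloisField p 2)
  have hc : Fintype.card (GaloisField p 2) = p ^ 2 := by rw [← hc0, Nat.card_eq_fintype_card]
  obtain ⟨L, τ, h⟩ := LD_exists p (GaloisField p 2) hc
  obtain ⟨hh, hodd⟩ := oddPart_odd (m := p + 1) (by omega)
  have tfn := ZMod_TF2 hodd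
  have hn := oddPart_dvd (p + 1)
  refine ⟨LD.gq L hn, h.gq_GD hn tfn hp, ?_, ?_⟩
  · intro A _ tf g hg
    obtain ⟨N, hN⟩ := h.main hc hg
    have hγ : oddPart (p + 1) • N 1 = 0 := by
      apply tf.odd
      rw [← map_nsmul, nsmul_one, ZMod.natCast_self, map_zero]
    have k2 : (2 : ZMod p) ≠ 0 := by
      intro h2
      have : ((2 : ℕ) : ZMod p) = 0 := by exact_mod_cast h2
      rw [ZMod.natCast_eq_zero_iff] at this
      exact absurd (Nat.le_of_dvd (by norm_num) this) (by omega)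
    have k21 : (2 : ZMod p) ≠ 1 := fun h => one_ne_zero (α := ZMod p) (by linear_combination h)
    let ψ : ZMod (oddPart (p + 1)) →+ A := ZMod.lift _ ⟨zmultiplesHom A ((hh + 1) • N 1), by
      simp only [zmultiplesHom_apply]
      rw [natCast_zsmul, smul_comm, hγ, smul_zero]⟩
    have hψ : ∀ m : ℕ, ψ (m : ZMod _) = m • (hh + 1) • N 1 := by
      intro m
      have := ZMod.lift_coe (oddPart (p + 1)) (A := A) ⟨zmultiplesHom A ((hh + 1) • N 1), by
        simp only [zmultiplesHom_apply]
        rw [natCast_zsmul, smul_comm, hγ, smul_zero]⟩ (m : ℤ)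
      simp only [zmultiplesHom_apply, natCast_zsmul, Int.cast_natCast] at this
      exact this
    have main : ∀ x, x ≠ 0 → x ≠ 1 → g x = ψ (LD.gq L hn x) := by
      intro x hx hx1
      have t := hg.tors tf hx hx1
      rw [ZMod.card] at t
      have e := hN x hx hx1
      rw [card_TT hc, show p ^ 2 - p = (p - 2) * (p + 1) + 2 by
        obtain ⟨s, rfl⟩ := Nat.exists_eq_add_of_le hp
        simp only [show 5 + s - 2 = s + 3 by omega]
        rw [Nat.sub_eq_iff_eq_add (by nlinarith)]; ring, add_smul, mul_smul, t, smul_zero, zero_add] at e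
      have t' := tf.odd t
      rw [hodd] at t'
      rw [LD.gq, if_neg hx1, if_neg hx, ← ZMod.natCast_zmod_val (DD L x), map_natCast, hψ]
      have e2 : N (DD L x) = (DD L x).val • N 1 := by
        rw [← map_nsmul, nsmul_one, ZMod.natCast_zmod_val]
      rw [e2] at e
      rw [smul_comm, ← e]
      linear_combination (norm := module) -t'
    refine ⟨ψ, fun a => ?_⟩
    by_cases h1 : a = 1
    · rw [h1, hg.qd.one, LD.gq, if_pos rfl, map_zero]
    by_cases h0 : a = 0
    · have r := hg.refl (-1)
      rw [hg.qd.neg_one tf, zero_add, show (1 : ZMod p) - -1 = 2 by ring] at r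
      rw [h0, ← r, main 2 k2 k21]
      congr 1
      simp [LD.gq, k2, k21]
    · exact main a h0 h1
  · have m2 := h.two_mem hc hp
    have hle : HD L ≤ (AddSubgroup.closure (Set.range (LD.gq L hn))).comap (ZMod.castHom hn (ZMod (oddPart (p + 1)))).toAddMonoidHom := by
      unfold HD
      rw [AddSubgroup.closure_le]
      rintro _ ⟨x, hx, hx1, rfl⟩
      apply AddSubgroup.subset_closure
      refine ⟨x, ?_⟩
      rw [LD.gq, if_neg hx1, if_neg hx]; rfl
    have m3 := hle m2
    rw [AddSubgroup.mem_comap] at m3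
    have e2 : (ZMod.castHom hn (ZMod (oddPart (p + 1)))).toAddMonoidHom 2 = 2 := by
      change (ZMod.castHom hn (ZMod (oddPart (p + 1)))) 2 = 2
      exact map_ofNat _ 2
    rw [e2] at m3
    have m4 : (1 : ZMod (oddPart (p + 1))) ∈ AddSubgroup.closure (Set.range (LD.gq L hn)) := by
      have := AddSubgroup.nsmul_mem _ m3 (hh + 1)
      have e : (hh + 1) • (2 : ZMod (oddPart (p + 1))) = 1 := by
        have z : ((oddPart (p + 1) : ℕ) : ZMod (oddPart (p + 1))) = 0 := ZMod.natCast_self _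
        have z2 : ((2 * hh + 1 : ℕ) : ZMod (oddPart (p + 1))) = 0 := by rw [← hodd]; exact z
        push_cast at z2
        rw [nsmul_eq_mul]; push_cast
        linear_combination z2
      rwa [e] at this
    rw [eq_top_iff]
    intro a _
    obtain ⟨m, rfl⟩ := ZMod.intCast_surjective a
    have := AddSubgroup.zsmul_mem _ m4 m
    rwa [zsmul_one] at this
end surj

section small
theorem z3_aux : (1 : ZMod 3) - -1 = -1 := by decide
theorem z2_aux : ∀ a : ZMod 2, a = 0 ∨ a = 1 := by decide

theorem GD_zero {k : Type*} [Field k] {A : Type*} [AddCommGroup A] : GD (fun _ : k => (0 : A)) :=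
  ⟨⟨rfl, by simp, by simp⟩, by simp, by simp⟩

theorem gp_three (p : ℕ) [Fact p.Prime] (hp : p = 3) : ∃ g, Univ p g := by
  have hm : oddPart (p + 1) = 1 := by
    rw [hp]; norm_num [oddPart]
    rw [show (4 : ℕ) = 2 ^ 2 by norm_num, Nat.Prime.factorization_pow Nat.prime_two]; simp
  have : Subsingleton (ZMod (oddPart (p + 1))) := by rw [hm]; infer_instance
  refine ⟨fun _ => 0, GD_zero, ?_, ?_⟩
  · intro A _ tf g hg
    refine ⟨0, ?_⟩
    subst hp
    have h1 := hg.qd.one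
    have h2 := hg.qd.neg_one tf
    have h3 := hg.refl (-1)
    rw [show (1 : ZMod 3) - -1 = -1 from z3_aux, h2, add_zero] at h3
    intro a
    fin_cases a
    · exact h3.symm
    · exact h1
    · exact h2
  · exact Subsingleton.elim _ _

theorem gp_two (p : ℕ) [Fact p.Prime] (hp : p = 2) : ∃ g, Univ p g := by
  have hm : oddPart (p + 1) = 3 := by
    rw [hp]; norm_num [oddPart]
  subst hp
  have cases : ∀ a : ZMod 2, a = 0 ∨ a = 1 := z2_aux
  have gd : ∀ (A : Type) [AddCommGroup A] (c : A), c + c + c = 0 → GD (fun a : ZMod 2 => if a = 0 then c else 0) := by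
    intro A _ c hc
    refine ⟨⟨by simp, ?_, ?_⟩, ?_, by simpa using hc⟩
    · intro x hx; rcases cases x with rfl | rfl <;> simp at hx ⊢
    · intro x y hx hx1; rcases cases x with rfl | rfl <;> simp at hx hx1
    · intro a; rcases cases a with rfl | rfl <;> simp
  unfold Univ
  have e : oddPart (2 + 1) = 3 := hm
  rw [e]
  refine ⟨fun a => if a = 0 then 1 else 0, gd _ 1 (by decide), ?_, ?_⟩
  · intro A _ tf g hg
    have h3 : ((3 : ℕ) : ℤ) • g 0 = 0 := by
      rw [natCast_zsmul]; linear_combination (norm := module) hg.three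
    refine ⟨ZMod.lift 3 ⟨zmultiplesHom A (g 0), by rw [zmultiplesHom_apply]; exact h3⟩, ?_⟩
    intro a
    rcases cases a with rfl | rfl
    · have := ZMod.lift_coe 3 (A := A) ⟨zmultiplesHom A (g 0), by rw [zmultiplesHom_apply]; exact h3⟩ 1
      simp only [Int.cast_one, zmultiplesHom_apply, one_smul] at this
      simp only [if_true]
      exact this.symm
    · simp [hg.qd.one]
  · rw [eq_top_iff]
    intro a _
    have m4 : (1 : ZMod 3) ∈ AddSubgroup.closure (Set.range (fun a : ZMod 2 => if a = 0 then (1 : ZMod 3) else 0)) :=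
      AddSubgroup.subset_closure ⟨0, by simp⟩
    obtain ⟨m, rfl⟩ := ZMod.intCast_surjective a
    have := AddSubgroup.zsmul_mem _ m4 m
    rwa [zsmul_one] at this

theorem gp_exists (p : ℕ) [hp : Fact p.Prime] : ∃ g, Univ p g := by
  by_cases h5 : 5 ≤ p
  · exact gp_big h5
  have h2 := hp.out.two_le
  by_cases e2 : p = 2
  · exact gp_two p e2
  by_cases e3 : p = 3
  · exact gp_three p e3
  have : p = 4 := by omega
  exact absurd hp.out (by rw [this]; norm_num)

def gpr (p : Nat.Primes) : ZMod p → ZMod (oddPart ((p : ℕ) + 1)) :=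
  have : Fact (p : ℕ).Prime := ⟨p.2⟩
  (gp_exists (p : ℕ)).choose

theorem gpr_univ (p : Nat.Primes) : @Univ (p : ℕ) ⟨p.2⟩ (gpr p) :=
  have : Fact (p : ℕ).Prime := ⟨p.2⟩
  (gp_exists (p : ℕ)).choose_spec
end small

section univ

abbrev MQ : Type := RP' ℚ
abbrev RQ : Type := RF ℚ

theorem cls_mul (a b : ℚˣ) : cls ℚ (a * b) = cls ℚ a * cls ℚ b := by
  unfold cls; rw [map_mul, map_mul]
theorem cls_one : cls ℚ 1 = 1 := by
  unfold cls; rw [map_one, map_one]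
theorem sqc_sq (a : ℚˣ) : sqc ℚ (a * a) = 1 := by
  exact (QuotientGroup.eq_one_iff (N := (powMonoidHom 2 : ℚˣ →* ℚˣ).range) (a * a)).2 ⟨a, by simp [powMonoidHom, pow_two]⟩
theorem cls_sq (a : ℚˣ) : cls ℚ a * cls ℚ a = 1 := by
  rw [← cls_mul]; unfold cls; rw [sqc_sq, map_one]

theorem rp_one : rp ℚ 1 = 0 := by
  unfold rp; exact (Submodule.Quotient.mk_eq_zero _).2 (Submodule.subset_span (by simp))
theorem rp_neg (x : ℚˣ) : cls ℚ (-1) • rp ℚ x = rp ℚ x := by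
  have : (Submodule.Quotient.mk (cls ℚ (-1) • gen ℚ x - gen ℚ x) : MQ) = 0 :=
    (Submodule.Quotient.mk_eq_zero _).2 (Submodule.subset_span (Or.inl (Or.inr ⟨x, rfl⟩)))
  exact sub_eq_zero.1 this
theorem rp_inv (x : ℚˣ) : rp ℚ x⁻¹ = - rp ℚ x := by
  have : (Submodule.Quotient.mk (gen ℚ x⁻¹ + gen ℚ x) : MQ) = 0 :=
    (Submodule.Quotient.mk_eq_zero _).2 (Submodule.subset_span (Or.inr ⟨x, rfl⟩))
  exact eq_neg_of_add_eq_zero_left this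
theorem rp_ft (x y : ℚˣ) (hx : (x : ℚ) ≠ 1) (hy : (y : ℚ) ≠ 1) :
    rp ℚ x - rp ℚ y + cls ℚ x • rp ℚ (y * x⁻¹)
    - cls ℚ (U ℚ ((x : ℚ)⁻¹ - 1) (inv_sub_one_ne hx)) •
        rp ℚ (U ℚ ((1 - (x : ℚ)⁻¹) / (1 - (y : ℚ)⁻¹))
          (div_ne_zero (one_sub_inv_ne hx) (one_sub_inv_ne hy)))
    + cls ℚ (U ℚ (1 - (x : ℚ)) (one_sub_ne hx)) •
        rp ℚ (U ℚ ((1 - (x : ℚ)) / (1 - (y : ℚ)))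
          (div_ne_zero (one_sub_ne hx) (one_sub_ne hy))) = 0 := by
  have : (Submodule.Quotient.mk (FT ℚ x y hx hy) : MQ) = 0 :=
    (Submodule.Quotient.mk_eq_zero _).2 (Submodule.subset_span (Or.inl (Or.inl (Or.inr ⟨x, y, hx, hy, rfl⟩))))
  exact this

theorem MQ_ext {A : Type*} [AddCommGroup A] {F G : MQ →+ A}
    (h : ∀ a x, F (cls ℚ a • rp ℚ x) = G (cls ℚ a • rp ℚ x)) : F = G := by
  let Q : FreeRP ℚ →+ MQ := (Submodule.mkQ (Submodule.span (RF ℚ)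
    ({gen ℚ 1} ∪ ftRels ℚ ∪ minusRels ℚ ∪ invRels ℚ))).toAddMonoidHom
  have hQ : Function.Surjective Q := Submodule.mkQ_surjective _
  have hs : ∀ a x, Q (Finsupp.single x (MonoidAlgebra.single (sqc ℚ a) 1)) = cls ℚ a • rp ℚ x := by
    intro a x
    have : Finsupp.single x (MonoidAlgebra.single (sqc ℚ a) 1) = cls ℚ a • gen ℚ x := by
      unfold gen cls; rw [Finsupp.smul_single, smul_eq_mul, mul_one]; rfl
    rw [this]; rfl
  have : F.comp Q = G.comp Q := by
    apply Finsupp.addHom_ext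
    intro x r
    have key : (F.comp Q).comp (Finsupp.singleAddHom x) = (G.comp Q).comp (Finsupp.singleAddHom x) := by
      apply MonoidAlgebra.addMonoidHom_ext
      intro g n
      obtain ⟨a, rfl⟩ := QuotientGroup.mk'_surjective _ g
      have e : (MonoidAlgebra.single (sqc ℚ a) n : RQ) = n • MonoidAlgebra.single (sqc ℚ a) 1 := by
        simp_all
      change _ = _
      have := h a x
      rw [← hs] at this
      change (F.comp Q) (Finsupp.singleAddHom x (MonoidAlgebra.single (sqc ℚ a) n)) =
        (G.comp Q) (Finsupp.singleAddHom x (MonoidAlgebra.single (sqc ℚ a) n))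
      rw [e, map_zsmul, map_zsmul, map_zsmul]
      congr 1
    exact DFunLike.congr_fun key r
  ext m
  obtain ⟨v, rfl⟩ := hQ m
  exact DFunLike.congr_fun this v

theorem exists_hom {A : Type*} [AddCommGroup A] {χ : ℚ → ℤ} {f : ℚ → A} (hχ : Chi χ) (q : QD χ f) :
    ∃ F : MQ →+ A, (∀ x : ℚˣ, F (rp ℚ x) = f x) ∧ (∀ (a : ℚˣ) m, F (cls ℚ a • m) = χ a • F m) ∧
      ∀ (r : RQ) m, F m = 0 → F (r • m) = 0 := by
  let φ : ℚˣ →* ℤ := ⟨⟨fun x => χ x, by simpa using hχ.one⟩, fun x y => by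
    simpa using hχ.mul x y x.ne_zero y.ne_zero⟩
  let ψ : SqCl ℚ →* ℤ := QuotientGroup.lift _ φ (by
    rintro _ ⟨a, rfl⟩
    change χ ((a ^ 2 : ℚˣ) : ℚ) = 1
    rw [pow_two, Units.val_mul, hχ.mul _ _ a.ne_zero a.ne_zero, hχ.sq a.ne_zero])
  let ρ : RQ →+* ℤ := (MonoidAlgebra.lift ℤ ℤ (SqCl ℚ) ψ).toRingHom
  have hρ : ∀ a, ρ (cls ℚ a) = χ a := by
    intro a
    change MonoidAlgebra.lift ℤ ℤ (SqCl ℚ) ψ (MonoidAlgebra.of ℤ _ (sqc ℚ a)) = _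
    rw [MonoidAlgebra.lift_of]; rfl
  letI : Module RQ A := Module.compHom A ρ
  have hsm : ∀ (a : ℚˣ) (z : A), cls ℚ a • z = χ a • z := by
    intro a z
    change ρ (cls ℚ a) • z = _
    rw [hρ]
  let G : FreeRP ℚ →ₗ[RQ] A := Finsupp.linearCombination RQ (fun x : ℚˣ => f x)
  have hG : ∀ x, G (gen ℚ x) = f x := by
    intro x; unfold gen; simp [G]
  have hle : Submodule.span (RF ℚ) ({gen ℚ 1} ∪ ftRels ℚ ∪ minusRels ℚ ∪ invRels ℚ) ≤ LinearMap.ker G := by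
    rw [Submodule.span_le]
    rintro v (((hv | hv) | hv) | hv)
    · rw [hv]; simp only [SetLike.mem_coe, LinearMap.mem_ker]; rw [hG]; simpa using q.one
    · obtain ⟨x, y, hx, hy, rfl⟩ := hv
      simp only [SetLike.mem_coe, LinearMap.mem_ker]
      unfold FT
      rw [map_add, map_sub, map_add, map_sub, map_smul, map_smul, map_smul, hG, hG, hG, hG, hG, hsm, hsm, hsm]
      have x0 := x.ne_zero
      have y0 := y.ne_zero
      have := q.ft x y x0 hx y0 hy
      have a1 := one_sub_ne hx
      have a2 := one_sub_ne hy
      rw [← this]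
      have e1 : χ ((U ℚ ((x : ℚ)⁻¹ - 1) (inv_sub_one_ne hx) : ℚˣ) : ℚ) = χ x * χ (1 - x) := by
        change χ ((x : ℚ)⁻¹ - 1) = _
        rw [show (x : ℚ)⁻¹ - 1 = (1 - x) / x by field_simp, hχ.div a1 x0, mul_comm]
      have e2 : ((U ℚ ((1 - (x : ℚ)⁻¹) / (1 - (y : ℚ)⁻¹))
          (div_ne_zero (one_sub_inv_ne hx) (one_sub_inv_ne hy)) : ℚˣ) : ℚ) = y * (1 - x) / (x * (1 - y)) := by
        change (1 - (x : ℚ)⁻¹) / (1 - (y : ℚ)⁻¹) = _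
        have b2 := one_sub_inv_ne hy
        field_simp
        ring
      rw [e1, e2, Units.val_mul, Units.val_inv_eq_inv_val, ← div_eq_mul_inv]
      rfl
    · obtain ⟨x, rfl⟩ := hv
      simp only [SetLike.mem_coe, LinearMap.mem_ker]
      rw [map_sub, map_smul, hG, hsm, Units.val_neg, Units.val_one, hχ.neg, one_smul, sub_self]
    · obtain ⟨x, rfl⟩ := hv
      simp only [SetLike.mem_coe, LinearMap.mem_ker]
      rw [map_add, hG, hG, Units.val_inv_eq_inv_val, q.inv _ x.ne_zero, neg_add_cancel]
  let F : MQ →ₗ[RQ] A := Submodule.liftQ _ G hle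
  refine ⟨F.toAddMonoidHom, fun x => ?_, fun a m => ?_, fun r m h => ?_⟩
  · exact hG x
  · rw [← hsm]; exact F.map_smul _ _
  · exact (F.map_smul r m).trans ((congrArg (r • ·) h).trans (smul_zero r))

theorem zorn_char (N0 : Submodule RQ MQ) (m : MQ) (hm : ∀ k : ℕ, (2 ^ k) • m ∉ N0) :
    ∃ (N : Submodule RQ MQ) (χ : ℚ → ℤ), N0 ≤ N ∧ Chi χ ∧ (∀ (a : ℚˣ) x, cls ℚ a • x - χ a • x ∈ N) ∧
      TF2 (MQ ⧸ N) ∧ ∀ k : ℕ, (2 ^ k) • m ∉ N := by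
  obtain ⟨N, hN0, hmax⟩ := zorn_le_nonempty₀ {N : Submodule RQ MQ | ∀ k : ℕ, (2 ^ k) • m ∉ N} (by
    intro c hc hch y hy
    refine ⟨sSup c, ?_, fun z hz => le_sSup hz⟩
    intro k hk
    rw [Submodule.mem_sSup_of_directed ⟨y, hy⟩ hch.directedOn] at hk
    obtain ⟨z, hz, hkz⟩ := hk
    exact hc hz k hkz) N0 hm
  have hN : ∀ k : ℕ, (2 ^ k) • m ∉ N := hmax.prop
  have big : ∀ N' : Submodule RQ MQ, N ≤ N' → ¬ (N' ≤ N) → ∃ k : ℕ, (2 ^ k) • m ∈ N' := by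
    intro N' h1 h2
    by_contra! hcon
    exact h2 (hmax.le_of_ge hcon h1)
  have tfN : ∀ x : MQ, x + x ∈ N → x ∈ N := by
    intro x hx
    by_contra hxN
    obtain ⟨k, hk⟩ := big (N ⊔ Submodule.span RQ {x}) le_sup_left (fun hle => hxN (hle (Submodule.mem_sup_right (Submodule.mem_span_singleton_self x))))
    obtain ⟨n, hn, z, hz, e⟩ := Submodule.mem_sup.1 hk
    obtain ⟨r, rfl⟩ := Submodule.mem_span_singleton.1 hz
    apply hN (k + 1)
    rw [pow_succ', mul_smul, ← e, two_nsmul, show n + r • x + (n + r • x) = n + n + r • (x + x) by rw [smul_add]; abel]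
    exact N.add_mem (N.add_mem hn hn) (N.smul_mem _ hx)
  have tf : TF2 (MQ ⧸ N) := by
    intro x hx
    obtain ⟨x, rfl⟩ := Submodule.Quotient.mk_surjective _ x
    rw [Submodule.Quotient.mk_eq_zero]
    apply tfN
    rw [← Submodule.Quotient.mk_eq_zero N]
    exact hx
  have step : ∀ c d : RQ, d * c = 0 → (∃ x : MQ, c • x ∉ N) → ∃ k : ℕ, d • ((2 ^ k) • m) ∈ N := by
    intro c d hdc ⟨x, hx⟩
    obtain ⟨k, hk⟩ := big (N ⊔ LinearMap.range (LinearMap.lsmul RQ MQ c)) le_sup_left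
      (fun hle => hx (hle (Submodule.mem_sup_right ⟨x, rfl⟩)))
    obtain ⟨n, hn, z, hz, e⟩ := Submodule.mem_sup.1 hk
    obtain ⟨u, rfl⟩ := hz
    refine ⟨k, ?_⟩
    rw [← e, smul_add, LinearMap.lsmul_apply, smul_smul, hdc, zero_smul, add_zero]
    exact N.smul_mem _ hn
  have dich : ∀ a : ℚˣ, (∀ x, cls ℚ a • x - x ∈ N) ∨ (∀ x, cls ℚ a • x + x ∈ N) := by
    intro a
    by_contra! hcon
    obtain ⟨⟨x, hx⟩, ⟨y, hy⟩⟩ := hcon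
    have sq := cls_sq a
    obtain ⟨k, hk⟩ := step (cls ℚ a - 1) (cls ℚ a + 1) (by linear_combination sq) ⟨x, by rwa [sub_smul, one_smul]⟩
    obtain ⟨l, hl⟩ := step (cls ℚ a + 1) (cls ℚ a - 1) (by linear_combination sq) ⟨y, by rwa [add_smul, one_smul]⟩
    apply hN (k + l + 1)
    have h1 := N.nsmul_mem hk (2 ^ l)
    have h2 := N.nsmul_mem hl (2 ^ k)
    have h3 := N.sub_mem h1 h2
    convert h3 using 1
    rw [smul_comm (2 ^ l) (cls ℚ a + 1), smul_comm (2 ^ k) (cls ℚ a - 1), smul_smul, smul_smul, ← pow_add, ← pow_add, add_comm l k,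
      pow_succ', mul_smul, two_nsmul, add_smul, sub_smul, one_smul]
    abel
  have nb : ∀ a : ℚˣ, ¬ ((∀ x, cls ℚ a • x - x ∈ N) ∧ (∀ x, cls ℚ a • x + x ∈ N)) := by
    rintro a ⟨h1, h2⟩
    apply hN 0
    rw [pow_zero, one_smul]
    apply tfN
    have := N.sub_mem (h2 m) (h1 m)
    convert this using 1
    abel
  let χ : ℚ → ℤ := fun a => if h : a ≠ 0 then (if ∀ x, cls ℚ (Units.mk0 a h) • x - x ∈ N then 1 else -1) else 1
  have hχu : ∀ a : ℚˣ, χ a = if ∀ x, cls ℚ a • x - x ∈ N then 1 else -1 := by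
    intro a
    simp only [χ]
    rw [dif_pos a.ne_zero, Units.mk0_val]
  have act : ∀ (a : ℚˣ) x, cls ℚ a • x - χ a • x ∈ N := by
    intro a x
    rw [hχu]
    split_ifs with h
    · rw [one_smul]; exact h x
    · have := (dich a).resolve_left h x
      rw [neg_smul, one_smul, sub_neg_eq_add]; exact this
  have pm : ∀ a : ℚˣ, χ a = 1 ∨ χ a = -1 := by
    grind
  have uniq : ∀ (a : ℚˣ) (s : ℤ), (s = 1 ∨ s = -1) → (∀ x, cls ℚ a • x - s • x ∈ N) → χ a = s := by
    intro a s hs h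
    rw [hχu]
    rcases hs with rfl | rfl
    · simp only [one_smul] at h; rw [if_pos h]
    · rw [if_neg]; intro h1
      apply nb a ⟨h1, fun x => by simpa using h x⟩
  refine ⟨N, χ, hN0, ⟨?_, ?_, ?_⟩, act, tf, hN⟩
  · intro x y hx hy
    have := uniq (Units.mk0 x hx * Units.mk0 y hy) (χ x * χ y) (by
      rcases pm (Units.mk0 x hx) with h1 | h1 <;> rcases pm (Units.mk0 y hy) with h2 | h2 <;>
        simp only [Units.val_mk0] at h1 h2 <;> rw [h1, h2] <;> simp) (by
      intro z
      have h1 := act (Units.mk0 x hx) (cls ℚ (Units.mk0 y hy) • z)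
      have h2 := zsmul_mem (act (Units.mk0 y hy) z) (χ x)
      have := N.add_mem h1 h2
      simp only [Units.val_mk0] at this
      rw [cls_mul, mul_smul, mul_smul]
      convert this using 1
      rw [smul_sub]; abel)
    simpa using this
  · grind
  · have := uniq (-1) 1 (Or.inl rfl) (by
      have e : DistribSMul.toAddMonoidHom MQ (cls ℚ (-1)) = AddMonoidHom.id MQ := by
        apply MQ_ext
        intro a x
        change cls ℚ (-1) • cls ℚ a • rp ℚ x = cls ℚ a • rp ℚ x
        rw [smul_smul, mul_comm, ← smul_smul, rp_neg]
      intro x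
      have := DFunLike.congr_fun e x
      change cls ℚ (-1) • x = x at this
      rw [one_smul, this, sub_self]; exact N.zero_mem)
    simpa using this
end univ

section det

theorem QD.map {k : Type*} [Field k] {A B : Type*} [AddCommGroup A] [AddCommGroup B] {χ : k → ℤ} {f : k → A}
    (q : QD χ f) (φ : A →+ B) : QD χ (fun x => φ (f x)) := by
  refine ⟨by rw [q.one, map_zero], fun x hx => by rw [q.inv x hx, map_neg], fun x y hx hx1 hy hy1 => ?_⟩
  have := congrArg φ (q.ft x y hx hx1 hy hy1)
  rw [map_add, map_sub, map_add, map_sub, map_zsmul, map_zsmul, map_zsmul, map_zero] at this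
  exact this

theorem QD.congr {A : Type*} [AddCommGroup A] {χ ψ : ℚ → ℤ} {f : ℚ → A}
    (q : QD χ f) (h : ∀ x, x ≠ 0 → χ x = ψ x) : QD ψ f := by
  refine ⟨q.one, q.inv, fun x y hx hx1 hy hy1 => ?_⟩
  rw [← h x hx, ← h (1 - x) (sub_ne_zero.2 (Ne.symm hx1))]
  exact q.ft x y hx hx1 hy hy1

/-- the function attached to a homomorphism -/
def fof {A : Type*} [AddCommGroup A] (π : MQ →+ A) (x : ℚ) : A :=
  if h : x ≠ 0 then π (rp ℚ (Units.mk0 x h)) else 0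

theorem fof_apply {A : Type*} [AddCommGroup A] (π : MQ →+ A) (x : ℚˣ) : fof π x = π (rp ℚ x) := by
  unfold fof; rw [dif_pos x.ne_zero, Units.mk0_val]

theorem fof_qd {A : Type*} [AddCommGroup A] {χ : ℚ → ℤ} (hχ : Chi χ) (π : MQ →+ A)
    (act : ∀ (a : ℚˣ) x, π (cls ℚ a • x) = χ a • π x) : QD χ (fof π) := by
  refine ⟨?_, ?_, ?_⟩
  · have := fof_apply π 1
    rwa [Units.val_one, rp_one, map_zero] at this
  · intro x hx
    have h1 := fof_apply π (Units.mk0 x hx)⁻¹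
    have h2 := fof_apply π (Units.mk0 x hx)
    rw [rp_inv, map_neg, ← h2] at h1
    simpa using h1
  · intro x y hx hx1 hy hy1
    have a1 : 1 - x ≠ 0 := sub_ne_zero.2 (Ne.symm hx1)
    have a2 : 1 - y ≠ 0 := sub_ne_zero.2 (Ne.symm hy1)
    have := congrArg π (rp_ft (Units.mk0 x hx) (Units.mk0 y hy) hx1 hy1)
    rw [map_add, map_sub, map_add, map_sub, map_zero, act, act, act, ← fof_apply, ← fof_apply, ← fof_apply,
      ← fof_apply, ← fof_apply] at this
    rw [← this]
    have e1 : χ ((U ℚ (((Units.mk0 x hx : ℚˣ) : ℚ)⁻¹ - 1) (inv_sub_one_ne (x := Units.mk0 x hx) hx1) : ℚˣ) : ℚ) = χ x * χ (1 - x) := by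
      change χ (x⁻¹ - 1) = _
      rw [show x⁻¹ - 1 = (1 - x) / x by field_simp, hχ.div a1 hx, mul_comm]
    have b2 : 1 - y⁻¹ ≠ 0 := one_sub_inv_ne (x := Units.mk0 y hy) hy1
    have e2 : y * (1 - x) / (x * (1 - y)) = (1 - x⁻¹) / (1 - y⁻¹) := by
      field_simp
      ring
    rw [e1, e2, Units.val_mul, Units.val_inv_eq_inv_val, div_eq_mul_inv y x]
    rfl

theorem factor {A B : Type*} [AddCommGroup A] [AddCommGroup B] {χ : ℚ → ℤ} {π : MQ →+ A} {F : MQ →+ B}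
    (h1 : ∀ (a : ℚˣ) x, π (cls ℚ a • x) = χ a • π x) (h2 : ∀ (a : ℚˣ) x, F (cls ℚ a • x) = χ a • F x)
    (φ : B →+ A) (h : ∀ x : ℚˣ, π (rp ℚ x) = φ (F (rp ℚ x))) (m : MQ) : π m = φ (F m) := by
  have : π = φ.comp F := by
    apply MQ_ext
    intro a x
    rw [AddMonoidHom.comp_apply, h1, h2, map_zsmul, h]
  exact DFunLike.congr_fun this m

theorem div_embed {A : Type} [AddCommGroup A] (tf : TF2 A) :
    ∃ (B : Type) (_ : AddCommGroup B) (j : A →+ B), Function.Injective j ∧ TF2 B ∧ Divb B := by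
  let D := CharacterModule A → AddCircle (1 : ℚ)
  let T : AddSubgroup D :=
    { carrier := {d | ∃ k : ℕ, (2 ^ k) • d = 0}
      zero_mem' := ⟨0, by simp⟩
      neg_mem' := by rintro d ⟨k, hk⟩; exact ⟨k, by rw [smul_neg, hk, neg_zero]⟩
      add_mem' := by
        rintro d e ⟨k, hk⟩ ⟨l, hl⟩
        refine ⟨k + l, ?_⟩
        rw [smul_add, pow_add, mul_smul (2 ^ k) (2 ^ l) e, hl, mul_comm, mul_smul, hk, smul_zero, smul_zero, add_zero] }
  let i : A →+ D := ⟨⟨fun a c => c a, by ext c; exact map_zero c⟩, fun a b => by ext c; exact map_add c a b⟩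
  refine ⟨D ⧸ T, inferInstance, (QuotientAddGroup.mk' T).comp i, ?_, ?_, ?_⟩
  · rw [injective_iff_map_eq_zero]
    intro a ha
    obtain ⟨k, hk⟩ := (QuotientAddGroup.eq_zero_iff (i a)).1 ha
    apply tf.pow k
    by_contra hne
    obtain ⟨c, hc⟩ := CharacterModule.exists_character_apply_ne_zero_of_ne_zero hne
    apply hc
    rw [map_nsmul]
    exact congrFun hk c
  · intro x hx
    obtain ⟨d, rfl⟩ := QuotientAddGroup.mk_surjective x
    obtain ⟨k, hk⟩ := (QuotientAddGroup.eq_zero_iff (d + d)).1 hx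
    refine (QuotientAddGroup.eq_zero_iff d).2 ⟨k + 1, ?_⟩
    rw [pow_succ, mul_smul, two_nsmul, hk]
  · intro n hn x
    obtain ⟨d, rfl⟩ := QuotientAddGroup.mk_surjective x
    have : ∀ c, ∃ e : AddCircle (1 : ℚ), n • e = d c := by
      intro c
      refine ⟨DivisibleBy.div (d c) (n : ℤ), ?_⟩
      rw [← natCast_zsmul]
      exact DivisibleBy.div_cancel (d c) (by exact_mod_cast hn)
    choose e he using this
    refine ⟨QuotientAddGroup.mk e, ?_⟩
    rw [← QuotientAddGroup.mk_nsmul]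
    congr 1
    ext c
    exact he c

theorem fin_supp (m : MQ) : ∃ N : ℕ, ∀ (B : Type) [AddCommGroup B] (P : MQ →+ B),
    (∀ (a : ℚˣ) x, P (cls ℚ a • x) = P x) → (∀ x : ℚˣ, |(x : ℚ).num| ≤ N → (x : ℚ).den ≤ N → P (rp ℚ x) = 0) →
    P m = 0 := by
  let H : AddSubgroup MQ :=
    { carrier := {m | ∃ N : ℕ, ∀ (B : Type) [AddCommGroup B] (P : MQ →+ B),
        (∀ (a : ℚˣ) x, P (cls ℚ a • x) = P x) → (∀ x : ℚˣ, |(x : ℚ).num| ≤ N → (x : ℚ).den ≤ N → P (rp ℚ x) = 0) →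
        P m = 0}
      zero_mem' := ⟨0, fun B _ P _ _ => map_zero P⟩
      neg_mem' := by
        rintro d ⟨k, hk⟩
        exact ⟨k, fun B _ P h1 h2 => by rw [map_neg, hk B P h1 h2, neg_zero]⟩
      add_mem' := by
        rintro d e ⟨k, hk⟩ ⟨l, hl⟩
        refine ⟨k + l, fun B _ P h1 h2 => ?_⟩
        rw [map_add, hk B P h1 (fun x hx hx' => h2 x (by push_cast; linarith) (by omega)),
          hl B P h1 (fun x hx hx' => h2 x (by push_cast; linarith) (by omega)), add_zero] }
  change m ∈ H
  have : QuotientAddGroup.mk' H = 0 := by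
    apply MQ_ext
    intro a x
    refine (QuotientAddGroup.eq_zero_iff _).2 ⟨(x : ℚ).num.natAbs + (x : ℚ).den, fun B _ P h1 h2 => ?_⟩
    rw [h1]
    apply h2
    · push_cast; linarith [(x : ℚ).den.cast_nonneg (α := ℤ)]
    · omega
  exact (QuotientAddGroup.eq_zero_iff m).1 (DFunLike.congr_fun this m)

theorem gd3 : GD (fun a : ZMod 2 => if a = 0 then (1 : ZMod 3) else 0) := by
  refine ⟨⟨by simp, ?_, ?_⟩, ?_, by decide⟩
  · intro x hx; rcases z2_aux x with rfl | rfl <;> simp at hx ⊢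
  · intro x y hx hx1; rcases z2_aux x with rfl | rfl <;> simp at hx hx1
  · intro a; rcases z2_aux a with rfl | rfl <;> simp

def f3 : ℚ → ZMod 3 := lft (p := 2) (fun a : ZMod 2 => if a = 0 then (1 : ZMod 3) else 0)
theorem f3_qd : QD (fun _ : ℚ => 1) f3 := GD.lift_one gd3
theorem f3_two : f3 2 = 1 := by
  unfold f3
  rw [lft_res (a := 0) (by have := res_p (p := 2); exact_mod_cast this), if_pos rfl]

theorem A_finish {B : Type} [AddCommGroup B] (tf : TF2 B) (dv : Divb B) (π : MQ →+ B)
    (act : ∀ (a : ℚˣ) x, π (cls ℚ a • x) = π x)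
    (F3 : MQ →+ ZMod 3) (h3 : ∀ x : ℚˣ, F3 (rp ℚ x) = f3 x) (a3 : ∀ (a : ℚˣ) x, F3 (cls ℚ a • x) = F3 x)
    (Λ : MQ →+ LL) (hl : ∀ x : ℚˣ, Λ (rp ℚ x) = lam x) (al : ∀ (a : ℚˣ) x, Λ (cls ℚ a • x) = Λ x)
    (m : MQ) (m3 : F3 m = 0) (ml : Λ m = 0) : π m = 0 := by
  have q : QD (fun _ : ℚ => 1) (fof π) := fof_qd one_chi π (fun a x => by rw [act, one_smul])
  have k2 : (2 : ℚ) ≠ 0 := two_ne_zero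
  have h3c := q.three tf k2
  have h3' : ((3 : ℕ) : ℤ) • fof π 2 = 0 := by
    grind
  let ψ : ZMod 3 →+ B := ZMod.lift 3 ⟨zmultiplesHom B (fof π 2), by rw [zmultiplesHom_apply]; exact h3'⟩
  have hψ : ψ 1 = fof π 2 := by
    have := ZMod.lift_coe 3 (A := B) ⟨zmultiplesHom B (fof π 2), by rw [zmultiplesHom_apply]; exact h3'⟩ 1
    simp only [Int.cast_one, zmultiplesHom_apply, one_smul] at this
    exact this
  have q' := f3_qd.map ψ
  let f' : ℚ → B := fun x => if x = 0 then 0 else fof π x - ψ (f3 x)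
  have hf' : ∀ x, x ≠ 0 → f' x = fof π x - ψ (f3 x) := fun x hx => if_neg hx
  have f0 : f' 0 = 0 := if_pos rfl
  have f1 : f' 1 = 0 := by rw [hf' 1 one_ne_zero, q.one, q'.one, sub_zero]
  have alt : Alt f' := by
    refine ⟨f0, f1, ?_, ?_, ?_⟩
    · intro x
      by_cases hx : x = 0
      · rw [hx, inv_zero, f0, neg_zero]
      rw [hf' x hx, hf' _ (inv_ne_zero hx), q.inv x hx, q'.inv x hx]; abel
    · intro x
      by_cases hx : x = 0
      · rw [hx, sub_zero, f0, f1, neg_zero]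
      by_cases hx1 : x = 1
      · rw [hx1, sub_self, f0, f1, neg_zero]
      have a1 : 1 - x ≠ 0 := sub_ne_zero.2 (Ne.symm hx1)
      have r1 := q.refl tf k2 hx hx1
      have r2 := q'.refl tf k2 hx hx1
      simp only [f3_two, hψ] at r2
      rw [hf' x hx, hf' _ a1]
      linear_combination (norm := module) r1 - r2
    · intro x y hx hx1 hy hy1
      have a1 : 1 - x ≠ 0 := sub_ne_zero.2 (Ne.symm hx1)
      have a2 : 1 - y ≠ 0 := sub_ne_zero.2 (Ne.symm hy1)
      have r1 := q.ft x y hx hx1 hy hy1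
      have r2 := q'.ft x y hx hx1 hy hy1
      rw [hf' x hx, hf' y hy, hf' _ (div_ne_zero hy hx), hf' _ (div_ne_zero (mul_ne_zero hy a1) (mul_ne_zero hx a2)),
        hf' _ (div_ne_zero a1 a2)]
      simp only [mul_one, one_smul] at r1 r2
      linear_combination (norm := module) r1 - r2
  obtain ⟨N, hN⟩ := fin_supp m
  obtain ⟨b, hb⟩ := alt.main tf dv (2 * N)
  have := hN B (π - ψ.comp F3 + b.comp Λ) (fun a x => by
    simp only [AddMonoidHom.add_apply, AddMonoidHom.sub_apply, AddMonoidHom.comp_apply, act, a3, al]) (by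
    intro x h1 h2
    simp only [AddMonoidHom.add_apply, AddMonoidHom.sub_apply, AddMonoidHom.comp_apply]
    rw [h3, hl, ← fof_apply, ← hf' x x.ne_zero]
    rw [abs_le] at h1
    have h2' : ((x : ℚ).den : ℤ) ≤ N := by exact_mod_cast h2
    have := hb (-(x : ℚ).num) 1 (x : ℚ).den 1 ((x : ℚ).num - (x : ℚ).den) 1
      (by rw [abs_neg, abs_le]; push_cast; constructor <;> linarith [h1.1, h1.2])
      (by rw [abs_one]; push_cast; linarith)
      (by rw [abs_le]; push_cast; constructor <;> linarith) (by rw [abs_one]; push_cast; linarith)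
      (by rw [abs_le]; push_cast; constructor <;> linarith [h1.1, h1.2]) (by rw [abs_one]; push_cast; linarith)
      (by ring)
    have e : -(((-(x : ℚ).num : ℤ) : ℚ) * ((1 : ℤ) : ℚ)) / ((((x : ℚ).den : ℤ) : ℚ) * ((1 : ℤ) : ℚ)) = x := by
      push_cast
      rw [mul_one, mul_one, neg_neg]
      exact Rat.num_div_den _
    rw [e] at this
    exact this)
  simp only [AddMonoidHom.add_apply, AddMonoidHom.sub_apply, AddMonoidHom.comp_apply, m3, ml, map_zero] at this
  simpa using this
end det

section homs

theorem lam_qd : QD (fun _ : ℚ => 1) lam :=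
  ⟨lam_alt.one, fun x _ => lam_alt.inv x, fun x y hx hx1 hy hy1 => by
    simpa using lam_alt.ft x y hx hx1 hy hy1⟩

/-- a package of the three kinds of homomorphisms -/
structure Pack where
  F : ∀ p : Nat.Primes, MQ →+ ZMod (oddPart ((p : ℕ) + 1))
  hF : ∀ p (x : ℚˣ), F p (rp ℚ x) = @lft p ⟨p.2⟩ _ _ (gpr p) x
  aF : ∀ p (a : ℚˣ) m, F p (cls ℚ a • m) = chip p a • F p m
  rF : ∀ p (r : RQ) m, F p m = 0 → F p (r • m) = 0
  F3 : MQ →+ ZMod 3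
  h3 : ∀ x : ℚˣ, F3 (rp ℚ x) = f3 x
  a3 : ∀ (a : ℚˣ) m, F3 (cls ℚ a • m) = F3 m
  Λ : MQ →+ LL
  hl : ∀ x : ℚˣ, Λ (rp ℚ x) = lam x
  al : ∀ (a : ℚˣ) m, Λ (cls ℚ a • m) = Λ m

theorem pack_exists : Nonempty Pack := by
  have H : ∀ p : Nat.Primes, ∃ F : MQ →+ ZMod (oddPart ((p : ℕ) + 1)),
      (∀ x : ℚˣ, F (rp ℚ x) = @lft p ⟨p.2⟩ _ _ (gpr p) x) ∧ (∀ (a : ℚˣ) m, F (cls ℚ a • m) = chip p a • F m) ∧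
      ∀ (r : RQ) m, F m = 0 → F (r • m) = 0 := by
    intro p
    have : Fact (p : ℕ).Prime := ⟨p.2⟩
    exact exists_hom (chip_chi p) (gpr_univ p).1.lift_chip
  choose F h1 h2 h2' using H
  obtain ⟨F3, h3, h4, -⟩ := exists_hom one_chi f3_qd
  obtain ⟨Λ, h5, h6, -⟩ := exists_hom one_chi lam_qd
  exact ⟨⟨F, h1, h2, h2', F3, h3, fun a m => by rw [h4, one_smul], Λ, h5, fun a m => by rw [h6, one_smul]⟩⟩

namespace Pack
variable (P : Pack)

theorem tfp (p : Nat.Primes) : TF2 (ZMod (oddPart ((p : ℕ) + 1))) := by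
  obtain ⟨h, hh⟩ := oddPart_odd (m := (p : ℕ) + 1) (by omega)
  exact ZMod_TF2 hh

theorem triv {N : Submodule RQ MQ} {χ : ℚ → ℤ} (act : ∀ (a : ℚˣ) x, cls ℚ a • x - χ a • x ∈ N)
    (tf : TF2 (MQ ⧸ N)) (hx : ∀ x, x ≠ 0 → χ x = 1) {m : MQ} (m3 : P.F3 m = 0) (ml : P.Λ m = 0) : m ∈ N := by
  obtain ⟨B, _, j, hj, tfB, dv⟩ := div_embed tf
  let π : MQ →+ MQ ⧸ N := N.mkQ.toAddMonoidHom
  have hπ : ∀ (a : ℚˣ) x, π (cls ℚ a • x) = π x := by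
    intro a x
    have := act a x
    rw [hx a a.ne_zero, one_smul] at this
    exact (Submodule.Quotient.eq N).2 this
  have := A_finish tfB dv (j.comp π) (fun a x => by rw [AddMonoidHom.comp_apply, hπ]; rfl)
    P.F3 P.h3 P.a3 P.Λ P.hl P.al m m3 ml
  exact (Submodule.Quotient.mk_eq_zero N).1 ((injective_iff_map_eq_zero j).1 hj _ this)

theorem ker {m : MQ} (hF : ∀ p, P.F p m = 0) (m3 : P.F3 m = 0) (ml : P.Λ m = 0) : ∃ k : ℕ, (2 ^ k) • m = 0 := by
  by_contra! hcon
  obtain ⟨N, χ, -, hχ, act, tf, hN⟩ := zorn_char ⊥ m (fun k hk => hcon k ((Submodule.mem_bot _).1 hk))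
  have hm : m ∉ N := by simpa using hN 0
  let π : MQ →+ MQ ⧸ N := N.mkQ.toAddMonoidHom
  have hπ : ∀ (a : ℚˣ) x, π (cls ℚ a • x) = χ a • π x := by
    intro a x
    rw [← map_zsmul]
    exact (Submodule.Quotient.eq N).2 (act a x)
  have q := fof_qd hχ π hπ
  apply hm
  rcases chi_cases hχ with h | ⟨p, hp, h⟩ | ⟨p, l, hp, hl, hpl, h1, h2, h3⟩
  · exact P.triv act tf h m3 ml
  · obtain ⟨p, rfl⟩ : ∃ p0 : Nat.Primes, (p0 : ℕ) = p := ⟨⟨p, hp⟩, rfl⟩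
    have : Fact (p : ℕ).Prime := ⟨hp⟩
    obtain ⟨g, hg, hfg⟩ := (q.congr h).to_res tf
    obtain ⟨φ, hφ⟩ := (gpr_univ p).2.1 _ tf g hg
    have key := factor (χ := χ) (π := π) (F := P.F p) hπ (fun a x => by rw [P.aF, h a a.ne_zero]) φ (by
      intro x
      rw [← fof_apply, hfg x x.ne_zero, P.hF]
      change lft g (x : ℚ) = φ (lft (gpr p) x)
      rcases Res.or (p := p) (x : ℚ) with ⟨a, ha⟩ | ⟨ha, h0⟩
      · rw [lft_res ha, lft_res ha, hφ]
      · rw [lft_inf h0 ha, lft_inf h0 ha, map_neg, hφ]) m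
    rw [hF, map_zero] at key
    exact (Submodule.Quotient.mk_eq_zero N).1 key
  · have h0 := q.two_primes hχ tf hp hl hpl h1 h2 h3
    have key := factor (χ := χ) (π := π) (F := π) hπ hπ (0 : (MQ ⧸ N) →+ (MQ ⧸ N)) (by
      intro x
      rw [← fof_apply, h0 x x.ne_zero]; rfl) m
    exact (Submodule.Quotient.mk_eq_zero N).1 key

/-- augmentation submodule -/
def JJ : Submodule RQ MQ := Submodule.span RQ {w | ∃ (a : ℚˣ) (y : MQ), w = y - cls ℚ a • y}

theorem kerJ {m : MQ} (m3 : P.F3 m = 0) (ml : P.Λ m = 0) : ∃ k : ℕ, (2 ^ k) • m ∈ JJ := by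
  by_contra! hcon
  obtain ⟨N, χ, hJ, hχ, act, tf, hN⟩ := zorn_char JJ m hcon
  have hm : m ∉ N := by simpa using hN 0
  apply hm
  refine P.triv act tf (fun x hx => (hχ.pm x hx).resolve_right (fun h => ?_)) m3 ml
  apply hN 1
  have h1 := act (Units.mk0 x hx) m
  rw [Units.val_mk0, h] at h1
  have h2 : m - cls ℚ (Units.mk0 x hx) • m ∈ N := hJ (Submodule.subset_span ⟨_, _, rfl⟩)
  have := N.add_mem h1 h2
  convert this using 1
  module

theorem finJ {m : MQ} (hm : m ∈ JJ) : {p | P.F p m ≠ 0}.Finite := by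
  refine Submodule.span_induction ?_ ?_ ?_ ?_ hm
  · rintro _ ⟨a, y, rfl⟩
    have hfin : {n : ℕ | n ∣ ((a : ℚ).num.natAbs * (a : ℚ).den)}.Finite := by
      refine (Set.finite_le_nat ((a : ℚ).num.natAbs * (a : ℚ).den)).subset (fun n hn => Nat.le_of_dvd ?_ hn)
      exact Nat.mul_pos (Int.natAbs_pos.2 (Rat.num_ne_zero.2 a.ne_zero)) (a : ℚ).den_pos
    refine (hfin.preimage (f := fun p : Nat.Primes => (p : ℕ)) Subtype.val_injective.injOn).subset ?_
    intro p hp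
    by_contra hnd
    apply hp
    have hnd' : ¬ ((p : ℕ) ∣ ((a : ℚ).num.natAbs * (a : ℚ).den)) := hnd
    have h1 : ¬ ((p : ℕ) ∣ (a : ℚ).num.natAbs) := fun h => hnd' (h.mul_right _)
    have h2 : ¬ ((p : ℕ) ∣ (a : ℚ).den) := fun h => hnd' (h.mul_left _)
    have : chip p a = 1 := by
      unfold chip
      rw [if_pos]
      rw [padicValRat_def, padicValNat.eq_zero_of_not_dvd h2, padicValInt, padicValNat.eq_zero_of_not_dvd h1]
      simp
    rw [map_sub, P.aF, this, one_smul, sub_self]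
  · simp
  · intro x y _ _ h1 h2
    refine (h1.union h2).subset (fun p hp => ?_)
    by_contra hcon
    simp only [Set.mem_union, Set.mem_ofPred_eq, not_or, not_not] at hcon
    apply hp
    rw [map_add, hcon.1, hcon.2, add_zero]
  · intro r x _ h
    refine h.subset (fun p hp h0 => hp (P.rF p r x h0))

theorem finK {m : MQ} (m3 : P.F3 m = 0) (ml : P.Λ m = 0) : {p | P.F p m ≠ 0}.Finite := by
  obtain ⟨k, hk⟩ := P.kerJ m3 ml
  refine (P.finJ hk).subset (fun p hp h0 => hp ((tfp p).pow k ?_))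
  rw [← map_nsmul]; exact h0

theorem Fsurj (p : Nat.Primes) (z : ZMod (oddPart ((p : ℕ) + 1))) : ∃ y, P.F p y = z := by
  have : Fact (p : ℕ).Prime := ⟨p.2⟩
  have : AddSubgroup.closure (Set.range (gpr p)) ≤ (P.F p).range := by
    rw [AddSubgroup.closure_le]
    rintro _ ⟨a, rfl⟩
    obtain ⟨x, hx0, hx⟩ : ∃ x : ℚ, x ≠ 0 ∧ Res p x a := by
      by_cases ha : a = 0
      · subst ha
        exact ⟨(p : ℕ), by exact_mod_cast p.2.ne_zero, res_p⟩
      · exact ⟨_, (Res.lift a).ne ha, Res.lift a⟩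
    refine ⟨rp ℚ (Units.mk0 x hx0), ?_⟩
    rw [P.hF]
    exact lft_res hx
  rw [(gpr_univ p).2.2] at this
  exact this (AddSubgroup.mem_top z)

theorem tt : ∃ t : MQ, (3 : ℕ) • t = 0 ∧ P.F3 t = 1 ∧ P.Λ t = 0 := by
  let u : ℚˣ := Units.mk0 2 two_ne_zero
  have lm : lam (-1) = 0 := by
    have := lam_alt.inv (-1)
    rw [inv_neg, inv_one] at this
    exact self_eq_neg.1 this
  have l2 : lam 2 = 0 := by
    have := lam_alt.sub (-1)
    rw [lm, neg_zero] at this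
    rw [← this]; norm_num
  obtain ⟨k, hk⟩ := P.ker (m := (3 : ℕ) • rp ℚ u) (by
    intro p
    have : Fact (p : ℕ).Prime := ⟨p.2⟩
    have := (gpr_univ p).1.lift_chip.three (tfp p) two_ne_zero
    rw [map_nsmul, P.hF]
    rw [← this]
    change 3 • lft (gpr p) 2 = _
    module) (by
    rw [map_nsmul]; generalize P.F3 (rp ℚ u) = z; revert z; decide) (by
    rw [map_nsmul, P.hl]; change 3 • lam 2 = 0; rw [l2, smul_zero])
  refine ⟨(4 ^ k) • rp ℚ u, ?_, ?_, ?_⟩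
  · rw [show 4 ^ k = 2 ^ k * 2 ^ k by rw [← mul_pow]; norm_num, mul_smul, smul_comm 3, smul_comm 3, hk, smul_zero]
  · rw [map_nsmul, P.h3]
    change 4 ^ k • f3 2 = 1
    rw [f3_two, nsmul_eq_mul, mul_one]
    push_cast
    rw [show (4 : ZMod 3) = 1 by decide, one_pow]
  · rw [map_nsmul, P.hl]
    change 4 ^ k • lam 2 = 0
    rw [l2, smul_zero]
end Pack
end homs

section free

theorem sub_free (H : AddSubgroup (ℕ →₀ ℤ)) (hinf : ∀ N, ∃ h ∈ H, ∃ n, N ≤ n ∧ h n ≠ 0) :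
    ∃ E : (ℕ →₀ ℤ) →+ (ℕ →₀ ℤ), Function.Injective E ∧ E.range = H := by
  let D : ℕ → AddSubgroup ℤ := fun n =>
    { carrier := {d | ∃ h ∈ H, (∀ i, n < i → h i = 0) ∧ h n = d}
      zero_mem' := ⟨0, H.zero_mem, fun _ _ => rfl, rfl⟩
      neg_mem' := by
        rintro _ ⟨h, h1, h2, rfl⟩
        exact ⟨-h, H.neg_mem h1, fun i hi => by rw [Finsupp.neg_apply, h2 i hi, neg_zero], rfl⟩
      add_mem' := by
        rintro _ _ ⟨h, h1, h2, rfl⟩ ⟨h', h1', h2', rfl⟩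
        exact ⟨h + h', H.add_mem h1 h1', fun i hi => by rw [Finsupp.add_apply, h2 i hi, h2' i hi, add_zero], rfl⟩ }
  have H1 : ∀ n, ∃ h ∈ H, (∀ i, n < i → h i = 0) ∧ ∀ z ∈ D n, ∃ c : ℤ, z = c * h n := by
    intro n
    obtain ⟨d, hd⟩ := Int.subgroup_cyclic (D n)
    have : d ∈ D n := by rw [hd]; exact AddSubgroup.subset_closure rfl
    obtain ⟨h, h1, h2, h3⟩ := this
    refine ⟨h, h1, h2, fun z hz => ?_⟩
    rw [hd] at hz
    obtain ⟨c, hc⟩ := AddSubgroup.mem_closure_singleton.1 hz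
    exact ⟨c, by rw [h3, ← hc, smul_eq_mul]⟩
  choose h hH hz hc using H1
  let S : Set ℕ := {n | h n n ≠ 0}
  have span : ∀ N (v : ℕ →₀ ℤ), v ∈ H → (∀ i, N ≤ i → v i = 0) → v ∈ AddSubgroup.closure (h '' S) := by
    intro N
    induction N with
    | zero =>
      intro v _ hv
      have : v = 0 := by ext i; exact hv i (Nat.zero_le _)
      rw [this]; exact AddSubgroup.zero_mem _
    | succ N ih =>
      intro v hvH hv
      obtain ⟨c, hcN⟩ := hc N (v N) ⟨v, hvH, fun i hi => hv i hi, rfl⟩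
      by_cases hN : h N N = 0
      · grind
      · have h1 := ih (v - c • h N) (H.sub_mem hvH (H.zsmul_mem (hH N) c)) (fun i hi => by
          rw [Finsupp.sub_apply, Finsupp.smul_apply, smul_eq_mul]
          rcases Nat.eq_or_lt_of_le hi with e | e
          · rw [← e, hcN, sub_self]
          · rw [hv i e, hz N i e, mul_zero, sub_zero])
        have h2 := AddSubgroup.zsmul_mem _ (AddSubgroup.subset_closure ⟨N, hN, rfl⟩ : h N ∈ AddSubgroup.closure (h '' S)) c
        have := AddSubgroup.add_mem _ h1 h2
        rwa [sub_add_cancel] at this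
  have span' : ∀ v ∈ H, v ∈ AddSubgroup.closure (h '' S) := by
    intro v hv
    refine span (v.support.sup id + 1) v hv (fun i hi => ?_)
    by_contra hne
    have := Finset.le_sup (f := id) (Finsupp.mem_support_iff.2 hne)
    simp only [id] at this
    omega
  have Sinf : S.Infinite := by
    intro hfin
    obtain ⟨N, hN⟩ := hfin.bddAbove
    obtain ⟨v, hv, n, hn, hvn⟩ := hinf (N + 1)
    apply hvn
    refine AddSubgroup.closure_induction (p := fun v _ => v n = 0) ?_ rfl ?_ ?_ (span' v hv)
    · rintro _ ⟨i, hi, rfl⟩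
      exact hz i n (lt_of_le_of_lt (hN hi) hn)
    · intro x y _ _ hx hy; rw [Finsupp.add_apply, hx, hy, add_zero]
    · intro x _ hx; rw [Finsupp.neg_apply, hx, neg_zero]
  have : Infinite S := Sinf.to_subtype
  let σ := Nat.orderEmbeddingOfSet S
  have hσ : Set.range σ = S := Nat.orderEmbeddingOfSet_range S
  let E : (ℕ →₀ ℤ) →+ (ℕ →₀ ℤ) := Finsupp.liftAddHom (fun n => zmultiplesHom _ (h (σ n)))
  have hE : ∀ v, E v = v.sum (fun n c => c • h (σ n)) := fun v => rfl
  refine ⟨E, ?_, ?_⟩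
  · rw [injective_iff_map_eq_zero]
    intro v hv
    by_contra hne
    have hs : v.support.Nonempty := Finsupp.support_nonempty_iff.2 hne
    have hmem := v.support.max'_mem hs
    set n := v.support.max' hs with hn
    have h1 : (E v) (σ n) = v n * h (σ n) (σ n) := by
      rw [hE, Finsupp.sum, Finsupp.finsetSum_apply, Finset.sum_eq_single n]
      · rfl
      · intro i hi hin
        have : i < n := lt_of_le_of_ne (v.support.le_max' i hi) hin
        rw [Finsupp.smul_apply, hz (σ i) (σ n) (σ.strictMono this), smul_zero]
      · intro h0; exact absurd hmem h0
    rw [hv] at h1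
    have h2 : h (σ n) (σ n) ≠ 0 := by
      have : σ n ∈ S := by rw [← hσ]; exact ⟨n, rfl⟩
      exact this
    exact mul_ne_zero (Finsupp.mem_support_iff.1 hmem) h2 h1.symm
  · apply le_antisymm
    · rintro _ ⟨v, rfl⟩
      rw [hE]
      exact H.sum_mem (fun i _ => H.zsmul_mem (hH _) _)
    · intro v hv
      refine (AddSubgroup.closure_le _).2 ?_ (span' v hv)
      rintro _ ⟨i, hi, rfl⟩
      rw [← hσ] at hi
      obtain ⟨n, rfl⟩ := hi
      refine ⟨Finsupp.single n 1, ?_⟩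
      rw [hE, Finsupp.sum_single_index, one_smul]
      exact zero_smul _ _

theorem Pack.mu (P : Pack) : ∃ μ : MQ →+ (ℕ →₀ ℤ), Function.Surjective μ ∧ ∀ m, μ m = 0 ↔ P.Λ m = 0 := by
  have : Infinite Nat.Primes := inferInstance
  obtain ⟨_⟩ := nonempty_denumerable (Nat.Primes × Nat.Primes)
  let e : (Nat.Primes × Nat.Primes) ≃ ℕ := Denumerable.eqv _
  let L : LL ≃+ (ℕ →₀ ℤ) := Finsupp.domCongr e
  have hL : ∀ v i, L v (e i) = v i := fun v i => by simp [L]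
  let G : MQ →+ (ℕ →₀ ℤ) := L.toAddMonoidHom.comp P.Λ
  obtain ⟨E, hE, hr⟩ := sub_free G.range (by
    intro N
    obtain ⟨p, hp, hpp⟩ := Nat.exists_infinite_primes (((Finset.range N).image (fun n => ((e.symm n).1 : ℕ))).sup id + 3)
    let p' : Nat.Primes := ⟨p, hpp⟩
    have : Fact p.Prime := ⟨hpp⟩
    obtain ⟨q, hq, hqd⟩ := Nat.exists_prime_and_dvd (n := p - 1) (by omega)
    let q' : Nat.Primes := ⟨q, hq⟩
    have : Fact q.Prime := ⟨hq⟩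
    have hp0 : (p : ℚ) ≠ 0 := by exact_mod_cast hpp.ne_zero
    refine ⟨G (rp ℚ (Units.mk0 (p : ℚ) hp0)), ⟨_, rfl⟩, e (p', q'), ?_, ?_⟩
    · by_contra hlt
      push Not at hlt
      have := Finset.le_sup (f := id) (Finset.mem_image.2 ⟨e (p', q'), Finset.mem_range.2 hlt, rfl⟩ :
        ((e.symm (e (p', q'))).1 : ℕ) ∈ (Finset.range N).image (fun n => ((e.symm n).1 : ℕ)))
      rw [Equiv.symm_apply_apply] at this
      simp only [id] at this
      change p ≤ _ at this
      omega
    · change L (P.Λ _) (e (p', q')) ≠ 0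
      rw [hL, P.hl, lam_apply, lamc]
      change padicValRat p (p : ℚ) * padicValRat q (1 - (p : ℚ)) - padicValRat p (1 - (p : ℚ)) * padicValRat q (p : ℚ) ≠ 0
      have hqp : q ≠ p := by
        rintro rfl
        have := Nat.le_of_dvd (by omega) hqd
        omega
      have h1 : (1 - (p : ℚ)) = -((p - 1 : ℕ) : ℚ) := by
        rw [Nat.cast_sub (by omega)]; push_cast; ring
      rw [h1, padicValRat.neg, padicValRat.neg, padicValRat.of_nat, padicValRat.of_nat, padicValRat.of_nat, padicValRat.of_nat,
        padicValNat_self, padicValNat_primes hqp]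
      have := one_le_padicValNat_of_dvd (p := q) (n := p - 1) (by omega) hqd
      push_cast
      rw [mul_zero, sub_zero, one_mul]
      exact_mod_cast (by omega : padicValNat q (p - 1) ≠ 0))
  have hmem : ∀ m, G m ∈ E.range := fun m => by rw [hr]; exact ⟨m, rfl⟩
  choose μ hμ using hmem
  refine ⟨⟨⟨μ, hE (by rw [hμ, map_zero, map_zero])⟩, fun a b => hE (by
    change E (μ (a + b)) = E (μ a + μ b)
    rw [map_add, hμ, hμ, hμ, map_add])⟩, ?_, ?_⟩
  · intro v
    have : E v ∈ G.range := by rw [← hr]; exact ⟨v, rfl⟩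
    obtain ⟨m, hm⟩ := this
    exact ⟨m, hE (by rw [← hm]; exact hμ m)⟩
  · intro m
    change μ m = 0 ↔ _
    rw [← map_eq_zero_iff E hE, hμ]
    exact map_eq_zero_iff L L.injective
end free

section fin

theorem exists_half (p : Nat.Primes) (z : ZMod (oddPart ((p : ℕ) + 1))) : ∃ u, u + u = z := by
  obtain ⟨h, hh⟩ := oddPart_odd (m := (p : ℕ) + 1) (by omega)
  refine ⟨((h : ZMod (oddPart ((p : ℕ) + 1))) + 1) * z, ?_⟩
  have : ((2 * h + 1 : ℕ) : ZMod (oddPart ((p : ℕ) + 1))) = 0 := by rw [← hh, ZMod.natCast_self]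
  push_cast at this
  linear_combination z * this

abbrev DD2 := DirectSum Nat.Primes fun p => ZMod (oddPart ((p : ℕ) + 1))

theorem dd_half (d : DD2) : ∃ u, u + u = d := by
  induction d using DirectSum.induction_on with
  | zero => exact ⟨0, add_zero 0⟩
  | of p z =>
    obtain ⟨u, hu⟩ := exists_half p z
    exact ⟨DirectSum.of _ p u, by rw [← map_add, hu]⟩
  | add x y hx hy =>
    obtain ⟨u, hu⟩ := hx
    obtain ⟨v, hv⟩ := hy
    exact ⟨u + v, by rw [← hu, ← hv]; abel⟩

theorem dd_tf : TF2 DD2 := by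
  intro d hd
  refine DFinsupp.ext (fun p => Pack.tfp p _ ?_)
  exact DFunLike.congr_fun hd p

theorem Pack.theta (P : Pack) : ∃ Ψ : MQ →+ DD2 × ZMod 3 × (ℕ →₀ ℤ),
    (∀ m, Ψ m = 0 → ∃ k : ℕ, (2 ^ k) • m = 0) ∧ ∀ t, ∃ m, Ψ m = t + t := by
  obtain ⟨t, t3, ft, lt⟩ := P.tt
  obtain ⟨μ, hμ, hμ0⟩ := P.mu
  have t3' : ((3 : ℕ) : ℤ) • t = 0 := by rw [natCast_zsmul]; exact t3
  let s3 : ZMod 3 →+ MQ := ZMod.lift 3 ⟨zmultiplesHom MQ t, by rw [zmultiplesHom_apply]; exact t3'⟩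
  have hs3 : ∀ n : ℤ, s3 n = n • t := fun n =>
    ZMod.lift_coe 3 (A := MQ) ⟨zmultiplesHom MQ t, by rw [zmultiplesHom_apply]; exact t3'⟩ n
  have fs3 : ∀ a, P.F3 (s3 a) = a := by
    intro a
    obtain ⟨n, rfl⟩ := ZMod.intCast_surjective a
    rw [hs3, map_zsmul, ft, zsmul_one]
  have ms3 : ∀ a, μ (s3 a) = 0 := by
    intro a
    obtain ⟨n, rfl⟩ := ZMod.intCast_surjective a
    rw [hs3, map_zsmul, (hμ0 t).2 lt, smul_zero]
  choose y hy using fun n : ℕ => hμ (Finsupp.single n 1)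
  let y' : ℕ → MQ := fun n => y n - s3 (P.F3 (y n))
  let sV : (ℕ →₀ ℤ) →+ MQ := Finsupp.liftAddHom (fun n => zmultiplesHom _ (y' n))
  have hsV : ∀ n c, sV (Finsupp.single n c) = c • y' n := fun n c => by simp [sV]
  have fV : ∀ v, P.F3 (sV v) = 0 := by
    intro v
    have : P.F3.comp sV = 0 := by
      apply Finsupp.addHom_ext
      intro n c
      rw [AddMonoidHom.comp_apply, hsV, map_zsmul, map_sub, fs3, sub_self, smul_zero]; rfl
    exact DFunLike.congr_fun this v
  have mV : ∀ v, μ (sV v) = v := by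
    intro v
    have : μ.comp sV = AddMonoidHom.id _ := by
      apply Finsupp.addHom_ext
      intro n c
      rw [AddMonoidHom.comp_apply, hsV, map_zsmul, map_sub, ms3, sub_zero, hy]; simp
    exact DFunLike.congr_fun this v
  let Q : MQ →+ MQ := AddMonoidHom.id MQ - s3.comp P.F3 - sV.comp μ
  have hQ : ∀ m, Q m = m - s3 (P.F3 m) - sV (μ m) := fun m => rfl
  have fQ : ∀ m, P.F3 (Q m) = 0 := fun m => by rw [hQ, map_sub, map_sub, fs3, fV, sub_self, sub_zero]
  have mQ : ∀ m, μ (Q m) = 0 := fun m => by rw [hQ, map_sub, map_sub, ms3, mV, sub_zero, sub_self]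
  have fin : ∀ m, {p | P.F p (Q m) ≠ 0}.Finite := fun m => P.finK (fQ m) ((hμ0 _).1 (mQ m))
  let θ0 : MQ → DD2 := fun m => DFinsupp.mk (fin m).toFinset (fun p => P.F p (Q m))
  have hθ0 : ∀ m p, θ0 m p = P.F p (Q m) := by
    intro m p
    by_cases h : p ∈ (fin m).toFinset
    · exact DFinsupp.mk_of_mem h
    · rw [show θ0 m p = 0 from DFinsupp.mk_of_notMem h]
      rw [Set.Finite.mem_toFinset] at h
      exact (not_not.1 h).symm
  let θ : MQ →+ DD2 := ⟨⟨θ0, DFinsupp.ext (fun p => by rw [hθ0, map_zero, map_zero]; rfl)⟩, fun a b =>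
    DFinsupp.ext (fun p => by
      change θ0 (a + b) p = θ0 a p + θ0 b p
      rw [hθ0, hθ0, hθ0, map_add, map_add])⟩
  have hθ : ∀ m p, θ m p = P.F p (Q m) := hθ0
  have dsurj : ∀ d : DD2, ∃ m, P.F3 m = 0 ∧ μ m = 0 ∧ θ m = d + d := by
    intro d
    induction d using DirectSum.induction_on with
    | zero => exact ⟨0, map_zero _, map_zero _, by rw [map_zero, add_zero]⟩
    | of p z =>
      have : Fact (p : ℕ).Prime := ⟨p.2⟩
      obtain ⟨y, hy⟩ := P.Fsurj p z
      have hp0 : ((p : ℕ) : ℚ) ≠ 0 := by exact_mod_cast p.2.ne_zero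
      let m : MQ := y - cls ℚ (Units.mk0 ((p : ℕ) : ℚ) hp0) • y
      have m3 : P.F3 m = 0 := by rw [map_sub, P.a3, sub_self]
      have ml : μ m = 0 := by rw [hμ0, map_sub, P.al, sub_self]
      refine ⟨m, m3, ml, DFinsupp.ext (fun q => ?_)⟩
      have : Fact (q : ℕ).Prime := ⟨q.2⟩
      rw [hθ, hQ, m3, ml, map_zero, map_zero, sub_zero, sub_zero, map_sub, P.aF, Units.val_mk0, chip_prime _ _ p.2]
      change _ = DirectSum.of (fun p : Nat.Primes => ZMod (oddPart ((p : ℕ) + 1))) p z q + DirectSum.of (fun p : Nat.Primes => ZMod (oddPart ((p : ℕ) + 1))) p z q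
      by_cases e : p = q
      · subst e
        rw [if_pos rfl, DirectSum.of_eq_same, hy, neg_smul, one_smul, sub_neg_eq_add]
      · rw [if_neg (fun h => e (Subtype.ext h)), DirectSum.of_eq_of_ne _ _ _ (Ne.symm e), one_smul, sub_self, add_zero]
    | add x y hx hy =>
      obtain ⟨a, a1, a2, a3⟩ := hx
      obtain ⟨b, b1, b2, b3⟩ := hy
      refine ⟨a + b, by rw [map_add, a1, b1, add_zero], by rw [map_add, a2, b2, add_zero], ?_⟩
      rw [map_add, a3, b3]; abel
  refine ⟨θ.prod (P.F3.prod μ), ?_, ?_⟩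
  · intro m hm
    have h1 : θ m = 0 := congrArg Prod.fst hm
    have h2 : P.F3 m = 0 := congrArg (fun z => z.2.1) hm
    have h3 : μ m = 0 := congrArg (fun z => z.2.2) hm
    refine P.ker (fun p => ?_) h2 ((hμ0 m).1 h3)
    have := hθ m p
    rw [hQ, h2, h3, h1, map_zero, map_zero, sub_zero, sub_zero] at this
    exact this.symm
  · rintro ⟨d, a, v⟩
    obtain ⟨m, m1, m2, m3⟩ := dsurj d
    have hs : θ (s3 a + sV v) = 0 := DFinsupp.ext (fun p => by
      rw [hθ, hQ, map_add P.F3, map_add μ, fs3, fV, ms3, mV, add_zero, zero_add, add_sub_cancel_left, sub_self, map_zero]; rfl)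
    refine ⟨m + ((s3 a + sV v) + (s3 a + sV v)), ?_⟩
    refine Prod.ext ?_ (Prod.ext ?_ ?_)
    · simp_all
    · simp_all
    · change μ _ = v + v
      rw [map_add, map_add, map_add, ms3, mV, m2, zero_add, zero_add]

instance : Algebra ℤ ZHalf := by unfold ZHalf; infer_instance
instance : IsLocalization.Away (2 : ℤ) ZHalf := by unfold ZHalf; infer_instance

theorem zh_unit : ∃ u : ZHalf, (2 : ZHalf) * u = 1 := by
  have := IsLocalization.Away.algebraMap_isUnit (S := ZHalf) (2 : ℤ)
  obtain ⟨u, hu⟩ := this.exists_right_inv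
  rw [show algebraMap ℤ ZHalf = Int.castRingHom ZHalf from Subsingleton.elim _ _] at hu
  have h' : ((2 : ℤ) : ZHalf) * u = 1 := hu
  exact ⟨u, by rw [← h']; norm_num⟩

theorem zh_inj : Function.Injective (Int.castRingHom ZHalf) := by
  have := IsLocalization.injective (M := Submonoid.powers (2 : ℤ)) ZHalf
    (powers_le_nonZeroDivisors_of_noZeroDivisors two_ne_zero)
  rwa [show algebraMap ℤ ZHalf = Int.castRingHom ZHalf from Subsingleton.elim _ _] at this

theorem zh_surj (z : ZHalf) : ∃ (k : ℕ) (n : ℤ), (2 ^ k) • z = (n : ZHalf) := by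
  obtain ⟨⟨n, s, k, hs⟩, h⟩ := IsLocalization.surj (Submonoid.powers (2 : ℤ)) z
  refine ⟨k, n, ?_⟩
  simp only at h hs
  rw [← hs] at h
  rw [show algebraMap ℤ ZHalf = Int.castRingHom ZHalf from Subsingleton.elim _ _] at h
  rw [nsmul_eq_mul, mul_comm]
  have h' : z * ((2 ^ k : ℤ) : ZHalf) = (n : ZHalf) := h
  rw [← h']; push_cast; rfl

abbrev TGT := DD2 × ZMod 3 × (ℕ →₀ ZHalf)

theorem tt_tf : TF2 TGT := by
  rintro ⟨d, a, v⟩ h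
  have h1 : d + d = 0 := congrArg Prod.fst h
  have h2 : a + a = 0 := congrArg (fun z => z.2.1) h
  have h3 : v + v = 0 := congrArg (fun z => z.2.2) h
  obtain ⟨u, hu⟩ := zh_unit
  refine Prod.ext (dd_tf d h1) (Prod.ext ?_ ?_)
  · have key : ∀ a : ZMod 3, a + a = 0 → a = 0 := by decide
    exact key a h2
  · ext n
    have := DFunLike.congr_fun h3 n
    change v n + v n = 0 at this
    change v n = 0
    linear_combination u * this - v n * hu

theorem tt_half (t : TGT) : ∃ u, u + u = t := by
  obtain ⟨d, a, v⟩ := t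
  obtain ⟨d', hd⟩ := dd_half d
  obtain ⟨u, hu⟩ := zh_unit
  refine ⟨(d', -a, v.mapRange (fun z => u * z) (mul_zero u)), Prod.ext hd (Prod.ext ?_ ?_)⟩
  · change -a + -a = a
    revert a; decide
  · ext n
    change u * v n + u * v n = v n
    linear_combination v n * hu

theorem final : Nonempty (RPQhalf ≃+ TGT) := by
  obtain ⟨P⟩ := pack_exists
  obtain ⟨Ψ, hk, hs⟩ := P.theta
  let c : (ℕ →₀ ℤ) →+ (ℕ →₀ ZHalf) := Finsupp.mapRange.addMonoidHom (Int.castRingHom ZHalf).toAddMonoidHom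
  have hc : ∀ v n, c v n = ((v n : ℤ) : ZHalf) := fun v n => rfl
  let κ : DD2 × ZMod 3 × (ℕ →₀ ℤ) →+ TGT := (AddMonoidHom.id _).prodMap ((AddMonoidHom.id _).prodMap c)
  have κinj : Function.Injective κ := by
    rintro ⟨d, a, v⟩ ⟨d', a', v'⟩ h
    have h1 : d = d' := congrArg Prod.fst h
    have h2 : a = a' := congrArg (fun z => z.2.1) h
    have h3 : c v = c v' := congrArg (fun z => z.2.2) h
    refine Prod.ext h1 (Prod.ext h2 ?_)
    ext n
    exact zh_inj (DFunLike.congr_fun h3 n)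
  have csurj : ∀ v : ℕ →₀ ZHalf, ∃ (k : ℕ) (w : ℕ →₀ ℤ), c w = (2 ^ k) • v := by
    intro v
    induction v using Finsupp.induction_linear with
    | zero => exact ⟨0, 0, by rw [map_zero, smul_zero]⟩
    | add x y hx hy =>
      obtain ⟨k, w, hw⟩ := hx
      obtain ⟨l, w', hw'⟩ := hy
      refine ⟨k + l, 2 ^ l • w + 2 ^ k • w', ?_⟩
      rw [map_add, map_nsmul, map_nsmul, hw, hw', smul_smul, smul_smul, ← pow_add, ← pow_add, add_comm l k, smul_add]
    | single n z =>
      obtain ⟨k, m, hm⟩ := zh_surj z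
      refine ⟨k, Finsupp.single n m, ?_⟩
      rw [Finsupp.smul_single, hm]
      exact Finsupp.mapRange_single (hf := map_zero _)
  have κsurj : ∀ t : TGT, ∃ (k : ℕ) (w : _), κ w = (2 ^ k) • t := by
    rintro ⟨d, a, v⟩
    obtain ⟨k, w, hw⟩ := csurj v
    refine ⟨k, (2 ^ k • d, 2 ^ k • a, w), Prod.ext rfl (Prod.ext rfl hw)⟩
  have bij : Function.Bijective (fun t : TGT => (2 : ℤ) • t) := by
    constructor
    · intro a b h
      rw [← sub_eq_zero]
      apply tt_tf
      have h' : (2 : ℤ) • a = (2 : ℤ) • b := h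
      have e : (a - b) + (a - b) = (2 : ℤ) • a - (2 : ℤ) • b := by
        grind
      rw [e, h', sub_self]
    · intro t
      obtain ⟨u, hu⟩ := tt_half t
      exact ⟨u, by rw [← hu]; exact two_zsmul u⟩
  let f : MQ →ₗ[ℤ] TGT := (κ.comp Ψ).toIntLinearMap
  have hf : ∀ m, f m = κ (Ψ m) := fun m => rfl
  have loc : IsLocalizedModule (Submonoid.powers (2 : ℤ)) f := by
    refine ⟨?_, ?_, ?_⟩
    · rintro ⟨_, k, rfl⟩
      change IsUnit (algebraMap ℤ (Module.End ℤ TGT) (2 ^ k))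
      rw [map_pow]
      apply IsUnit.pow
      rw [Module.End.isUnit_iff]
      exact bij
    · intro t
      obtain ⟨k, w, hw⟩ := κsurj t
      obtain ⟨m, hm⟩ := hs w
      refine ⟨⟨m, ⟨2 ^ (k + 1), ⟨k + 1, rfl⟩⟩⟩, ?_⟩
      change (2 ^ (k + 1) : ℤ) • t = f m
      rw [hf, hm, map_add, hw, ← two_nsmul, smul_smul, ← pow_succ', ← natCast_zsmul]
      push_cast
      rfl
    · intro a b h
      have : Ψ (a - b) = 0 := by
        grind
      obtain ⟨k, hk⟩ := hk _ this
      refine ⟨⟨2 ^ k, ⟨k, rfl⟩⟩, ?_⟩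
      change (2 ^ k : ℤ) • a = (2 ^ k : ℤ) • b
      rw [← sub_eq_zero, ← smul_sub, ← hk, ← natCast_zsmul]
      push_cast
      rfl
  let e := IsLocalizedModule.iso (Submonoid.powers (2 : ℤ)) f
  exact ⟨⟨e.toEquiv, fun a b => e.map_add' a b⟩⟩
end fin

/-- As a `ℤ[1/2]`-module, `RP′(ℚ)[1/2]` is isomorphic to
`(⊕_{p prime} ℤ/(p+1)′) ⊕ ℤ/3 ⊕ V` where `V` is a free `ℤ[1/2]`-module of countably
infinite rank.  (Since a `ℤ[1/2]`-module structure on an abelian group is unique when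
it exists, and every additive homomorphism of `ℤ[1/2]`-modules is `ℤ[1/2]`-linear, an
isomorphism of `ℤ[1/2]`-modules is the same thing as an isomorphism of the underlying
abelian groups.) -/
theorem statement19 :
    Nonempty
      (RPQhalf ≃+
        ((DirectSum Nat.Primes fun p => ZMod (oddPart ((p : ℕ) + 1))) ×
          ZMod 3 × (ℕ →₀ ZHalf))) := by
  exact final

end
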